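/- arXiv:0804.0493 — 2 statements merged into one kernel-verified Lean document; each statement's English description precedes it below -/
import Mathlib

section
/- An open Riemann surface is hyperbolic (i.e., admits a Green function) if and only if it carries a negative C^∞ strictly subharmonic function. -/
open Set Metric Filter MeasureTheory Topology

noncomputable section

variable {E : Type*} [NormedAddCommGroup E] [NormedSpace ℂ E]

/-- `f` is an automorphism (biholomorphic self-map) of the domain `Ω`. -/
def IsAutOn (Ω : Set E) (f : E → E) : Prop :=
  DifferentiableOn ℂ f Ω ∧ MapsTo f Ω Ω ∧
    ∃ g : E → E, DifferentiableOn ℂ g Ω ∧ MapsTo g Ω Ω ∧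
      EqOn (g ∘ f) id Ω ∧ EqOn (f ∘ g) id Ω

/-- `Γ` is a group of automorphisms of the domain `Ω`. -/
structure IsAutGroupOn (Ω : Set E) (Γ : Set (E → E)) : Prop where
  aut : ∀ γ ∈ Γ, IsAutOn Ω γ
  id_mem : id ∈ Γ
  comp_mem : ∀ γ ∈ Γ, ∀ σ ∈ Γ, γ ∘ σ ∈ Γ
  inv_mem : ∀ γ ∈ Γ, ∃ σ ∈ Γ, EqOn (σ ∘ γ) id Ω ∧ EqOn (γ ∘ σ) id Ω

/-- `Γ` acts properly discontinuously on `Ω`: for any pair of compact subsets of `Ω`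
only finitely many elements of `Γ` move the first one into the second one. -/
def ProperlyDiscontinuousOn (Ω : Set E) (Γ : Set (E → E)) : Prop :=
  ∀ K₁ K₂ : Set E, K₁ ⊆ Ω → K₂ ⊆ Ω → IsCompact K₁ → IsCompact K₂ →
    {γ ∈ Γ | (γ '' K₁ ∩ K₂).Nonempty}.Finite

/-- The action of `Γ` on `Ω` is free: an element with a fixed point acts as the identity. -/
def FreeActionOn (Ω : Set E) (Γ : Set (E → E)) : Prop :=
  ∀ γ ∈ Γ, (∃ z ∈ Ω, γ z = z) → EqOn γ id Ω

/-- Plurisubharmonicity of an `EReal`-valued function `u` on `Ω`: `u` is upper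
semicontinuous and, on every closed disc inside `Ω` on every complex line, `u` is dominated
by any harmonic function (real part of a holomorphic function) dominating it on the
boundary circle. -/
def IsPSHOn (u : E → EReal) (Ω : Set E) : Prop :=
  UpperSemicontinuousOn u Ω ∧
  ∀ z v : E, ∀ r : ℝ, 0 < r → (∀ w : ℂ, ‖w‖ ≤ r → z + w • v ∈ Ω) →
    ∀ f : ℂ → ℂ, Differentiable ℂ f →
      (∀ w : ℂ, ‖w‖ = r → u (z + w • v) ≤ ((f w).re : EReal)) →
      ∀ w : ℂ, ‖w‖ ≤ r → u (z + w • v) ≤ ((f w).re : EReal)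

/-- Plurisubharmonicity for a real-valued function. -/
def IsPSHOnR (u : E → ℝ) (Ω : Set E) : Prop :=
  IsPSHOn (fun z => (u z : EReal)) Ω

/-- The Laplacian at `0` of `w ↦ u (z + w • v)`, `w ∈ ℂ`; up to the factor `1/4` this is
the Levi form of `u` at `z` evaluated at the direction `v`. -/
def lineLaplacian (u : E → ℝ) (z v : E) : ℝ :=
  deriv (deriv fun t : ℝ => u (z + (t : ℂ) • v)) 0 +
  deriv (deriv fun t : ℝ => u (z + ((t : ℂ) * Complex.I) • v)) 0

/-- Strict plurisubharmonicity (for a `C²` function): the Levi form is positive definite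
at every point of `Ω`. -/
def IsStrictPSHOn (u : E → ℝ) (Ω : Set E) : Prop :=
  ∀ z ∈ Ω, ∀ v : E, v ≠ 0 → 0 < lineLaplacian u z v

/-- The quotient manifold `Ω/Γ` is Stein: `Γ`-invariant holomorphic functions (that is,
holomorphic functions of the quotient) separate the points of the quotient, and the
quotient is holomorphically convex: the holomorphically convex hull (in the quotient) of
any compact set is compact, i.e. is contained in the `Γ`-saturation of a compact subset
of `Ω`. -/
def QuotientIsStein (Ω : Set E) (Γ : Set (E → E)) : Prop :=
  (∀ z ∈ Ω, ∀ w ∈ Ω, (∀ γ ∈ Γ, γ z ≠ w) →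
      ∃ f : E → ℂ, DifferentiableOn ℂ f Ω ∧ (∀ γ ∈ Γ, ∀ x ∈ Ω, f (γ x) = f x) ∧
        f z ≠ f w) ∧
  (∀ K : Set E, K ⊆ Ω → IsCompact K → ∃ L : Set E, L ⊆ Ω ∧ IsCompact L ∧
      {z ∈ Ω | ∀ f : E → ℂ, DifferentiableOn ℂ f Ω →
          (∀ γ ∈ Γ, ∀ x ∈ Ω, f (γ x) = f x) →
          ‖f z‖ ≤ sSup ((fun x => ‖f x‖) '' K)} ⊆ ⋃ γ ∈ Γ, γ '' L)

/-- The quotient manifold `Ω/Γ` possesses a negative `C^∞` strictly plurisubharmonic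
function, i.e. there is a `Γ`-invariant negative `C^∞` strictly plurisubharmonic function
on `Ω`. -/
def QuotientHasNegSPSH (Ω : Set E) (Γ : Set (E → E)) : Prop :=
  ∃ u : E → ℝ, (∀ γ ∈ Γ, ∀ z ∈ Ω, u (γ z) = u z) ∧ (∀ z ∈ Ω, u z < 0) ∧
    ContDiffOn ℝ (⊤ : ℕ∞) u Ω ∧ IsStrictPSHOn u Ω

/-- The pluricomplex Green function of `Ω` with pole `w`. -/
def pcGreen (Ω : Set E) (z w : E) : EReal :=
  sSup {t : EReal | ∃ u : E → EReal, IsPSHOn u Ω ∧ (∀ x ∈ Ω, u x < 0) ∧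
    (∃ C : ℝ, ∀ᶠ x in 𝓝[Ω \ {w}] w, u x ≤ ((Real.log ‖x - w‖ + C : ℝ) : EReal)) ∧
    t = u z}

/-- The pluricomplex Green function of `Ω` with pole `w` exists: it has a logarithmic
pole at `w` and is bounded away from `-∞` outside a neighborhood of `w`. -/
def GreenExistsAt (Ω : Set E) (w : E) : Prop :=
  (∃ C : ℝ, ∀ᶠ z in 𝓝[Ω \ {w}] w,
      ((Real.log ‖z - w‖ - C : ℝ) : EReal) ≤ pcGreen Ω z w ∧
        pcGreen Ω z w ≤ ((Real.log ‖z - w‖ + C : ℝ) : EReal)) ∧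
  ∃ r : ℝ, 0 < r ∧ ∃ C : ℝ, ∀ z ∈ Ω, z ∉ ball w r → ((-C : ℝ) : EReal) ≤ pcGreen Ω z w

/-- `Ω` is pluricomplex hyperbolic. -/
def PlcpxHyperbolic (Ω : Set E) : Prop :=
  ∀ w ∈ Ω, GreenExistsAt Ω w

/-- `Ω` is a Stein domain: it is open, holomorphically convex, and holomorphic functions
separate its points. -/
def IsSteinDomain (Ω : Set E) : Prop :=
  IsOpen Ω ∧
  (∀ K : Set E, K ⊆ Ω → IsCompact K →
      IsCompact {z ∈ Ω | ∀ f : E → ℂ, DifferentiableOn ℂ f Ω →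
        ‖f z‖ ≤ sSup ((fun x => ‖f x‖) '' K)}) ∧
  ∀ z ∈ Ω, ∀ w ∈ Ω, z ≠ w → ∃ f : E → ℂ, DifferentiableOn ℂ f Ω ∧ f z ≠ f w

/-- The pluricomplex Green function of the quotient `Ω/Γ` with pole `π w`, pulled back to
`Ω`: the supremum of all `Γ`-invariant negative plurisubharmonic functions on `Ω` with a
logarithmic pole at `w`. -/
def quotGreen (Ω : Set E) (Γ : Set (E → E)) (z w : E) : EReal :=
  sSup {t : EReal | ∃ u : E → EReal, IsPSHOn u Ω ∧ (∀ x ∈ Ω, u x < 0) ∧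
    (∀ γ ∈ Γ, ∀ x ∈ Ω, u (γ x) = u x) ∧
    (∃ C : ℝ, ∀ᶠ x in 𝓝[Ω \ {w}] w, u x ≤ ((Real.log ‖x - w‖ + C : ℝ) : EReal)) ∧
    t = u z}

/-- The pluricomplex Green function of the quotient `Ω/Γ` with pole `π w` exists. -/
def QuotientGreenExistsAt (Ω : Set E) (Γ : Set (E → E)) (w : E) : Prop :=
  (∃ C : ℝ, ∀ᶠ z in 𝓝[Ω \ {w}] w,
      ((Real.log ‖z - w‖ - C : ℝ) : EReal) ≤ quotGreen Ω Γ z w ∧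
        quotGreen Ω Γ z w ≤ ((Real.log ‖z - w‖ + C : ℝ) : EReal)) ∧
  ∃ r : ℝ, 0 < r ∧ ∃ C : ℝ, ∀ z ∈ Ω, (∀ γ ∈ Γ, γ z ∉ ball w r) →
    ((-C : ℝ) : EReal) ≤ quotGreen Ω Γ z w

/-- The quotient `Ω/Γ` is pluricomplex hyperbolic. -/
def QuotientPlcpxHyperbolic (Ω : Set E) (Γ : Set (E → E)) : Prop :=
  ∀ w ∈ Ω, QuotientGreenExistsAt Ω Γ w

/-- `D` is a fundamental domain for the action of `Γ` on `Ω`. -/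
def IsFundamentalDomainOn (Ω : Set E) (Γ : Set (E → E)) (D : Set E) : Prop :=
  D ⊆ Ω ∧ (∀ z ∈ Ω, ∃ γ ∈ Γ, γ z ∈ D) ∧
    ∀ z ∈ D, ∀ w ∈ D, (∃ γ ∈ Γ, γ z = w) → z = w

/-- The orbit of the point `a` under `Γ`. -/
def orbitOf (Γ : Set (E → E)) (a : E) : Set E := (fun γ : E → E => γ a) '' Γ

/-- The set of cluster (accumulation) points of the orbit of `a` under `Γ`. -/
def clusterPtsOfOrbit (Γ : Set (E → E)) (a : E) : Set E :=
  {b : E | AccPt b (𝓟 (orbitOf Γ a))}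

/-- The limit set of `Γ` acting on the bounded domain `Ω`. -/
def limitSet (Ω : Set E) (Γ : Set (E → E)) : Set E :=
  {w ∈ frontier Ω | ∃ K : Set E, K ⊆ Ω ∧ IsCompact K ∧
    ∃ z : ℕ → E, (∀ k, z k ∈ Ω) ∧ Tendsto z atTop (𝓝 w) ∧
      ∃ γ : ℕ → E → E, (∀ k, γ k ∈ Γ) ∧ ∀ k, γ k (z k) ∈ K}

/-- `ψ` is a barrier at the boundary point `p` of `Ω`. -/
def IsBarrierAt (Ω : Set E) (p : E) (ψ : E → ℝ) : Prop :=
  ContinuousOn ψ (closure Ω) ∧ IsPSHOnR ψ Ω ∧ ψ p = 0 ∧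
    ∀ z ∈ closure Ω, z ≠ p → ψ z < 0

/-- `Ω` is B-regular: there is a barrier at every boundary point. -/
def BRegular (Ω : Set E) : Prop :=
  ∀ p ∈ frontier Ω, ∃ ψ : E → ℝ, IsBarrierAt Ω p ψ

/-- Integer iterates of a map `f` with (two-sided) inverse `g`. -/
def zIter (f g : E → E) : ℤ → E → E
  | Int.ofNat k => f^[k]
  | Int.negSucc k => g^[k + 1]

/-- `Γ` is an (algebraically) cyclic group of automorphisms of `Ω`: it consists of the
integer powers of a single automorphism. -/
def IsCyclicAutGroupOn (Ω : Set E) (Γ : Set (E → E)) : Prop :=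
  ∃ γ ∈ Γ, ∃ γ' ∈ Γ, EqOn (γ' ∘ γ) id Ω ∧ EqOn (γ ∘ γ') id Ω ∧
    (∀ k : ℤ, zIter γ γ' k ∈ Γ) ∧ ∀ σ ∈ Γ, ∃ k : ℤ, EqOn σ (zIter γ γ' k) Ω

/-- The complex Jacobian determinant of `γ` at `z`. -/
def jacDet (γ : E → E) (z : E) : ℂ :=
  LinearMap.det ((fderiv ℂ γ z : E →L[ℂ] E) : E →ₗ[ℂ] E)


/-- The open Riemann surface `Δ/Γ` is hyperbolic, i.e. it admits a Green function: there
is a pole `w` and a `Γ`-invariant negative subharmonic function on `Δ`, not identically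
`-∞`, with a logarithmic pole at `w` (such a function is exactly the pullback of a
negative subharmonic function on `Δ/Γ` with a logarithmic pole, and one exists if and
only if the Green function of `Δ/Γ` exists). -/
def QuotientIsHyperbolic (Γ : Set (ℂ → ℂ)) : Prop :=
  ∃ w ∈ ball (0 : ℂ) 1, ∃ u : ℂ → EReal,
    IsPSHOn u (ball (0 : ℂ) 1) ∧ (∀ z ∈ ball (0 : ℂ) 1, u z < 0) ∧
    (∃ z ∈ ball (0 : ℂ) 1, u z ≠ ⊥) ∧
    (∀ γ ∈ Γ, ∀ z ∈ ball (0 : ℂ) 1, u (γ z) = u z) ∧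
    ∃ C : ℝ, ∀ᶠ z in 𝓝[ball (0 : ℂ) 1 \ {w}] w,
      u z ≤ ((Real.log ‖z - w‖ + C : ℝ) : EReal)

/-! ### The Laplacian along a complex line -/

theorem hasDerivAt_comp_real_line {G : Type*} [NormedAddCommGroup G] [NormedSpace ℂ G]
    {F : ℂ → G} {z d : ℂ} {t : ℝ} (hF : DifferentiableAt ℂ F (z + t * d)) :
    HasDerivAt (fun s : ℝ => F (z + s * d)) (d • deriv F (z + t * d)) t := by
  have h1 : HasDerivAt (fun s : ℝ => z + (s : ℂ) * d) d t := by
    simpa using ((Complex.ofRealCLM.hasDerivAt (x := t)).mul_const d).const_add z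
  exact HasDerivAt.scomp t hF.hasDerivAt h1

theorem tendsto_real_line (z d : ℂ) :
    Tendsto (fun s : ℝ => z + (s : ℂ) * d) (𝓝 0) (𝓝 z) := by
  have : Continuous fun s : ℝ => z + (s : ℂ) * d := by fun_prop
  simpa using this.tendsto 0

theorem deriv_deriv_eq_of_eventually {φ φ' : ℝ → ℝ} {x a : ℝ}
    (h : ∀ᶠ t in 𝓝 x, HasDerivAt φ (φ' t) t) (h' : HasDerivAt φ' a x) :
    deriv (deriv φ) x = a := by
  have : deriv φ =ᶠ[𝓝 x] φ' := h.mono fun t ht => ht.deriv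
  rw [this.deriv_eq, h'.deriv]

theorem deriv_deriv_real_line {u : ℂ → ℝ} {z : ℂ} (hu : ContDiffAt ℝ 2 u z) (d : ℂ) :
    deriv (deriv fun t : ℝ => u (z + t * d)) 0 = fderiv ℝ (fderiv ℝ u) z d d := by
  have hl : ∀ t : ℝ, HasDerivAt (fun s : ℝ => z + (s : ℂ) * d) d t := fun t => by
    simpa using ((Complex.ofRealCLM.hasDerivAt (x := t)).mul_const d).const_add z
  have hd : ∀ᶠ y in 𝓝 z, DifferentiableAt ℝ u y :=
    (hu.eventually (by simp)).mono fun y hy => hy.differentiableAt (by simp)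
  have hfd : DifferentiableAt ℝ (fderiv ℝ u) z :=
    (hu.fderiv_right (m := 1) (by norm_num)).differentiableAt (by simp)
  refine deriv_deriv_eq_of_eventually (φ' := fun t => fderiv ℝ u (z + t * d) d) ?_ ?_
  · filter_upwards [(tendsto_real_line z d).eventually hd] with t ht
    exact ht.hasFDerivAt.comp_hasDerivAt t (hl t)
  · have h0 : HasFDerivAt (fderiv ℝ u) (fderiv ℝ (fderiv ℝ u) z) (z + ((0 : ℝ) : ℂ) * d) := by
      simpa using hfd.hasFDerivAt
    have := h0.comp_hasDerivAt (0 : ℝ) (hl 0)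
    simpa using this.clm_apply (hasDerivAt_const (0 : ℝ) d)

theorem lineLaplacian_eq_fderiv {u : ℂ → ℝ} {z : ℂ} (hu : ContDiffAt ℝ 2 u z) (v : ℂ) :
    lineLaplacian u z v = fderiv ℝ (fderiv ℝ u) z v v +
      fderiv ℝ (fderiv ℝ u) z (Complex.I * v) (Complex.I * v) := by
  simp only [lineLaplacian, smul_eq_mul, mul_assoc]
  rw [deriv_deriv_real_line hu, deriv_deriv_real_line hu]

theorem lineLaplacian_add {u₁ u₂ : ℂ → ℝ} {z : ℂ} (h₁ : ContDiffAt ℝ 2 u₁ z)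
    (h₂ : ContDiffAt ℝ 2 u₂ z) (v : ℂ) :
    lineLaplacian (fun x => u₁ x + u₂ x) z v = lineLaplacian u₁ z v + lineLaplacian u₂ z v := by
  have e : fderiv ℝ (fun x => u₁ x + u₂ x) =ᶠ[𝓝 z] fun x => fderiv ℝ u₁ x + fderiv ℝ u₂ x := by
    filter_upwards [h₁.eventually (by simp), h₂.eventually (by simp)] with y hy₁ hy₂
    exact fderiv_fun_add (hy₁.differentiableAt (by simp)) (hy₂.differentiableAt (by simp))
  have d₁ : DifferentiableAt ℝ (fderiv ℝ u₁) z :=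
    (h₁.fderiv_right (m := 1) (by norm_num)).differentiableAt (by simp)
  have d₂ : DifferentiableAt ℝ (fderiv ℝ u₂) z :=
    (h₂.fderiv_right (m := 1) (by norm_num)).differentiableAt (by simp)
  rw [lineLaplacian_eq_fderiv h₁, lineLaplacian_eq_fderiv h₂, lineLaplacian_eq_fderiv (h₁.add h₂),
    e.fderiv_eq, fderiv_fun_add d₁ d₂]
  simp only [add_apply]
  ring

theorem lineLaplacian_const_mul (u : ℂ → ℝ) (z v : ℂ) (c : ℝ) :
    lineLaplacian (fun x => c * u x) z v = c * lineLaplacian u z v := by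
  simp only [lineLaplacian, deriv_const_mul_field']
  ring

theorem lineLaplacian_congr {u₁ u₂ : ℂ → ℝ} {z : ℂ} (h : u₁ =ᶠ[𝓝 z] u₂) (v : ℂ) :
    lineLaplacian u₁ z v = lineLaplacian u₂ z v := by
  have key : ∀ d : ℂ, deriv (deriv fun t : ℝ => u₁ (z + t * d)) 0 =
      deriv (deriv fun t : ℝ => u₂ (z + t * d)) 0 := fun d =>
    EventuallyEq.deriv_eq (EventuallyEq.deriv ((tendsto_real_line z d).eventually h))
  simp only [lineLaplacian, smul_eq_mul, mul_assoc, key]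

theorem lineLaplacian_norm_sq {H : Type*} [NormedAddCommGroup H] [InnerProductSpace ℂ H]
    [CompleteSpace H] {F : ℂ → H} {z : ℂ} (hF : ∀ᶠ x in 𝓝 z, DifferentiableAt ℂ F x) (v : ℂ) :
    lineLaplacian (fun x => ‖F x‖ ^ 2) z v = 4 * ‖v‖ ^ 2 * ‖deriv F z‖ ^ 2 := by
  have hF' : DifferentiableAt ℂ (deriv F) z :=
    ((Complex.analyticAt_iff_eventually_differentiableAt).2 hF).deriv.differentiableAt
  have key : ∀ d : ℂ, deriv (deriv fun t : ℝ => ‖F (z + t * d)‖ ^ 2) 0 =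
      2 * (d ^ 2 * inner ℂ (F z) (deriv (deriv F) z)).re + 2 * ‖d‖ ^ 2 * ‖deriv F z‖ ^ 2 := by
    intro d
    refine deriv_deriv_eq_of_eventually
      (φ' := fun t => 2 * (inner ℂ (F (z + t * d)) (d • deriv F (z + t * d))).re) ?_ ?_
    · filter_upwards [(tendsto_real_line z d).eventually hF] with t ht
      have h := hasDerivAt_comp_real_line ht
      have h2 := Complex.reCLM.hasFDerivAt.comp_hasDerivAt t (h.inner ℂ h)
      have e : (fun s : ℝ => ‖F (z + s * d)‖ ^ 2) =
          Complex.reCLM ∘ fun s : ℝ => inner ℂ (F (z + s * d)) (F (z + s * d)) := by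
        ext s
        simpa using (inner_self_eq_norm_sq (𝕜 := ℂ) (F (z + s * d))).symm
      rw [e]
      refine h2.congr_deriv ?_
      have : (inner ℂ (F (z + t * d)) (d • deriv F (z + t * d))).re =
          (inner ℂ (d • deriv F (z + t * d)) (F (z + t * d))).re :=
        inner_re_symm (𝕜 := ℂ) _ _
      simp only [Complex.reCLM_apply, Complex.add_re]
      rw [← this]
      ring
    · have h := hasDerivAt_comp_real_line (F := F) (z := z) (d := d) (t := 0)
        (by simpa using hF.self_of_nhds)
      have h' := (hasDerivAt_comp_real_line (F := deriv F) (z := z) (d := d) (t := 0)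
        (by simpa using hF')).const_smul d
      have h2 := (Complex.reCLM.hasFDerivAt.comp_hasDerivAt 0 (h.inner ℂ h')).const_mul 2
      refine h2.congr_deriv ?_
      have e : (inner ℂ (d • deriv F z) (d • deriv F z)).re = ‖d‖ ^ 2 * ‖deriv F z‖ ^ 2 := by
        have := inner_self_eq_norm_sq (𝕜 := ℂ) (d • deriv F z)
        rw [norm_smul, mul_pow] at this
        simpa using this
      simp only [Pi.smul_apply, Complex.ofReal_zero, zero_mul, add_zero, Complex.reCLM_apply,
        Complex.add_re, e]
      rw [inner_smul_right, inner_smul_right]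
      ring_nf
  simp only [lineLaplacian, smul_eq_mul, mul_assoc, key]
  have hI : (Complex.I * v) ^ 2 = -v ^ 2 := by rw [mul_pow, Complex.I_sq]; ring
  rw [hI, neg_mul, Complex.neg_re, norm_mul, Complex.norm_I]
  ring

theorem lineLaplacian_re {f : ℂ → ℂ} {z : ℂ} (hf : AnalyticAt ℂ f z) (v : ℂ) :
    lineLaplacian (fun x => (f x).re) z v = 0 := by
  have hF := hf.eventually_analyticAt
  have hF' : DifferentiableAt ℂ (deriv f) z := hf.deriv.differentiableAt
  have key : ∀ d : ℂ, deriv (deriv fun t : ℝ => (f (z + t * d)).re) 0 =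
      (d ^ 2 * deriv (deriv f) z).re := by
    intro d
    refine deriv_deriv_eq_of_eventually (φ' := fun t => (d • deriv f (z + t * d)).re) ?_ ?_
    · filter_upwards [(tendsto_real_line z d).eventually hF] with t ht
      exact Complex.reCLM.hasFDerivAt.comp_hasDerivAt t
        (hasDerivAt_comp_real_line ht.differentiableAt)
    · have h' := (hasDerivAt_comp_real_line (F := deriv f) (z := z) (d := d) (t := 0)
        (by simpa using hF')).const_smul d
      refine (Complex.reCLM.hasFDerivAt.comp_hasDerivAt 0 h').congr_deriv ?_
      simp [pow_two, mul_assoc]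
  simp only [lineLaplacian, smul_eq_mul, mul_assoc, key]
  have hI : (Complex.I * v) ^ 2 = -v ^ 2 := by rw [mul_pow, Complex.I_sq]; ring
  rw [hI, neg_mul, Complex.neg_re]
  ring

/-- At a local maximum the Laplacian of a `C²` function is not positive. -/
theorem IsLocalMax.lineLaplacian_nonpos {u : ℂ → ℝ} {z : ℂ} (h : IsLocalMax u z)
    (hu : ContDiffAt ℝ 2 u z) (v : ℂ) : lineLaplacian u z v ≤ 0 := by
  have key : ∀ d : ℂ, deriv (deriv fun t : ℝ => u (z + t * d)) 0 ≤ 0 := by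
    intro d
    by_contra! hpos
    set φ := fun t : ℝ => u (z + t * d) with hφ
    have hmax : IsLocalMax φ 0 := by
      have := (tendsto_real_line z d).eventually h
      simpa [IsLocalMax, IsMaxFilter, hφ] using this
    have hc : ContinuousAt φ 0 := by
      have h1 : ContinuousAt u (z + ((0 : ℝ) : ℂ) * d) := by simpa using hu.continuousAt
      exact ContinuousAt.comp (f := fun s : ℝ => z + (s : ℂ) * d) h1 (by fun_prop)
    have hmin := isLocalMin_of_deriv_deriv_pos hpos hmax.deriv_eq_zero hc
    have he : φ =ᶠ[𝓝 0] fun _ => φ 0 := by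
      filter_upwards [hmax, hmin] with t h1 h2 using le_antisymm h1 h2
    have h0 : deriv (deriv φ) 0 = 0 := by
      rw [he.deriv.deriv_eq]; simp
    exact hpos.ne' h0
  simp only [lineLaplacian, smul_eq_mul, mul_assoc]
  exact add_nonpos (key _) (key _)

/-! ### Comparison with harmonic functions -/

theorem EReal.add_coe_le_coe_iff (x : EReal) (a b : ℝ) :
    x + (a : EReal) ≤ (b : EReal) ↔ x ≤ ((b - a : ℝ) : EReal) := by
  induction x with
  | bot => simp
  | top => simp only [EReal.top_add_coe, top_le_iff, EReal.coe_ne_top]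
  | coe x => norm_cast; exact _root_.le_sub_iff_add_le.symm

theorem EReal.exists_coe_eq {x : EReal} (h : x ≠ ⊥) (h' : x ≠ ⊤) : ∃ a : ℝ, x = (a : EReal) :=
  ⟨x.toReal, (EReal.coe_toReal h' h).symm⟩

/-- No function harmonic near `p` touches `u` from above at `p`. -/
def NoHarmonicTouch (u : ℂ → EReal) (p : ℂ) : Prop :=
  ∀ f : ℂ → ℂ, AnalyticAt ℂ f p → u p = ((f p).re : EReal) →
    ¬ ∀ᶠ z in 𝓝 p, u z ≤ ((f z).re : EReal)

theorem noHarmonicTouch_of_eq_bot {u : ℂ → EReal} {p : ℂ} (h : u p = ⊥) :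
    NoHarmonicTouch u p := by
  intro f _ hf
  rw [h] at hf
  exact absurd hf.symm (EReal.coe_ne_bot _)

theorem NoHarmonicTouch.add_re {u : ℂ → EReal} {p : ℂ} (hu : NoHarmonicTouch u p)
    {h : ℂ → ℝ} {g : ℂ → ℂ} (hg : AnalyticAt ℂ g p) (hh : ∀ᶠ z in 𝓝 p, h z = (g z).re) :
    NoHarmonicTouch (fun z => u z + (h z : EReal)) p := by
  intro f hf hp hle
  change u p + (h p : EReal) = _ at hp
  have hhp := hh.self_of_nhds
  refine hu (fun z => f z - g z) (hf.sub hg) ?_ ?_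
  · refine le_antisymm ?_ ?_
    · have := (EReal.add_coe_le_coe_iff _ _ _).1 hp.le
      simpa [hhp] using this
    · have h0 : u p ≠ ⊥ := by
        intro h0
        rw [h0, EReal.bot_add] at hp
        exact absurd hp.symm (EReal.coe_ne_bot _)
      have h1 : u p ≠ ⊤ := by
        intro h1
        rw [h1, EReal.top_add_coe] at hp
        exact absurd hp.symm (EReal.coe_ne_top _)
      obtain ⟨a, ha⟩ := EReal.exists_coe_eq h0 h1
      rw [ha] at hp ⊢
      norm_cast at hp ⊢
      simp only [Complex.sub_re]
      linarith
  · filter_upwards [hh, hle] with z h1 h2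
    have := (EReal.add_coe_le_coe_iff _ _ _).1 h2
    simpa [h1] using this

theorem NoHarmonicTouch.comp {u V : ℂ → EReal} {p : ℂ} {γ σ : ℂ → ℂ}
    (hV : NoHarmonicTouch V (γ p)) (huV : ∀ᶠ z in 𝓝 p, u z = V (γ z))
    (hσ : AnalyticAt ℂ σ (γ p)) (hp : σ (γ p) = p)
    (hγσ : ∀ᶠ y in 𝓝 (γ p), γ (σ y) = y) : NoHarmonicTouch u p := by
  intro f hf hfp hle
  refine hV (f ∘ σ) (AnalyticAt.comp (by rwa [hp]) hσ) ?_ ?_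
  · simp only [Function.comp_apply, hp]
    rw [← hfp, huV.self_of_nhds]
  · have ht : Tendsto σ (𝓝 (γ p)) (𝓝 p) := by simpa [hp] using hσ.continuousAt.tendsto
    filter_upwards [hγσ, ht.eventually huV, ht.eventually hle] with y h1 h2 h3
    rw [← h1, ← h2, h1]
    exact h3

/-- A function touched from below by a `C²` function with positive Laplacian is not touched from
above by a harmonic function. -/
theorem noHarmonicTouch_of_lower {u : ℂ → EReal} {φ : ℂ → ℝ} {p : ℂ} (hφ : ContDiffAt ℝ 2 φ p)
    (hpos : 0 < lineLaplacian φ p 1) (hp : (φ p : EReal) = u p)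
    (hle : ∀ᶠ z in 𝓝 p, (φ z : EReal) ≤ u z) : NoHarmonicTouch u p := by
  intro f hf hfp hfle
  have hre : ∀ g : ℂ → ℂ, AnalyticAt ℂ g p → ContDiffAt ℝ 2 (fun z => (g z).re) p := fun g hg =>
    Complex.reCLM.contDiff.contDiffAt.comp p (hg.contDiffAt.restrict_scalars ℝ)
  have hmax : IsLocalMax (fun z => φ z + (-f z).re) p := by
    have h0 : φ p = (f p).re := by exact_mod_cast hp.trans hfp
    filter_upwards [hle, hfle] with z h1 h2
    have : φ z ≤ (f z).re := by exact_mod_cast h1.trans h2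
    simp only [Complex.neg_re]
    linarith
  have h1 := hmax.lineLaplacian_nonpos (hφ.add (hre _ hf.neg)) 1
  have h2 := lineLaplacian_add hφ (hre _ hf.neg) 1
  rw [lineLaplacian_re hf.neg 1] at h2
  simp only [Pi.neg_apply] at h2
  linarith

theorem UpperSemicontinuousOn.add_coe {u : ℂ → EReal} {h : ℂ → ℝ} {s : Set ℂ}
    (hu : UpperSemicontinuousOn u s) (hh : ContinuousOn h s) :
    UpperSemicontinuousOn (fun z => u z + (h z : EReal)) s := by
  refine UpperSemicontinuousOn.add' hu ?_ ?_
  · exact (continuous_coe_real_ereal.comp_continuousOn hh).upperSemicontinuousOn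
  · intro x _
    exact EReal.continuousAt_add (Or.inr (EReal.coe_ne_bot _)) (Or.inr (EReal.coe_ne_top _))

theorem le_of_noHarmonicTouch {U : ℂ → EReal} {c : ℂ} {r : ℝ} (hr : 0 < r) {M : ℝ}
    (husc : UpperSemicontinuousOn U (closedBall c r)) (htop : ∀ z ∈ closedBall c r, U z ≠ ⊤)
    (hno : ∀ z ∈ ball c r, NoHarmonicTouch U z) (hM : ∀ z ∈ sphere c r, U z ≤ (M : EReal)) :
    ∀ z ∈ closedBall c r, U z ≤ (M : EReal) := by
  obtain ⟨p, hp, hmax⟩ := husc.exists_isMaxOn (nonempty_closedBall.2 hr.le)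
    (isCompact_closedBall c r)
  intro z hz
  refine (hmax hz).trans ?_
  by_cases hps : p ∈ sphere c r
  · exact hM p hps
  by_cases hbot : U p = ⊥
  · rw [hbot]; exact bot_le
  have hpb : p ∈ ball c r := by
    rw [mem_ball]
    exact lt_of_le_of_ne hp hps
  obtain ⟨a, ha⟩ := EReal.exists_coe_eq hbot (htop p hp)
  refine absurd ?_ (hno p hpb (fun _ => (a : ℂ)) analyticAt_const (by simpa using ha))
  filter_upwards [isOpen_ball.mem_nhds hpb] with y hy
  have := hmax (ball_subset_closedBall hy)
  simpa [ha] using this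

theorem isPSHOn_of_noHarmonicTouch {u : ℂ → EReal} {Ω : Set ℂ}
    (husc : UpperSemicontinuousOn u Ω) (htop : ∀ z ∈ Ω, u z ≠ ⊤)
    (hno : ∀ z ∈ Ω, NoHarmonicTouch u z) : IsPSHOn u Ω := by
  refine ⟨husc, fun z v r hr hΩ f hf hb => ?_⟩
  by_cases hv : v = 0
  · subst hv
    simp only [smul_zero, add_zero] at hb hΩ ⊢
    intro w hw
    by_cases hbot : u z = ⊥
    · rw [hbot]; exact bot_le
    obtain ⟨a, ha⟩ := EReal.exists_coe_eq hbot (htop z (hΩ 0 (by simpa using hr.le)))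
    rw [ha] at hb ⊢
    have h1 : ‖Complex.exp (-f w)‖ ≤ Real.exp (-a) := by
      refine Complex.norm_le_of_forall_mem_frontier_norm_le (U := ball (0 : ℂ) r) isBounded_ball
        (f := fun x => Complex.exp (-f x)) (hf.neg.cexp.diffContOnCl) ?_ ?_
      · intro y hy
        rw [frontier_ball _ hr.ne', mem_sphere_zero_iff_norm] at hy
        have : a ≤ (f y).re := by exact_mod_cast hb y hy
        simpa [Complex.norm_exp] using this
      · rw [closure_ball _ hr.ne']
        simpa using hw
    have : a ≤ (f w).re := by simpa [Complex.norm_exp] using h1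
    exact_mod_cast this
  · have hmaps : MapsTo (fun w : ℂ => z + w * v) (closedBall 0 r) Ω := fun w hw => by
      simpa using hΩ w (by simpa using hw)
    have husc' : UpperSemicontinuousOn (fun w => u (z + w * v)) (closedBall (0 : ℂ) r) :=
      UpperSemicontinuousOn.comp husc (by fun_prop) hmaps
    have key := le_of_noHarmonicTouch (U := fun w => u (z + w * v) + ((-(f w).re : ℝ) : EReal))
      hr (M := 0) (husc'.add_coe (by
        have := hf.continuous
        fun_prop)) ?_ ?_ ?_
    · intro w hw
      have := (EReal.add_coe_le_coe_iff _ _ _).1 (key w (by simpa using hw))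
      simpa using this
    · intro w hw
      obtain h | h := eq_or_ne (u (z + w * v)) ⊥
      · simp [h]
      · obtain ⟨a, ha⟩ := EReal.exists_coe_eq h (htop _ (hmaps hw))
        rw [ha]
        exact_mod_cast EReal.coe_ne_top _
    · intro w hw
      have h1 : NoHarmonicTouch (fun w => u (z + w * v)) w := by
        refine NoHarmonicTouch.comp (V := u) (γ := fun w => z + w * v)
          (σ := fun y => (y - z) / v) (hno _ (hmaps (ball_subset_closedBall hw)))
          (Eventually.of_forall fun _ => rfl) ?_ ?_ (Eventually.of_forall fun y => ?_)
        · exact (Differentiable.analyticAt (by fun_prop) _)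
        · simp [hv]
        · simp [hv]
      exact h1.add_re (g := fun w => -f w) (hf.neg.analyticAt w)
        (Eventually.of_forall fun _ => by simp)
    · intro w hw
      have := hb w (by simpa using hw)
      rw [EReal.add_coe_le_coe_iff]
      simpa using this

theorem IsPSHOn.noHarmonicTouch_add_norm_sq {u : ℂ → EReal} {Ω : Set ℂ} (hu : IsPSHOn u Ω)
    (hΩ : IsOpen Ω) {p : ℂ} (hp : p ∈ Ω) {η : ℝ} (hη : 0 < η) :
    NoHarmonicTouch (fun z => u z + ((η * ‖z‖ ^ 2 : ℝ) : EReal)) p := by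
  intro f hf hfp hle
  set g : ℂ → ℂ := fun z => f z - 2 * η * (starRingEnd ℂ p) * z + η * ‖p‖ ^ 2 with hg
  have hnorm : ∀ z : ℂ, (f z).re - η * ‖z‖ ^ 2 = (g z).re - η * ‖z - p‖ ^ 2 := by
    intro z
    have h2 : ((η : ℂ) * ‖p‖ ^ 2).re = η * ‖p‖ ^ 2 := by norm_cast
    simp only [hg, Complex.add_re, Complex.sub_re, h2, Complex.sq_norm, Complex.normSq_apply,
      Complex.mul_re, Complex.mul_im, Complex.conj_re, Complex.conj_im, Complex.ofReal_re,
      Complex.ofReal_im, Complex.sub_im, Complex.re_ofNat, Complex.im_ofNat]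
    ring
  have hga : AnalyticAt ℂ g p := by
    refine (hf.sub ?_).add analyticAt_const
    exact analyticAt_const.mul analyticAt_id
  obtain ⟨P, hP⟩ := hga
  obtain ⟨C, hCpos, hC⟩ := (hP.isBigO_sub_partialSum_pow 3).exists_pos
  rw [Asymptotics.isBigOWith_iff] at hC
  have hq : Differentiable ℂ (P.partialSum 3) := by
    have : P.partialSum 3 = fun y => ∑ k ∈ Finset.range 3, y ^ k • P.coeff k := by
      ext y
      simp [FormalMultilinearSeries.partialSum]
    rw [this]
    fun_prop
  have hq0 : P.partialSum 3 0 = g p := by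
    have := hC.self_of_nhds
    simp only [add_zero, norm_zero, norm_pow] at this
    have h0 : ‖g p - P.partialSum 3 0‖ ≤ 0 := by simpa using this
    exact (sub_eq_zero.1 (norm_le_zero_iff.1 h0)).symm
  have hev : ∀ᶠ y in 𝓝 (0 : ℂ), u (p + y) ≤ (((f (p + y)).re - η * ‖p + y‖ ^ 2 : ℝ) : EReal) ∧
      p + y ∈ Ω ∧ ‖g (p + y) - P.partialSum 3 y‖ ≤ C * ‖‖y‖ ^ 3‖ := by
    have ht : Tendsto (fun y : ℂ => p + y) (𝓝 0) (𝓝 p) := by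
      have : Continuous fun y : ℂ => p + y := by fun_prop
      simpa using this.tendsto 0
    filter_upwards [ht.eventually hle, ht.eventually (hΩ.mem_nhds hp), hC] with y h1 h2 h3
    exact ⟨(EReal.add_coe_le_coe_iff _ _ _).1 h1, h2, h3⟩
  obtain ⟨δ, hδ, hδb⟩ := Metric.eventually_nhds_iff.1 hev
  obtain ⟨r, hr, hrlt⟩ := exists_between (lt_min hδ (div_pos hη hCpos))
  have hrδ := hrlt.trans_le (min_le_left _ _)
  have hrC : C * r < η := by
    have := hrlt.trans_le (min_le_right _ _)
    rwa [lt_div_iff₀ hCpos, mul_comm] at this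
  have hball : ∀ w : ℂ, ‖w‖ ≤ r → dist w 0 < δ := fun w hw => by
    simpa using hw.trans_lt hrδ
  have := hu.2 p 1 r hr (fun w hw => by simpa using (hδb (hball w hw)).2.1)
    (fun w => P.partialSum 3 w + ((C * r ^ 3 - η * r ^ 2 : ℝ) : ℂ)) (hq.add_const _) ?_ 0
    (by simpa using hr.le)
  · simp only [zero_smul, add_zero, hq0] at this
    have h1 := (EReal.add_coe_le_coe_iff (u p) (η * ‖p‖ ^ 2)
      ((g p).re + (C * r ^ 3 - η * r ^ 2) + η * ‖p‖ ^ 2)).2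
      (by rwa [add_sub_cancel_right, ← Complex.ofReal_re (C * r ^ 3 - η * r ^ 2),
        ← Complex.add_re])
    change u p + ((η * ‖p‖ ^ 2 : ℝ) : EReal) = _ at hfp
    rw [hfp] at h1
    have h2 : (f p).re ≤ _ := EReal.coe_le_coe_iff.1 h1
    have h3 := hnorm p
    simp only [sub_self, norm_zero] at h3
    have h4 : C * r * r ^ 2 < η * r ^ 2 := by gcongr
    nlinarith
  · intro w hw
    obtain ⟨h1, -, h3⟩ := hδb (hball w hw.le)
    simp only [smul_eq_mul, mul_one]
    refine h1.trans ?_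
    rw [hnorm]
    have h4 := (Complex.abs_re_le_norm _).trans h3
    rw [norm_pow, norm_norm, hw, Complex.sub_re] at h4
    have h5 := (abs_le.1 h4).2
    simp only [add_sub_cancel_left, hw, Complex.add_re, Complex.ofReal_re]
    exact_mod_cast (by linarith)

/-- The logarithm of the modulus of a nonvanishing analytic function is locally the real part of
an analytic function. -/
theorem AnalyticAt.exists_log_norm_eq_re {b : ℂ → ℂ} {p : ℂ} (hb : AnalyticAt ℂ b p)
    (h0 : b p ≠ 0) :
    ∃ g : ℂ → ℂ, AnalyticAt ℂ g p ∧ ∀ᶠ z in 𝓝 p, Real.log ‖b z‖ = (g z).re := by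
  refine ⟨fun z => Complex.log (b z / b p) + Real.log ‖b p‖, ?_, ?_⟩
  · refine AnalyticAt.add (AnalyticAt.clog (hb.div analyticAt_const h0) ?_) analyticAt_const
    simp [h0]
  · filter_upwards [hb.continuousAt.eventually_ne h0] with z hz
    rw [Complex.add_re, Complex.log_re, Complex.ofReal_re, norm_div,
      Real.log_div (norm_ne_zero_iff.2 hz) (norm_ne_zero_iff.2 h0)]
    ring

/-! ### Blaschke factors -/

/-- The automorphism of the unit disc sending `a` to `0`. -/
def blaschke (a z : ℂ) : ℂ := (z - a) / (1 - starRingEnd ℂ a * z)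

theorem blaschke_denom_pos {a z : ℂ} (hz : ‖z‖ ≤ 1) :
    1 - ‖a‖ ≤ ‖1 - starRingEnd ℂ a * z‖ := by
  have h1 : ‖starRingEnd ℂ a * z‖ ≤ ‖a‖ := by
    rw [norm_mul, RCLike.norm_conj]
    exact mul_le_of_le_one_right (norm_nonneg _) hz
  have h2 := norm_sub_norm_le (1 : ℂ) (starRingEnd ℂ a * z)
  rw [norm_one] at h2
  linarith

theorem blaschke_denom_ne_zero {a z : ℂ} (ha : ‖a‖ < 1) (hz : ‖z‖ ≤ 1) :
    1 - starRingEnd ℂ a * z ≠ 0 := by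
  rw [← norm_pos_iff]
  linarith [blaschke_denom_pos (a := a) hz]

theorem one_sub_norm_blaschke_sq {a z : ℂ} (ha : ‖a‖ < 1) (hz : ‖z‖ ≤ 1) :
    1 - ‖blaschke a z‖ ^ 2 =
      (1 - ‖a‖ ^ 2) * (1 - ‖z‖ ^ 2) / ‖1 - starRingEnd ℂ a * z‖ ^ 2 := by
  have h : ‖1 - starRingEnd ℂ a * z‖ ≠ 0 := norm_ne_zero_iff.2 (blaschke_denom_ne_zero ha hz)
  have h2 : ‖1 - starRingEnd ℂ a * z‖ ^ 2 - ‖z - a‖ ^ 2 = (1 - ‖a‖ ^ 2) * (1 - ‖z‖ ^ 2) := by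
    simp only [Complex.sq_norm, Complex.normSq_apply, Complex.sub_re, Complex.sub_im,
      Complex.mul_re, Complex.mul_im, Complex.conj_re, Complex.conj_im, Complex.one_re,
      Complex.one_im]
    ring
  rw [blaschke, norm_div, div_pow, ← h2, sub_div, div_self (pow_ne_zero 2 h)]

theorem norm_blaschke_lt_one {a z : ℂ} (ha : ‖a‖ < 1) (hz : ‖z‖ < 1) : ‖blaschke a z‖ < 1 := by
  have h := one_sub_norm_blaschke_sq ha hz.le
  have h1 : 0 < ‖1 - starRingEnd ℂ a * z‖ :=
    norm_pos_iff.2 (blaschke_denom_ne_zero ha hz.le)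
  have h2 : 0 < 1 - ‖a‖ ^ 2 := by nlinarith [norm_nonneg a]
  have h3 : 0 < 1 - ‖z‖ ^ 2 := by nlinarith [norm_nonneg z]
  have : 0 < 1 - ‖blaschke a z‖ ^ 2 := by rw [h]; positivity
  nlinarith [norm_nonneg (blaschke a z)]

theorem le_one_sub_norm_blaschke_sq {a z : ℂ} (ha : ‖a‖ < 1) (hz : ‖z‖ < 1) :
    (1 - ‖a‖ ^ 2) * (1 - ‖z‖ ^ 2) / 4 ≤ 1 - ‖blaschke a z‖ ^ 2 := by
  have h1 : 0 < ‖1 - starRingEnd ℂ a * z‖ :=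
    norm_pos_iff.2 (blaschke_denom_ne_zero ha hz.le)
  have h2 : 0 < 1 - ‖a‖ ^ 2 := by nlinarith [norm_nonneg a]
  have h3 : 0 < 1 - ‖z‖ ^ 2 := by nlinarith [norm_nonneg z]
  have h4 : ‖1 - starRingEnd ℂ a * z‖ ≤ 2 := by
    refine (norm_sub_le _ _).trans ?_
    rw [norm_one, norm_mul, RCLike.norm_conj]
    nlinarith [norm_nonneg a, norm_nonneg z]
  rw [one_sub_norm_blaschke_sq ha hz.le]
  gcongr
  nlinarith

theorem analyticAt_blaschke {a z : ℂ} (ha : ‖a‖ < 1) (hz : ‖z‖ ≤ 1) :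
    AnalyticAt ℂ (blaschke a) z := by
  refine AnalyticAt.div ?_ ?_ (blaschke_denom_ne_zero ha hz)
  · exact analyticAt_id.sub analyticAt_const
  · exact analyticAt_const.sub (analyticAt_const.mul analyticAt_id)

theorem blaschke_ne_zero {a z : ℂ} (ha : ‖a‖ < 1) (hz : ‖z‖ ≤ 1) (h : z ≠ a) :
    blaschke a z ≠ 0 :=
  div_ne_zero (sub_ne_zero.2 h) (blaschke_denom_ne_zero ha hz)

theorem blaschke_self (a : ℂ) : blaschke a a = 0 := by simp [blaschke]

theorem blaschke_neg_blaschke {a z : ℂ} (ha : ‖a‖ < 1) (hz : ‖z‖ < 1) :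
    blaschke (-a) (blaschke a z) = z := by
  have h0 := blaschke_denom_ne_zero ha hz.le
  have h2 : 1 - starRingEnd ℂ (-a) * blaschke a z ≠ 0 :=
    blaschke_denom_ne_zero (by simpa using ha) (norm_blaschke_lt_one ha hz).le
  have hb : blaschke a z * (1 - starRingEnd ℂ a * z) = z - a := div_mul_cancel₀ _ h0
  rw [blaschke, div_eq_iff h2, map_neg]
  refine mul_right_cancel₀ h0 ?_
  linear_combination (1 - starRingEnd ℂ a * z) * hb

theorem norm_blaschke_le_of_mapsTo {γ : ℂ → ℂ} (hd : DifferentiableOn ℂ γ (ball 0 1))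
    (hm : MapsTo γ (ball 0 1) (ball 0 1)) {a z : ℂ} (ha : ‖a‖ < 1) (hz : ‖z‖ < 1) :
    ‖blaschke (γ a) (γ z)‖ ≤ ‖blaschke a z‖ := by
  have hna : ‖-a‖ < 1 := by simpa using ha
  have hm' : ∀ {x : ℂ}, ‖x‖ < 1 → ‖γ x‖ < 1 := fun {x} hx => by
    simpa using hm (show x ∈ ball (0 : ℂ) 1 by simpa using hx)
  have key := Complex.norm_le_norm_of_mapsTo_ball (R := 1) (z := blaschke a z)
    (f := fun ζ => blaschke (γ a) (γ (blaschke (-a) ζ))) ?_ ?_ ?_ (norm_blaschke_lt_one ha hz)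
  · simpa only [blaschke_neg_blaschke ha hz] using key
  · intro ζ hζ
    have hζ' : ‖ζ‖ < 1 := by simpa using hζ
    have h1 := norm_blaschke_lt_one hna hζ'
    have d1 : DifferentiableAt ℂ γ (blaschke (-a) ζ) :=
      hd.differentiableAt (isOpen_ball.mem_nhds (by simpa using h1))
    have d2 := (analyticAt_blaschke (hm' ha) (hm' h1).le).differentiableAt
    exact (d2.comp ζ (d1.comp ζ
      (analyticAt_blaschke hna hζ'.le).differentiableAt)).differentiableWithinAt
  · intro ζ hζ
    have hζ' : ‖ζ‖ < 1 := by simpa using hζ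
    have := norm_blaschke_lt_one (hm' ha) (hm' (norm_blaschke_lt_one hna hζ'))
    simpa using this.le
  · have : blaschke (-a) 0 = a := by simp [blaschke]
    simp only [this, blaschke_self]

theorem IsAutOn.norm_blaschke {γ : ℂ → ℂ} (hγ : IsAutOn (ball (0 : ℂ) 1) γ) {a z : ℂ}
    (ha : ‖a‖ < 1) (hz : ‖z‖ < 1) : ‖blaschke (γ a) (γ z)‖ = ‖blaschke a z‖ := by
  obtain ⟨hd, hm, σ, hd', hm', hl, -⟩ := hγ
  refine le_antisymm (norm_blaschke_le_of_mapsTo hd hm ha hz) ?_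
  have ha' : a ∈ ball (0 : ℂ) 1 := by simpa using ha
  have hz' : z ∈ ball (0 : ℂ) 1 := by simpa using hz
  have := norm_blaschke_le_of_mapsTo hd' hm' (a := γ a) (z := γ z) (by simpa using hm ha')
    (by simpa using hm hz')
  have e1 : σ (γ a) = a := hl ha'
  have e2 : σ (γ z) = z := hl hz'
  rwa [e1, e2] at this

theorem eventually_neg_log_norm_blaschke_le {a : ℂ} (ha : ‖a‖ < 1) {ε : ℝ} (hε : 0 < ε) :
    ∀ᶠ ρ in 𝓝[<] (1 : ℝ), ∀ z : ℂ, ‖z‖ = ρ → -Real.log ‖blaschke a z‖ ≤ ε := by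
  set K := (1 - ‖a‖ ^ 2) / (1 - ‖a‖) ^ 2 with hK
  have ht : Tendsto (fun ρ : ℝ => 1 - K * (1 - ρ ^ 2)) (𝓝[<] 1) (𝓝 1) := by
    have : Continuous fun ρ : ℝ => 1 - K * (1 - ρ ^ 2) := by fun_prop
    simpa using (this.tendsto 1).mono_left nhdsWithin_le_nhds
  have hlt : Real.exp (-(2 * ε)) < 1 := Real.exp_lt_one_iff.2 (by linarith)
  filter_upwards [ht.eventually (lt_mem_nhds hlt), self_mem_nhdsWithin,
    nhdsWithin_le_nhds (lt_mem_nhds (zero_lt_one : (0 : ℝ) < 1))] with ρ h1 h2 h3 z hz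
  have hz1 : ‖z‖ ≤ 1 := hz.trans_le (le_of_lt h2)
  have hpos : 0 < 1 - ‖a‖ := by linarith
  have h4 : 1 - ‖blaschke a z‖ ^ 2 ≤ K * (1 - ρ ^ 2) := by
    rw [one_sub_norm_blaschke_sq ha hz1, hz, hK, div_mul_eq_mul_div]
    have : 0 ≤ 1 - ‖a‖ ^ 2 := by nlinarith [norm_nonneg a]
    have : 0 ≤ 1 - ρ ^ 2 := by nlinarith [show ρ < 1 from h2]
    have := blaschke_denom_pos (a := a) hz1
    gcongr
  have h5 : Real.exp (-(2 * ε)) ≤ ‖blaschke a z‖ ^ 2 := by linarith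
  have h6 := Real.log_le_log (Real.exp_pos _) h5
  rw [Real.log_exp, Real.log_pow] at h6
  push_cast at h6
  linarith

/-! ### Negative subharmonic functions with many logarithmic poles -/

theorem tendsto_log_norm_sub (a : ℂ) :
    Tendsto (fun z : ℂ => Real.log ‖z - a‖) (𝓝[≠] a) atBot := by
  have := Real.tendsto_log_nhdsGT_zero.comp (tendsto_norm_sub_self_nhdsNE a)
  exact this

theorem IsPSHOn.eq_bot_of_log_pole {u : ℂ → EReal} {Ω : Set ℂ} (hu : IsPSHOn u Ω)
    (hΩ : IsOpen Ω) {a : ℂ} (ha : a ∈ Ω) {C : ℝ}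
    (hC : ∀ᶠ z in 𝓝[≠] a, u z ≤ ((Real.log ‖z - a‖ + C : ℝ) : EReal)) : u a = ⊥ := by
  refine EReal.eq_bot_iff_forall_lt _ |>.2 fun M => ?_
  have h1 : ∀ᶠ z in 𝓝[≠] a, Real.log ‖z - a‖ < M - C :=
    (tendsto_log_norm_sub a).eventually (eventually_lt_atBot _)
  have h3 : ∀ᶠ z in 𝓝 a, z ∈ Ω ∧ (z ≠ a → u z ≤ ((Real.log ‖z - a‖ + C : ℝ) : EReal) ∧
      Real.log ‖z - a‖ < M - C) := by
    have := eventually_nhdsWithin_iff.1 (hC.and h1)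
    filter_upwards [hΩ.mem_nhds ha, this] with z h1 h2 using ⟨h1, h2⟩
  obtain ⟨δ, hδ, hb⟩ := Metric.eventually_nhds_iff.1 h3
  obtain ⟨r, hr, hrδ⟩ := exists_between hδ
  have hd : ∀ w : ℂ, dist (a + w • (1 : ℂ)) a = ‖w‖ := fun w => by simp [dist_eq_norm]
  have hrM : Real.log r < M - C := by
    have := (hb (y := a + (r : ℂ) • (1 : ℂ)) (by rw [hd]; simpa [abs_of_pos hr] using hrδ)).2
      (by simp [hr.ne'])
    simpa [abs_of_pos hr] using this.2
  have := hu.2 a 1 r hr (fun w hw => (hb (by rw [hd]; exact hw.trans_lt hrδ)).1)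
    (fun _ => ((Real.log r + C : ℝ) : ℂ)) (differentiable_const _) (fun w hw => ?_) 0
    (by simpa using hr.le)
  · simp only [zero_smul, add_zero, Complex.ofReal_re] at this
    refine this.trans_lt ?_
    exact_mod_cast (by linarith)
  · have hw0 : w ≠ 0 := by rintro rfl; simp at hw; exact hr.ne hw
    have := ((hb (y := a + w • (1 : ℂ)) (by rw [hd, hw]; exact hrδ)).2 (by simpa using hw0)).1
    simpa [hw] using this

/-- A negative subharmonic function on the disc with logarithmic poles is controlled by
a sum of logarithms of Blaschke factors. -/
theorem IsPSHOn.le_sum_log_blaschke {u : ℂ → EReal} (hu : IsPSHOn u (ball (0 : ℂ) 1))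
    (hneg : ∀ z ∈ ball (0 : ℂ) 1, u z < 0) (F : Finset ℂ) (hF : ∀ a ∈ F, ‖a‖ < 1)
    (hpole : ∀ a ∈ F, ∃ C : ℝ, ∀ᶠ z in 𝓝[≠] a, u z ≤ ((Real.log ‖z - a‖ + C : ℝ) : EReal))
    {z₀ : ℂ} (hz₀ : ‖z₀‖ < 1) :
    u z₀ ≤ ((2 + 1 / 2 * ∑ a ∈ F, Real.log ‖blaschke a z₀‖ : ℝ) : EReal) := by
  have hbot : ∀ a ∈ F, u a = ⊥ := fun a ha =>
    let ⟨_, hC⟩ := hpole a ha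
    hu.eq_bot_of_log_pole isOpen_ball (by simpa using hF a ha) hC
  set h : ℂ → ℝ := fun z => -(1 / 2) * ∑ a ∈ F, Real.log ‖blaschke a z‖ with hh
  set U : ℂ → EReal := fun z => (u z + ((1 * ‖z‖ ^ 2 : ℝ) : EReal)) + (h z : EReal) with hU
  obtain ⟨ρ, hρ, hρ1, hρz⟩ : ∃ ρ : ℝ, (∀ a ∈ F, ∀ z : ℂ, ‖z‖ = ρ →
      -Real.log ‖blaschke a z‖ ≤ 2 / (F.card + 1)) ∧ ρ < 1 ∧ ‖z₀‖ < ρ := by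
    have h1 : ∀ᶠ ρ in 𝓝[<] (1 : ℝ), ∀ a ∈ F, ∀ z : ℂ, ‖z‖ = ρ →
        -Real.log ‖blaschke a z‖ ≤ 2 / (F.card + 1) :=
      (Filter.eventually_all_finset F).2 fun a ha =>
        eventually_neg_log_norm_blaschke_le (hF a ha) (by positivity)
    exact (h1.and ((eventually_mem_nhdsWithin (a := (1 : ℝ)) (s := Iio 1)).and
      (nhdsWithin_le_nhds (lt_mem_nhds hz₀)))).exists
  have hρ0 : 0 < ρ := (norm_nonneg _).trans_lt hρz
  have hsub : closedBall (0 : ℂ) ρ ⊆ ball 0 1 := closedBall_subset_ball hρ1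
  have hreal : ∀ p : ℂ, ‖p‖ < 1 → p ∉ F →
      ∃ g : ℂ → ℂ, AnalyticAt ℂ g p ∧ ∀ᶠ z in 𝓝 p, h z = (g z).re := by
    intro p hp hpF
    have : ∀ a ∈ F, ∃ g : ℂ → ℂ, AnalyticAt ℂ g p ∧
        ∀ᶠ z in 𝓝 p, Real.log ‖blaschke a z‖ = (g z).re := fun a ha =>
      (analyticAt_blaschke (hF a ha) hp.le).exists_log_norm_eq_re
        (blaschke_ne_zero (hF a ha) hp.le (by rintro rfl; exact hpF ha))
    choose! g hg hge using this
    refine ⟨fun z => ((-(1 / 2) : ℝ) : ℂ) * ∑ a ∈ F, g a z,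
      analyticAt_const.mul (Finset.analyticAt_fun_sum _ hg), ?_⟩
    filter_upwards [(Filter.eventually_all_finset F).2 hge] with z hz
    rw [Complex.re_ofReal_mul, Complex.re_sum, hh]
    simp only [Finset.sum_congr rfl hz]
  have hmax := le_of_noHarmonicTouch (U := U) (c := 0) hρ0 (M := 2) ?_ ?_ ?_ ?_ z₀
    (by simpa using hρz.le)
  · have h1 := (EReal.add_coe_le_coe_iff _ _ _).1 ((EReal.add_coe_le_coe_iff _ _ _).1 hmax)
    refine h1.trans ?_
    simp only [hh]
    exact_mod_cast (by nlinarith [sq_nonneg ‖z₀‖])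
  · intro p hp
    have hp1 : ‖p‖ < 1 := by simpa using hsub hp
    have hu1 : UpperSemicontinuousOn (fun z => u z + ((1 * ‖z‖ ^ 2 : ℝ) : EReal))
      (closedBall 0 ρ) := (UpperSemicontinuousOn.mono hu.1 hsub).add_coe (by fun_prop)
    by_cases hpF : p ∈ F
    · refine UpperSemicontinuousAt.upperSemicontinuousWithinAt _ ?_
      intro y hy
      obtain ⟨C, hC⟩ := hpole p hpF
      have hy0 : ⊥ < y := by simpa [hU, hbot p hpF] using hy
      obtain ⟨M, -, hM⟩ := EReal.lt_iff_exists_real_btwn.1 hy0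
      set k : ℂ → ℝ := fun z => C + 1 + 1 / 2 * Real.log ‖1 - starRingEnd ℂ p * z‖ -
        1 / 2 * ∑ a ∈ F.erase p, Real.log ‖blaschke a z‖ with hk
      have hkc : ContinuousAt k p := by
        have c1 : ContinuousAt (fun z => Real.log ‖1 - starRingEnd ℂ p * z‖) p := by
          refine ContinuousAt.log (by fun_prop) ?_
          exact norm_ne_zero_iff.2 (blaschke_denom_ne_zero hp1 hp1.le)
        have c2 : ContinuousAt (fun z => ∑ a ∈ F.erase p, Real.log ‖blaschke a z‖) p := by
          refine tendsto_finsetSum _ fun a ha => ?_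
          have haF := Finset.mem_of_mem_erase ha
          exact ContinuousAt.log (analyticAt_blaschke (hF a haF) hp1.le).continuousAt.norm
            (norm_ne_zero_iff.2 (blaschke_ne_zero (hF a haF) hp1.le
              (Finset.ne_of_mem_erase ha).symm))
        exact (continuousAt_const.add (c1.const_mul _)).sub (c2.const_mul _)
      have hlim : Tendsto (fun z => 1 / 2 * Real.log ‖z - p‖ + k z) (𝓝[≠] p) atBot :=
        ((tendsto_log_norm_sub p).const_mul_atBot (by norm_num)).atBot_add
          (hkc.tendsto.mono_left nhdsWithin_le_nhds)
      have hev : ∀ᶠ z in 𝓝[≠] p, U z < y := by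
        filter_upwards [hC, hlim.eventually (eventually_le_atBot M), self_mem_nhdsWithin,
          nhdsWithin_le_nhds (isOpen_ball.mem_nhds (show p ∈ ball (0 : ℂ) 1 by simpa using hp1))]
          with z h1 h2 h3 h4
        have hz1 : ‖z‖ < 1 := by simpa using h4
        refine lt_of_le_of_lt ?_ hM
        rw [hU]
        refine (EReal.add_coe_le_coe_iff _ _ _).2 ((EReal.add_coe_le_coe_iff _ _ _).2
          (h1.trans ?_))
        rw [EReal.coe_le_coe_iff]
        have e1 : Real.log ‖blaschke p z‖ =
            Real.log ‖z - p‖ - Real.log ‖1 - starRingEnd ℂ p * z‖ := by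
          rw [blaschke, norm_div, Real.log_div (norm_ne_zero_iff.2 (sub_ne_zero.2 h3))
            (norm_ne_zero_iff.2 (blaschke_denom_ne_zero hp1 hz1.le))]
        have e2 := Finset.add_sum_erase F (fun a => Real.log ‖blaschke a z‖) hpF
        simp only [hh, ← e2, e1, hk] at h2 ⊢
        nlinarith [norm_nonneg z]
      have := eventually_nhdsWithin_iff.1 hev
      filter_upwards [this] with z hz
      by_cases hzp : z = p
      · rw [hzp]; exact hy
      · exact hz hzp
    · obtain ⟨g, hg, hge⟩ := hreal p hp1 hpF
      have hc : ContinuousAt h p :=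
        (Complex.continuous_re.continuousAt.comp hg.continuousAt).congr
          (hge.mono fun z hz => hz.symm)
      refine UpperSemicontinuousWithinAt.add' (hu1 p hp) ?_ ?_
      · exact (ContinuousAt.comp continuous_coe_real_ereal.continuousAt
          hc).upperSemicontinuousAt.upperSemicontinuousWithinAt _
      · exact EReal.continuousAt_add (Or.inr (EReal.coe_ne_bot _)) (Or.inr (EReal.coe_ne_top _))
  · intro z hz
    have h1 := (hneg z (hsub hz)).ne_top
    obtain h2 | h2 := eq_or_ne (u z) ⊥
    · simp [hU, h2]
    · obtain ⟨a, ha⟩ := EReal.exists_coe_eq h2 h1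
      rw [hU]
      simp only [ha]
      exact_mod_cast EReal.coe_ne_top _
  · intro p hp
    have hpb := hsub (ball_subset_closedBall hp)
    by_cases hpF : p ∈ F
    · exact noHarmonicTouch_of_eq_bot (by simp [hU, hbot p hpF])
    · obtain ⟨g, hg, hge⟩ := hreal p (by simpa using hpb) hpF
      exact (hu.noHarmonicTouch_add_norm_sq isOpen_ball hpb one_pos).add_re hg hge
  · intro z hz
    have hzρ : ‖z‖ = ρ := by simpa using hz
    have h1 := (hneg z (hsub (sphere_subset_closedBall hz))).le
    rw [hU]
    refine (EReal.add_coe_le_coe_iff _ _ _).2 ((EReal.add_coe_le_coe_iff _ _ _).2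
      (h1.trans ?_))
    have h2 : -∑ a ∈ F, Real.log ‖blaschke a z‖ ≤ 2 := by
      rw [← Finset.sum_neg_distrib]
      refine (Finset.sum_le_card_nsmul F _ _ fun a ha => hρ a ha z hzρ).trans ?_
      rw [nsmul_eq_mul, ← mul_div_assoc, div_le_iff₀ (by positivity)]
      linarith
    simp only [hh, hzρ]
    exact_mod_cast (by nlinarith : (0 : ℝ) ≤ 2 - -(1 / 2) * ∑ a ∈ F, Real.log ‖blaschke a z‖ -
      1 * ρ ^ 2)

theorem IsPSHOn.summable_one_sub_norm_sq {u : ℂ → EReal} (hu : IsPSHOn u (ball (0 : ℂ) 1))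
    (hneg : ∀ z ∈ ball (0 : ℂ) 1, u z < 0) {O : Set ℂ} (hO : ∀ a ∈ O, ‖a‖ < 1)
    (hpole : ∀ a ∈ O, ∃ C : ℝ, ∀ᶠ z in 𝓝[≠] a, u z ≤ ((Real.log ‖z - a‖ + C : ℝ) : EReal))
    {z₀ : ℂ} (hz₀ : ‖z₀‖ < 1) (hbot : u z₀ ≠ ⊥) :
    Summable fun a : O => 1 - ‖(a : ℂ)‖ ^ 2 := by
  obtain ⟨m, hm⟩ := EReal.exists_coe_eq hbot (hneg z₀ (by simpa using hz₀)).ne_top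
  have hz : 0 < 1 - ‖z₀‖ ^ 2 := by nlinarith [norm_nonneg z₀]
  refine summable_of_sum_le (c := 16 * (2 - m) / (1 - ‖z₀‖ ^ 2)) (fun a => ?_) fun F => ?_
  · have := hO a a.2
    simp only [Pi.zero_apply]
    nlinarith [norm_nonneg (a : ℂ)]
  · have h1 := hu.le_sum_log_blaschke hneg (F.map (Function.Embedding.subtype _))
      (fun a ha => by
        obtain ⟨b, -, rfl⟩ := Finset.mem_map.1 ha
        exact hO _ b.2)
      (fun a ha => by
        obtain ⟨b, -, rfl⟩ := Finset.mem_map.1 ha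
        exact hpole _ b.2) hz₀
    rw [hm, EReal.coe_le_coe_iff, Finset.sum_map] at h1
    have hbl : ∀ a : O, u a = ⊥ := fun a =>
      let ⟨_, hC⟩ := hpole a a.2
      hu.eq_bot_of_log_pole isOpen_ball (by simpa using hO a a.2) hC
    have h2 : ∀ a ∈ F, Real.log ‖blaschke a z₀‖ ≤ -((1 - ‖z₀‖ ^ 2) / 8) * (1 - ‖(a : ℂ)‖ ^ 2) := by
      intro a _
      have hne : z₀ ≠ a := by rintro rfl; exact hbot (hbl a)
      have hpos : 0 < ‖blaschke a z₀‖ :=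
        norm_pos_iff.2 (blaschke_ne_zero (hO a a.2) hz₀.le hne)
      have h3 := Real.log_le_sub_one_of_pos (pow_pos hpos 2)
      rw [Real.log_pow] at h3
      push_cast at h3
      have h4 := le_one_sub_norm_blaschke_sq (hO a a.2) hz₀
      nlinarith
    have h5 := Finset.sum_le_sum h2
    rw [← Finset.mul_sum] at h5
    simp only [Function.Embedding.subtype_apply] at h1
    rw [le_div_iff₀ hz]
    nlinarith

/-! ### From Green functions to strictly subharmonic functions -/

theorem IsAutGroupOn.exists_log_pole {Γ : Set (ℂ → ℂ)} (hgrp : IsAutGroupOn (ball (0 : ℂ) 1) Γ)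
    {u : ℂ → EReal} (hinv : ∀ γ ∈ Γ, ∀ z ∈ ball (0 : ℂ) 1, u (γ z) = u z) {w : ℂ}
    (hw : w ∈ ball (0 : ℂ) 1) {C : ℝ}
    (hC : ∀ᶠ z in 𝓝[ball (0 : ℂ) 1 \ {w}] w, u z ≤ ((Real.log ‖z - w‖ + C : ℝ) : EReal))
    {γ : ℂ → ℂ} (hγ : γ ∈ Γ) :
    ∃ C' : ℝ, ∀ᶠ z in 𝓝[≠] (γ w), u z ≤ ((Real.log ‖z - γ w‖ + C' : ℝ) : EReal) := by
  obtain ⟨σ, hσ, h1, h2⟩ := hgrp.inv_mem γ hγ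
  have ha : γ w ∈ ball (0 : ℂ) 1 := (hgrp.aut γ hγ).2.1 hw
  have hnhds : ∀ᶠ z in 𝓝[≠] (γ w), z ∈ ball (0 : ℂ) 1 :=
    nhdsWithin_le_nhds (isOpen_ball.mem_nhds ha)
  have hd : DifferentiableAt ℂ σ (γ w) :=
    (hgrp.aut σ hσ).1.differentiableAt (isOpen_ball.mem_nhds ha)
  have hσw : σ (γ w) = w := h1 hw
  have hne : ∀ z ∈ ball (0 : ℂ) 1, z ≠ γ w → σ z ≠ w := by
    rintro z hz hzw rfl
    exact hzw (h2 hz).symm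
  have ht : Tendsto σ (𝓝[≠] (γ w)) (𝓝[ball (0 : ℂ) 1 \ {w}] w) := by
    refine tendsto_nhdsWithin_iff.2 ⟨?_, ?_⟩
    · have := hd.continuousAt.tendsto
      rw [hσw] at this
      exact this.mono_left nhdsWithin_le_nhds
    · filter_upwards [hnhds, self_mem_nhdsWithin] with z hz hzw
      exact ⟨(hgrp.aut σ hσ).2.1 hz, hne z hz hzw⟩
  obtain ⟨L, hL, hb⟩ := hd.isBigO_sub.exists_pos
  refine ⟨Real.log L + C, ?_⟩
  filter_upwards [hnhds, self_mem_nhdsWithin, ht.eventually hC,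
    nhdsWithin_le_nhds hb.bound] with z hz hzw h3 h4
  rw [hinv σ hσ z hz] at h3
  refine h3.trans (EReal.coe_le_coe_iff.2 ?_)
  rw [hσw] at h4
  have h5 := Real.log_le_log (norm_pos_iff.2 (sub_ne_zero.2 (hne z hz hzw))) h4
  rw [Real.log_mul hL.ne' (norm_ne_zero_iff.2 (sub_ne_zero.2 hzw))] at h5
  linarith

theorem contDiffOn_norm_sq_of_differentiableOn {H : Type*} [NormedAddCommGroup H]
    [InnerProductSpace ℂ H] [CompleteSpace H] {F : ℂ → H} {s : Set ℂ}
    (hF : DifferentiableOn ℂ F s) (hs : IsOpen s) (n : WithTop ℕ∞) :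
    ContDiffOn ℝ n (fun z => ‖F z‖ ^ 2) s :=
  ((hF.contDiffOn hs).restrict_scalars ℝ).norm_sq ℂ

theorem lp.hasSum_norm_sq {ι : Type*} (f : lp (fun _ : ι => ℂ) 2) :
    HasSum (fun i => ‖f i‖ ^ 2) (‖f‖ ^ 2) := by
  have := lp.hasSum_norm (p := 2) (by norm_num) f
  simpa using this

/-- The Szegő-type kernel functions `√(1 - |a|²) / (1 - ā z)`, `a ∈ O`, assembled into a
holomorphic map to a Hilbert space. -/
theorem exists_differentiableOn_lp {O : Set ℂ} (hO : ∀ a ∈ O, ‖a‖ < 1)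
    (hs : Summable fun a : O => 1 - ‖(a : ℂ)‖ ^ 2) :
    ∃ F : ℂ → lp (fun _ : O => ℂ) 2, DifferentiableOn ℂ F (ball 0 1) ∧
      ∀ z ∈ ball (0 : ℂ) 1, ∀ a : O,
        F z a = (√(1 - ‖(a : ℂ)‖ ^ 2) : ℂ) / (1 - starRingEnd ℂ (a : ℂ) * z) := by
  have hc : ∀ a : O, 0 ≤ 1 - ‖(a : ℂ)‖ ^ 2 := fun a => by
    nlinarith [norm_nonneg (a : ℂ), hO a a.2]
  have hv : ∀ (n : ℕ) (a : O), ‖(√(1 - ‖(a : ℂ)‖ ^ 2) : ℂ) * starRingEnd ℂ (a : ℂ) ^ n‖ ^ 2 ≤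
      1 - ‖(a : ℂ)‖ ^ 2 := by
    intro n a
    rw [norm_mul, mul_pow, Complex.norm_real, Real.norm_eq_abs, sq_abs, Real.sq_sqrt (hc a)]
    refine mul_le_of_le_one_right (hc a) (pow_le_one₀ (norm_nonneg _) ?_)
    rw [norm_pow, RCLike.norm_conj]
    exact pow_le_one₀ (norm_nonneg _) (hO a a.2).le
  set V : ℕ → lp (fun _ : O => ℂ) 2 := fun n =>
    ⟨fun a => (√(1 - ‖(a : ℂ)‖ ^ 2) : ℂ) * starRingEnd ℂ (a : ℂ) ^ n, memℓp_gen (by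
      simpa using Summable.of_nonneg_of_le (fun _ => sq_nonneg _) (hv n) hs)⟩ with hV
  set S := ∑' a : O, (1 - ‖(a : ℂ)‖ ^ 2)
  have hVS : ∀ n, ‖V n‖ ≤ √S := fun n =>
    Real.le_sqrt_of_sq_le (hasSum_le (hv n) (lp.hasSum_norm_sq (V n)) hs.hasSum)
  have hbound : ∀ {r : ℝ} (n : ℕ) (z : ℂ), ‖z‖ ≤ r → ‖z ^ n • V n‖ ≤ r ^ n * √S := by
    intro r n z hz
    rw [norm_smul, norm_pow]
    have := hVS n
    have := (norm_nonneg z).trans hz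
    gcongr
  have hgeo : ∀ {r : ℝ}, 0 ≤ r → r < 1 → Summable fun n : ℕ => r ^ n * √S := fun h0 h1 =>
    (summable_geometric_of_lt_one h0 h1).mul_right _
  refine ⟨fun z => ∑' n, z ^ n • V n, fun z hz => ?_, fun z hz a => ?_⟩
  · obtain ⟨r, hzr, hr⟩ := exists_between (show ‖z‖ < 1 by simpa using hz)
    refine DifferentiableAt.differentiableWithinAt ?_
    refine (Complex.differentiableOn_tsum_of_summable_norm (U := ball (0 : ℂ) r)
      (hgeo ((norm_nonneg z).trans hzr.le) hr) (fun n => ?_) isOpen_ball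
      (fun n y hy => hbound n y ?_)).differentiableAt (isOpen_ball.mem_nhds (by simpa using hzr))
    · exact ((differentiable_id.pow n).smul_const _).differentiableOn
    · exact le_of_lt (by simpa using hy)
  · have hz1 : ‖z‖ < 1 := by simpa using hz
    have hsum : Summable fun n => z ^ n • V n :=
      Summable.of_norm_bounded (hgeo (norm_nonneg z) hz1) fun n => hbound n z le_rfl
    have h1 := (lp.evalCLM ℂ (fun _ : O => ℂ) 2 a).map_tsum hsum
    change (∑' n, z ^ n • V n) a = ∑' n, z ^ n *
      ((√(1 - ‖(a : ℂ)‖ ^ 2) : ℂ) * starRingEnd ℂ (a : ℂ) ^ n) at h1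
    have h2 : ‖starRingEnd ℂ (a : ℂ) * z‖ < 1 := by
      rw [norm_mul, RCLike.norm_conj]
      nlinarith [norm_nonneg (a : ℂ), hO a a.2, norm_nonneg z]
    rw [h1, div_eq_mul_inv, ← tsum_geometric_of_norm_lt_one h2, ← tsum_mul_left]
    refine tsum_congr fun n => ?_
    rw [mul_pow]
    ring

theorem hasDerivAt_lp_apply {ι : Type*} {F : ℂ → lp (fun _ : ι => ℂ) 2} {z : ℂ}
    (hF : DifferentiableAt ℂ F z) (i : ι) : HasDerivAt (fun x => F x i) (deriv F z i) z :=
  (lp.evalCLM ℂ (fun _ : ι => ℂ) 2 i).hasFDerivAt.comp_hasDerivAt z hF.hasDerivAt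

/-- The sum of `|b_a|² - 1` over the Blaschke factors `b_a`, `a ∈ O`. -/
def blaschkeSum (O : Set ℂ) (z : ℂ) : ℝ := ∑' a : O, (‖blaschke a z‖ ^ 2 - 1)

section BlaschkeSum

variable {O : Set ℂ}

theorem exists_blaschkeSum_eq (hO : ∀ a ∈ O, ‖a‖ < 1)
    (hs : Summable fun a : O => 1 - ‖(a : ℂ)‖ ^ 2) :
    ∃ F : ℂ → lp (fun _ : O => ℂ) 2, DifferentiableOn ℂ F (ball 0 1) ∧
      (∀ z ∈ ball (0 : ℂ) 1, ∀ a : O,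
        F z a = (√(1 - ‖(a : ℂ)‖ ^ 2) : ℂ) / (1 - starRingEnd ℂ (a : ℂ) * z)) ∧
      ∀ z ∈ ball (0 : ℂ) 1, blaschkeSum O z = ‖z • F z‖ ^ 2 + -1 * ‖F z‖ ^ 2 := by
  obtain ⟨F, hF, hFa⟩ := exists_differentiableOn_lp hO hs
  refine ⟨F, hF, hFa, fun z hz => ?_⟩
  have h := (lp.hasSum_norm_sq (F z)).mul_left (‖z‖ ^ 2 - 1)
  have e : (fun a : O => (‖z‖ ^ 2 - 1) * ‖F z a‖ ^ 2) =
      fun a : O => ‖blaschke a z‖ ^ 2 - 1 := by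
    funext a
    have h1 := one_sub_norm_blaschke_sq (hO a a.2) (z := z) (le_of_lt (by simpa using hz))
    have h2 : 0 ≤ 1 - ‖(a : ℂ)‖ ^ 2 := by nlinarith [norm_nonneg (a : ℂ), hO a a.2]
    rw [hFa z hz, norm_div, div_pow, Complex.norm_real, Real.norm_eq_abs, sq_abs,
      Real.sq_sqrt h2]
    linear_combination h1
  rw [e] at h
  rw [blaschkeSum, h.tsum_eq, norm_smul]
  ring

theorem contDiffOn_blaschkeSum (hO : ∀ a ∈ O, ‖a‖ < 1)
    (hs : Summable fun a : O => 1 - ‖(a : ℂ)‖ ^ 2) (n : WithTop ℕ∞) :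
    ContDiffOn ℝ n (blaschkeSum O) (ball 0 1) := by
  obtain ⟨F, hF, -, h⟩ := exists_blaschkeSum_eq hO hs
  have hG : DifferentiableOn ℂ (fun z => z • F z) (ball 0 1) := differentiableOn_id.smul hF
  exact ((contDiffOn_norm_sq_of_differentiableOn hG isOpen_ball n).add
    (contDiffOn_const.mul (contDiffOn_norm_sq_of_differentiableOn hF isOpen_ball n))).congr h

theorem blaschkeSum_neg (hO : ∀ a ∈ O, ‖a‖ < 1) (hne : O.Nonempty)
    (hs : Summable fun a : O => 1 - ‖(a : ℂ)‖ ^ 2) {z : ℂ} (hz : z ∈ ball (0 : ℂ) 1) :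
    blaschkeSum O z < 0 := by
  obtain ⟨F, hF, hFa, h⟩ := exists_blaschkeSum_eq hO hs
  obtain ⟨a, ha⟩ := hne
  have hz1 : ‖z‖ < 1 := by simpa using hz
  have h1 : F z ≠ 0 := by
    intro h0
    have h2 := hFa z hz ⟨a, ha⟩
    have h3 : √(1 - ‖a‖ ^ 2) ≠ 0 := (Real.sqrt_pos.2 (by
      nlinarith [norm_nonneg a, hO a ha])).ne'
    rw [h0] at h2
    exact div_ne_zero (Complex.ofReal_ne_zero.2 h3)
      (blaschke_denom_ne_zero (hO a ha) hz1.le) h2.symm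
  have h4 : 0 < ‖F z‖ ^ 2 := by positivity
  have h5 : ‖z‖ ^ 2 < 1 := by nlinarith [norm_nonneg z]
  rw [h z hz, norm_smul, mul_pow]
  nlinarith

theorem isStrictPSHOn_blaschkeSum (hO : ∀ a ∈ O, ‖a‖ < 1) (hne : O.Nonempty)
    (hs : Summable fun a : O => 1 - ‖(a : ℂ)‖ ^ 2) :
    IsStrictPSHOn (blaschkeSum O) (ball 0 1) := by
  obtain ⟨F, hF, hFa, h⟩ := exists_blaschkeSum_eq hO hs
  intro z hz v hv
  have hz1 : ‖z‖ < 1 := by simpa using hz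
  have hnhds := isOpen_ball.mem_nhds hz
  have hG : DifferentiableOn ℂ (fun z => z • F z) (ball 0 1) := differentiableOn_id.smul hF
  have ev : ∀ {K : ℂ → lp (fun _ : O => ℂ) 2}, DifferentiableOn ℂ K (ball 0 1) →
      ∀ᶠ x in 𝓝 z, DifferentiableAt ℂ K x := fun hK =>
    (isOpen_ball.eventually_mem hz).mono fun x hx => hK.differentiableAt (isOpen_ball.mem_nhds hx)
  rw [lineLaplacian_congr ((isOpen_ball.eventually_mem hz).mono h),
    lineLaplacian_add
      ((contDiffOn_norm_sq_of_differentiableOn hG isOpen_ball 2).contDiffAt hnhds)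
      (contDiffAt_const.mul
        ((contDiffOn_norm_sq_of_differentiableOn hF isOpen_ball 2).contDiffAt hnhds)),
    lineLaplacian_const_mul, lineLaplacian_norm_sq (ev hG), lineLaplacian_norm_sq (ev hF)]
  have hcoord : ∀ a : O, deriv F z a = starRingEnd ℂ (a : ℂ) * deriv (fun z => z • F z) z a ∧
      deriv (fun z => z • F z) z a ≠ 0 := by
    intro a
    set s : ℂ := (√(1 - ‖(a : ℂ)‖ ^ 2) : ℂ) with hs
    set c := starRingEnd ℂ (a : ℂ)
    have hs0 : s ≠ 0 := Complex.ofReal_ne_zero.2 (Real.sqrt_pos.2 (by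
      nlinarith [norm_nonneg (a : ℂ), hO a a.2])).ne'
    have hd0 : 1 - c * z ≠ 0 := blaschke_denom_ne_zero (hO a a.2) hz1.le
    have hden : HasDerivAt (fun x => 1 - c * x) (-c) z := by
      simpa using ((hasDerivAt_id z).const_mul c).const_sub 1
    have e1 : deriv F z a = s * c / (1 - c * z) ^ 2 := by
      refine (hasDerivAt_lp_apply (hF.differentiableAt hnhds) a).unique ?_
      have := ((hasDerivAt_const z s).div hden hd0).congr_of_eventuallyEq
        ((isOpen_ball.eventually_mem hz).mono fun x hx => hFa x hx a)
      convert this using 1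
      ring
    have e2 : deriv (fun z => z • F z) z a = s / (1 - c * z) ^ 2 := by
      refine (hasDerivAt_lp_apply (hG.differentiableAt hnhds) a).unique ?_
      have := (((hasDerivAt_id z).mul_const s).div hden hd0).congr_of_eventuallyEq
        (f₁ := fun x => (x • F x) a)
        ((isOpen_ball.eventually_mem hz).mono fun x hx => by
          change x * F x a = _
          rw [hFa x hx a]
          exact (mul_div_assoc _ _ _).symm)
      convert this using 1
      simp only [id]
      ring
    rw [e1, e2]
    exact ⟨by ring, div_ne_zero hs0 (pow_ne_zero 2 hd0)⟩
  have hlt : ∀ a : O, ‖deriv F z a‖ ^ 2 < ‖deriv (fun z => z • F z) z a‖ ^ 2 := by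
    intro a
    obtain ⟨h1, h2⟩ := hcoord a
    rw [h1, norm_mul, RCLike.norm_conj, mul_pow]
    have : 0 < ‖deriv (fun z => z • F z) z a‖ ^ 2 := by positivity
    have ha : ‖(a : ℂ)‖ ^ 2 < 1 := by nlinarith [norm_nonneg (a : ℂ), hO a a.2]
    nlinarith
  have key : ‖deriv F z‖ ^ 2 < ‖deriv (fun z => z • F z) z‖ ^ 2 :=
    let ⟨a, ha⟩ := hne
    hasSum_lt (fun a => (hlt a).le) (hlt ⟨a, ha⟩) (lp.hasSum_norm_sq _) (lp.hasSum_norm_sq _)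
  have : 0 < ‖v‖ ^ 2 := by positivity
  nlinarith

end BlaschkeSum

theorem blaschkeSum_orbitOf_comp {Γ : Set (ℂ → ℂ)} (hgrp : IsAutGroupOn (ball (0 : ℂ) 1) Γ)
    {w : ℂ} (hw : w ∈ ball (0 : ℂ) 1) {γ : ℂ → ℂ} (hγ : γ ∈ Γ) {z : ℂ}
    (hz : z ∈ ball (0 : ℂ) 1) :
    blaschkeSum (orbitOf Γ w) (γ z) = blaschkeSum (orbitOf Γ w) z := by
  have hO : ∀ a ∈ orbitOf Γ w, a ∈ ball (0 : ℂ) 1 := by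
    rintro _ ⟨τ, hτ, rfl⟩
    exact (hgrp.aut τ hτ).2.1 hw
  have hmaps : ∀ τ ∈ Γ, ∀ a ∈ orbitOf Γ w, τ a ∈ orbitOf Γ w := by
    rintro τ hτ _ ⟨τ', hτ', rfl⟩
    exact ⟨τ ∘ τ', hgrp.comp_mem τ hτ τ' hτ', rfl⟩
  obtain ⟨σ, hσ, h1, h2⟩ := hgrp.inv_mem γ hγ
  let e : orbitOf Γ w ≃ orbitOf Γ w :=
    { toFun := fun a => ⟨γ a, hmaps γ hγ a a.2⟩
      invFun := fun a => ⟨σ a, hmaps σ hσ a a.2⟩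
      left_inv := fun a => Subtype.ext (h1 (hO a a.2))
      right_inv := fun a => Subtype.ext (h2 (hO a a.2)) }
  rw [blaschkeSum, blaschkeSum, ← e.tsum_eq]
  refine tsum_congr fun a => ?_
  change ‖blaschke (γ a) (γ z)‖ ^ 2 - 1 = _
  rw [(hgrp.aut γ hγ).norm_blaschke (by simpa using hO a a.2) (by simpa using hz)]

theorem QuotientIsHyperbolic.quotientHasNegSPSH {Γ : Set (ℂ → ℂ)}
    (hgrp : IsAutGroupOn (ball (0 : ℂ) 1) Γ) (h : QuotientIsHyperbolic Γ) :
    QuotientHasNegSPSH (ball (0 : ℂ) 1) Γ := by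
  obtain ⟨w, hw, u, hu, hneg, ⟨z₀, hz₀, hbot⟩, hinv, C, hC⟩ := h
  have hO : ∀ a ∈ orbitOf Γ w, ‖a‖ < 1 := by
    rintro _ ⟨τ, hτ, rfl⟩
    simpa using (hgrp.aut τ hτ).2.1 hw
  have hne : (orbitOf Γ w).Nonempty := ⟨_, id, hgrp.id_mem, rfl⟩
  have hs := hu.summable_one_sub_norm_sq hneg hO (by
    rintro _ ⟨τ, hτ, rfl⟩
    exact hgrp.exists_log_pole hinv hw hC hτ) (by simpa using hz₀) hbot
  exact ⟨blaschkeSum (orbitOf Γ w), fun γ hγ z hz => blaschkeSum_orbitOf_comp hgrp hw hγ hz,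
    fun z hz => blaschkeSum_neg hO hne hs hz, contDiffOn_blaschkeSum hO hs _,
    isStrictPSHOn_blaschkeSum hO hne hs⟩

/-! ### From strictly subharmonic functions to Green functions -/

theorem exists_forall_norm_lt_imp_eqOn_id {Γ : Set (ℂ → ℂ)}
    (hgrp : IsAutGroupOn (ball (0 : ℂ) 1) Γ) (hfree : FreeActionOn (ball (0 : ℂ) 1) Γ)
    (hpd : ProperlyDiscontinuousOn (ball (0 : ℂ) 1) Γ) :
    ∃ R : ℝ, 0 < R ∧ R < 1 ∧
      ∀ γ ∈ Γ, ∀ z : ℂ, ‖z‖ < R → ‖γ z‖ < R → EqOn γ id (ball 0 1) := by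
  have hK : closedBall (0 : ℂ) (1 / 2) ⊆ ball 0 1 := closedBall_subset_ball (by norm_num)
  have hfin := hpd _ _ hK hK (isCompact_closedBall _ _) (isCompact_closedBall _ _)
  have h0 : (0 : ℂ) ∈ ball (0 : ℂ) 1 := by simp
  have hε : ∀ γ ∈ {γ ∈ Γ | (γ '' closedBall (0 : ℂ) (1 / 2) ∩ closedBall 0 (1 / 2)).Nonempty},
      ∀ᶠ R in 𝓝[>] (0 : ℝ), ∀ z : ℂ, ‖z‖ < R → ‖γ z‖ < R → EqOn γ id (ball 0 1) := by
    intro γ hγ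
    by_cases hγ0 : γ 0 = 0
    · exact Eventually.of_forall fun _ _ _ _ => hfree γ hγ.1 ⟨0, h0, hγ0⟩
    · have hpos : 0 < ‖γ 0‖ := norm_pos_iff.2 hγ0
      have hc : ContinuousAt γ 0 :=
        ((hgrp.aut γ hγ.1).1.differentiableAt (isOpen_ball.mem_nhds h0)).continuousAt
      obtain ⟨δ, hδ, hb⟩ := Metric.eventually_nhds_iff.1
        (hc.norm.eventually (lt_mem_nhds (half_lt_self hpos)))
      filter_upwards [nhdsWithin_le_nhds (gt_mem_nhds hδ),
        nhdsWithin_le_nhds (gt_mem_nhds (half_pos hpos))] with R h1 h2 z hz hγz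
      have := hb (y := z) (by simpa using hz.trans h1)
      linarith
  obtain ⟨R, h1, h2, h3⟩ := (((Filter.eventually_all_finite hfin).2 hε).and
    ((eventually_mem_nhdsWithin (a := (0 : ℝ)) (s := Ioi 0)).and
      (nhdsWithin_le_nhds (gt_mem_nhds (show (0 : ℝ) < 1 / 2 by norm_num))))).exists
  refine ⟨R, h2, by linarith, fun γ hγ z hz hγz => h1 γ ⟨hγ, γ z, ⟨z, ?_, rfl⟩, ?_⟩ z hz hγz⟩
  · simpa using (hz.trans h3).le
  · simpa using (hγz.trans h3).le

theorem continuousOn_lineLaplacian {ψ : ℂ → ℝ} {s : Set ℂ} (hs : IsOpen s)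
    (hψ : ContDiffOn ℝ 2 ψ s) (v : ℂ) : ContinuousOn (fun z => lineLaplacian ψ z v) s := by
  have h1 : ContDiffOn ℝ 1 (fderiv ℝ ψ) s := hψ.fderiv_of_isOpen hs (by norm_num)
  have h2 : ContinuousOn (fderiv ℝ (fderiv ℝ ψ)) s := h1.continuousOn_fderiv_of_isOpen hs le_rfl
  refine ContinuousOn.congr (f := fun z => fderiv ℝ (fderiv ℝ ψ) z v v +
    fderiv ℝ (fderiv ℝ ψ) z (Complex.I * v) (Complex.I * v)) ?_
    fun z hz => lineLaplacian_eq_fderiv (hψ.contDiffAt (hs.mem_nhds hz)) v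
  exact ((h2.clm_apply continuousOn_const).clm_apply continuousOn_const).add
    ((h2.clm_apply continuousOn_const).clm_apply continuousOn_const)

theorem exists_const_mul_bounds {ψ : ℂ → ℝ} {s K : Set ℂ} (hs : IsOpen s)
    (hψ : ContDiffOn ℝ 2 ψ s) (hneg : ∀ z ∈ s, ψ z < 0) (hlap : ∀ z ∈ s, 0 < lineLaplacian ψ z 1)
    (hK : IsCompact K) (hKs : K ⊆ s) (M N : ℝ) :
    ∃ A : ℝ, 0 < A ∧ ∀ z ∈ K, M < A * lineLaplacian ψ z 1 ∧ A * ψ z < -N := by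
  have key : ∀ {φ : ℂ → ℝ}, ContinuousOn φ K → (∀ z ∈ K, 0 < φ z) → ∀ c : ℝ,
      ∀ᶠ A in atTop, ∀ z ∈ K, c < A * φ z := by
    intro φ hφ hpos c
    rcases K.eq_empty_or_nonempty with rfl | hne
    · simp
    obtain ⟨p, hp, hmin⟩ := hK.exists_isMinOn hne hφ
    filter_upwards [(tendsto_id.atTop_mul_const (hpos p hp)).eventually (eventually_gt_atTop c),
      eventually_ge_atTop 0] with A h1 h2 z hz
    exact h1.trans_le (mul_le_mul_of_nonneg_left (hmin hz) h2)
  obtain ⟨A, h1, h2, h3⟩ := ((key ((continuousOn_lineLaplacian hs hψ 1).mono hKs)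
    (fun z hz => hlap z (hKs hz)) M).and ((key ((hψ.continuousOn.mono hKs).neg)
      (fun z hz => neg_pos.2 (hneg z (hKs hz))) N).and (eventually_gt_atTop 0))).exists
  exact ⟨A, h3, fun z hz => ⟨h1 z hz, by
    have := h2 z hz
    rw [Pi.neg_apply, mul_neg] at this
    linarith⟩⟩

theorem contDiffAt_log_norm {p : ℂ} (hp : p ≠ 0) :
    ContDiffAt ℝ 2 (fun z : ℂ => Real.log ‖z‖) p :=
  (contDiffAt_norm ℂ hp).log (norm_ne_zero_iff.2 hp)

theorem lineLaplacian_log_norm {p : ℂ} (hp : p ≠ 0) (v : ℂ) :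
    lineLaplacian (fun z : ℂ => Real.log ‖z‖) p v = 0 := by
  obtain ⟨g, hg, hge⟩ := AnalyticAt.exists_log_norm_eq_re (b := fun z => z) analyticAt_id hp
  rw [lineLaplacian_congr hge, lineLaplacian_re hg]

/-- The radial function `log |z| - 2 |z|² / r²`, normalized so as to be positive on the circle
of radius `r / 2` and negative outside the disc of radius `r`. -/
def radialBump (r : ℝ) (z : ℂ) : ℝ :=
  Real.log ‖z‖ + (-(2 / r ^ 2) * ‖z‖ ^ 2 + (1 + Real.log 2 - Real.log r))

section RadialBump

variable {r : ℝ}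

theorem contDiffAt_radialBump {p : ℂ} (hp : p ≠ 0) : ContDiffAt ℝ 2 (radialBump r) p :=
  (contDiffAt_log_norm hp).add
    ((contDiffAt_const.mul (contDiff_norm_sq ℂ).contDiffAt).add contDiffAt_const)

theorem lineLaplacian_radialBump {p : ℂ} (hp : p ≠ 0) :
    lineLaplacian (radialBump r) p 1 = -(8 / r ^ 2) := by
  have hn : ContDiffAt ℝ 2 (fun z : ℂ => -(2 / r ^ 2) * ‖z‖ ^ 2) p :=
    contDiffAt_const.mul (contDiff_norm_sq ℂ).contDiffAt
  have hc := lineLaplacian_re (f := fun _ => ((1 + Real.log 2 - Real.log r : ℝ) : ℂ)) (z := p)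
    analyticAt_const 1
  simp only [Complex.ofReal_re] at hc
  have hsq := lineLaplacian_norm_sq (F := fun z : ℂ => z) (z := p)
    (Eventually.of_forall fun _ => differentiableAt_id) 1
  change lineLaplacian (fun z : ℂ => Real.log ‖z‖ + (-(2 / r ^ 2) * ‖z‖ ^ 2 +
    (1 + Real.log 2 - Real.log r))) p 1 = _
  rw [lineLaplacian_add (contDiffAt_log_norm hp) (hn.add contDiffAt_const),
    lineLaplacian_add hn contDiffAt_const, lineLaplacian_const_mul, hc, hsq,
    lineLaplacian_log_norm hp, deriv_id'']
  norm_num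
  ring

theorem radialBump_neg (hr : 0 < r) {z : ℂ} (hz : r ≤ ‖z‖) : radialBump r z < 0 := by
  have hz0 : 0 < ‖z‖ := hr.trans_le hz
  have h1 := Real.log_le_sub_one_of_pos (div_pos hz0 hr)
  rw [Real.log_div hz0.ne' hr.ne'] at h1
  have h2 : 1 ≤ ‖z‖ / r := (one_le_div hr).2 hz
  have h3 := Real.log_two_lt_d9
  have h4 : radialBump r z = Real.log ‖z‖ - Real.log r + 1 + Real.log 2 - 2 * (‖z‖ / r) ^ 2 := by
    rw [radialBump]
    ring
  rw [h4]
  nlinarith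

theorem radialBump_le_two (hr : 0 < r) {z : ℂ} (hz0 : z ≠ 0) (hz : ‖z‖ ≤ r) :
    radialBump r z ≤ 2 := by
  have h1 := Real.log_le_log (norm_pos_iff.2 hz0) hz
  have h3 := Real.log_two_lt_d9
  have h4 : 0 ≤ 2 / r ^ 2 * ‖z‖ ^ 2 := by positivity
  rw [radialBump]
  linarith

theorem radialBump_pos (hr : 0 < r) {z : ℂ} (hz : ‖z‖ = r / 2) : 0 < radialBump r z := by
  have h : 2 / r ^ 2 * (r / 2) ^ 2 = 1 / 2 := by field_simp
  rw [radialBump, hz, neg_mul, h, Real.log_div hr.ne' two_ne_zero]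
  linarith

end RadialBump

/-- A strictly subharmonic function `ψ` modified near `0` so as to acquire a logarithmic
pole at `0`. -/
def withPole (ψ : ℂ → ℝ) (r : ℝ) (z : ℂ) : EReal :=
  if z = 0 then ⊥ else
    ((ψ z + if ‖z‖ ≤ r / 2 then radialBump r z else max (radialBump r z) 0 : ℝ) : EReal)

section WithPole

variable {ψ : ℂ → ℝ} {r : ℝ}

theorem withPole_zero : withPole ψ r 0 = ⊥ := if_pos rfl

theorem withPole_ne_bot {z : ℂ} (hz : z ≠ 0) : withPole ψ r z ≠ ⊥ := by
  rw [withPole, if_neg hz]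
  exact EReal.coe_ne_bot _

theorem withPole_of_le {z : ℂ} (hz0 : z ≠ 0) (hz : ‖z‖ ≤ r / 2) :
    withPole ψ r z = ((ψ z + radialBump r z : ℝ) : EReal) := by
  rw [withPole, if_neg hz0, if_pos hz]

theorem withPole_of_lt {z : ℂ} (hr : 0 < r) (hz : r / 2 < ‖z‖) :
    withPole ψ r z = ((ψ z + max (radialBump r z) 0 : ℝ) : EReal) := by
  rw [withPole, if_neg (norm_pos_iff.1 ((half_pos hr).trans hz)), if_neg hz.not_ge]

theorem withPole_of_nonneg {z : ℂ} (hz0 : z ≠ 0) (hz : 0 ≤ radialBump r z) :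
    withPole ψ r z = ((ψ z + radialBump r z : ℝ) : EReal) := by
  rw [withPole, if_neg hz0, max_eq_left hz, ite_self]

theorem withPole_eq (hr : 0 < r) {z : ℂ} (hz : r ≤ ‖z‖) : withPole ψ r z = (ψ z : EReal) := by
  rw [withPole_of_lt hr (by linarith), max_eq_right (radialBump_neg hr hz).le, add_zero]

theorem le_withPole {z : ℂ} (hz0 : z ≠ 0) :
    ((ψ z + radialBump r z : ℝ) : EReal) ≤ withPole ψ r z := by
  rw [withPole, if_neg hz0, EReal.coe_le_coe_iff]
  split_ifs
  · exact le_rfl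
  · gcongr
    exact le_max_left _ _

theorem withPole_lt_zero (hr : 0 < r) {z : ℂ} (hneg : ψ z < 0) (hψ : ‖z‖ ≤ r → ψ z < -2) :
    withPole ψ r z < 0 := by
  by_cases hz0 : z = 0
  · rw [hz0, withPole_zero]
    exact EReal.bot_lt_zero
  rcases le_total r ‖z‖ with hz | hz
  · rw [withPole_eq hr hz]
    exact_mod_cast hneg
  · have h1 := radialBump_le_two hr hz0 hz
    have h2 := hψ hz
    rw [withPole, if_neg hz0]
    norm_cast
    split_ifs
    · linarith
    · have : max (radialBump r z) 0 ≤ 2 := max_le h1 zero_le_two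
      linarith

theorem withPole_le_log (hr : 0 < r) (hψ : ∀ᶠ z in 𝓝 (0 : ℂ), ψ z < 0) :
    ∀ᶠ z in 𝓝[≠] (0 : ℂ), withPole ψ r z ≤
      ((Real.log ‖z - 0‖ + (1 + Real.log 2 - Real.log r) : ℝ) : EReal) := by
  filter_upwards [nhdsWithin_le_nhds hψ, self_mem_nhdsWithin,
    nhdsWithin_le_nhds (ball_mem_nhds (0 : ℂ) (half_pos hr))] with z h1 h2 h3
  have h4 : 0 ≤ 2 / r ^ 2 * ‖z‖ ^ 2 := by positivity
  rw [withPole_of_le h2 (le_of_lt (by simpa using h3)), EReal.coe_le_coe_iff, radialBump, sub_zero]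
  linarith

theorem upperSemicontinuousAt_withPole (hr : 0 < r) {p : ℂ} (hc : ContinuousAt ψ p)
    (hψ : ψ p < 0) : UpperSemicontinuousAt (withPole ψ r) p := by
  have husc : ∀ {φ : ℂ → ℝ}, ContinuousAt φ p → (∀ᶠ z in 𝓝 p, withPole ψ r z = (φ z : EReal)) →
      UpperSemicontinuousAt (withPole ψ r) p := by
    intro φ hφ he
    refine ContinuousAt.upperSemicontinuousAt ?_
    exact (ContinuousAt.comp continuous_coe_real_ereal.continuousAt hφ).congr
      (he.mono fun z hz => hz.symm)
  by_cases hp0 : p = 0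
  · subst hp0
    intro y hy
    rw [withPole_zero] at hy
    obtain ⟨M, -, hM⟩ := EReal.lt_iff_exists_real_btwn.1 hy
    have h1 := ((tendsto_log_norm_sub 0).atBot_add
      (tendsto_const_nhds (x := 1 + Real.log 2 - Real.log r))).eventually (eventually_le_atBot M)
    have h2 : ∀ᶠ z in 𝓝[≠] (0 : ℂ), withPole ψ r z < y := by
      filter_upwards [h1, withPole_le_log hr (hc.eventually (gt_mem_nhds hψ))] with z h1 h2
      exact (h2.trans (EReal.coe_le_coe_iff.2 h1)).trans_lt hM
    filter_upwards [eventually_nhdsWithin_iff.1 h2] with z hz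
    by_cases hz0 : z = 0
    · rwa [hz0, withPole_zero]
    · exact hz hz0
  · have hg : ContinuousAt (radialBump r) p := (contDiffAt_radialBump hp0).continuousAt
    have hn : ∀ᶠ z in 𝓝 p, z ≠ 0 := eventually_ne_nhds hp0
    rcases lt_trichotomy ‖p‖ (r / 2) with h | h | h
    · refine husc (hc.add hg) ?_
      filter_upwards [hn, continuous_norm.continuousAt.eventually (gt_mem_nhds h)] with z h1 h2
      exact withPole_of_le h1 (le_of_lt h2)
    · refine husc (hc.add hg) ?_
      filter_upwards [hn, hg.eventually (lt_mem_nhds (radialBump_pos hr h))] with z h1 h2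
      exact withPole_of_nonneg h1 (le_of_lt h2)
    · refine husc (φ := fun z => ψ z + max (radialBump r z) 0)
        (hc.add (hg.max continuousAt_const)) ?_
      filter_upwards [continuous_norm.continuousAt.eventually (lt_mem_nhds h)] with z h1
      exact withPole_of_lt hr h1

theorem noHarmonicTouch_withPole (hr : 0 < r) {p : ℂ} (hψ : ContDiffAt ℝ 2 ψ p)
    (hlap : 0 < lineLaplacian ψ p 1) (hlap' : ‖p‖ ≤ r → 8 / r ^ 2 < lineLaplacian ψ p 1) :
    NoHarmonicTouch (withPole ψ r) p := by
  by_cases hp0 : p = 0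
  · exact noHarmonicTouch_of_eq_bot (by rw [hp0, withPole_zero])
  have hpole : ‖p‖ ≤ r → withPole ψ r p = ((ψ p + radialBump r p : ℝ) : EReal) →
      NoHarmonicTouch (withPole ψ r) p := fun h h' => by
    refine noHarmonicTouch_of_lower (φ := fun z => ψ z + radialBump r z)
      (hψ.add (contDiffAt_radialBump hp0)) ?_ h'.symm
      ((eventually_ne_nhds hp0).mono fun z hz => le_withPole hz)
    rw [lineLaplacian_add hψ (contDiffAt_radialBump hp0), lineLaplacian_radialBump hp0]
    linarith [hlap' h]
  rcases le_or_gt ‖p‖ (r / 2) with h | h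
  · exact hpole (by linarith) (withPole_of_le hp0 h)
  rcases le_or_gt 0 (radialBump r p) with h0 | h0
  · refine hpole ?_ (withPole_of_nonneg hp0 h0)
    by_contra! hrp
    exact absurd (radialBump_neg hr hrp.le) h0.not_gt
  · refine noHarmonicTouch_of_lower hψ hlap ?_ ?_
    · rw [withPole_of_lt hr h, max_eq_right h0.le, add_zero]
    · filter_upwards [continuous_norm.continuousAt.eventually (lt_mem_nhds h)] with z hz
      rw [withPole_of_lt hr hz, EReal.coe_le_coe_iff]
      linarith [le_max_right (radialBump r z) 0]

end WithPole

open Classical in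
/-- The function equal to `V ∘ γ` on the preimage of the disc of radius `R` under `γ ∈ Γ`, and
to `ψ` off these preimages. -/
def glueOrbit (Γ : Set (ℂ → ℂ)) (R : ℝ) (V : ℂ → EReal) (ψ : ℂ → ℝ) (z : ℂ) : EReal :=
  if h : ∃ γ ∈ Γ, ‖γ z‖ < R then V (h.choose z) else (ψ z : EReal)

section GlueOrbit

variable {Γ : Set (ℂ → ℂ)} {R : ℝ} {V : ℂ → EReal} {ψ : ℂ → ℝ}

theorem glueOrbit_of_forall {z : ℂ} (h : ∀ γ ∈ Γ, R ≤ ‖γ z‖) :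
    glueOrbit Γ R V ψ z = (ψ z : EReal) :=
  dif_neg fun ⟨γ, hγ, hlt⟩ => (h γ hγ).not_gt hlt

theorem glueOrbit_of_lt (hgrp : IsAutGroupOn (ball (0 : ℂ) 1) Γ)
    (hR : ∀ γ ∈ Γ, ∀ z : ℂ, ‖z‖ < R → ‖γ z‖ < R → EqOn γ id (ball 0 1))
    {γ : ℂ → ℂ} (hγ : γ ∈ Γ) {z : ℂ} (hz : z ∈ ball (0 : ℂ) 1)
    (h : ‖γ z‖ < R) : glueOrbit Γ R V ψ z = V (γ z) := by
  have hex : ∃ γ ∈ Γ, ‖γ z‖ < R := ⟨γ, hγ, h⟩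
  obtain ⟨hτ, hτR⟩ := hex.choose_spec
  rw [glueOrbit, dif_pos hex]
  generalize hex.choose = τ at hτ hτR
  obtain ⟨σ, hσ, h1, -⟩ := hgrp.inv_mem γ hγ
  have h1z : σ (γ z) = z := h1 hz
  have h2 := hR (τ ∘ σ) (hgrp.comp_mem τ hτ σ hσ) (γ z) h
    (by rw [Function.comp_apply, h1z]; exact hτR) ((hgrp.aut γ hγ).2.1 hz)
  rw [Function.comp_apply, h1z, id] at h2
  rw [h2]

theorem glueOrbit_comp (hgrp : IsAutGroupOn (ball (0 : ℂ) 1) Γ)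
    (hR : ∀ γ ∈ Γ, ∀ z : ℂ, ‖z‖ < R → ‖γ z‖ < R → EqOn γ id (ball 0 1))
    (hinv : ∀ γ ∈ Γ, ∀ z ∈ ball (0 : ℂ) 1, ψ (γ z) = ψ z) {γ : ℂ → ℂ}
    (hγ : γ ∈ Γ) {z : ℂ} (hz : z ∈ ball (0 : ℂ) 1) :
    glueOrbit Γ R V ψ (γ z) = glueOrbit Γ R V ψ z := by
  have hγz := (hgrp.aut γ hγ).2.1 hz
  by_cases h : ∃ τ ∈ Γ, ‖τ (γ z)‖ < R
  · obtain ⟨τ, hτ, hlt⟩ := h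
    rw [glueOrbit_of_lt hgrp hR hτ hγz hlt,
      glueOrbit_of_lt hgrp hR (hgrp.comp_mem τ hτ γ hγ) hz hlt]
    rfl
  · push Not at h
    obtain ⟨σ, hσ, h1, -⟩ := hgrp.inv_mem γ hγ
    have h1z : σ (γ z) = z := h1 hz
    rw [glueOrbit_of_forall h, glueOrbit_of_forall, hinv γ hγ z hz]
    intro τ hτ
    have := h (τ ∘ σ) (hgrp.comp_mem τ hτ σ hσ)
    rwa [Function.comp_apply, h1z] at this

theorem glueOrbit_lt_zero (hgrp : IsAutGroupOn (ball (0 : ℂ) 1) Γ)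
    (hR : ∀ γ ∈ Γ, ∀ z : ℂ, ‖z‖ < R → ‖γ z‖ < R → EqOn γ id (ball 0 1))
    (hψ : ∀ z ∈ ball (0 : ℂ) 1, ψ z < 0)
    (hV : ∀ z ∈ ball (0 : ℂ) 1, V z < 0) {z : ℂ} (hz : z ∈ ball (0 : ℂ) 1) :
    glueOrbit Γ R V ψ z < 0 := by
  by_cases h : ∃ γ ∈ Γ, ‖γ z‖ < R
  · obtain ⟨γ, hγ, hlt⟩ := h
    rw [glueOrbit_of_lt hgrp hR hγ hz hlt]
    exact hV _ ((hgrp.aut γ hγ).2.1 hz)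
  · push Not at h
    rw [glueOrbit_of_forall h]
    exact_mod_cast hψ z hz

theorem eventually_glueOrbit_eq (hgrp : IsAutGroupOn (ball (0 : ℂ) 1) Γ)
    (hR : ∀ γ ∈ Γ, ∀ z : ℂ, ‖z‖ < R → ‖γ z‖ < R → EqOn γ id (ball 0 1))
    (hpd : ProperlyDiscontinuousOn (ball (0 : ℂ) 1) Γ)
    (hinv : ∀ γ ∈ Γ, ∀ z ∈ ball (0 : ℂ) 1, ψ (γ z) = ψ z) {r : ℝ} (hr : r < R) (hr1 : r < 1)
    (hV : ∀ z : ℂ, r ≤ ‖z‖ → V z = (ψ z : EReal)) {p : ℂ} (hp : p ∈ ball (0 : ℂ) 1)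
    (hpR : ∀ γ ∈ Γ, R ≤ ‖γ p‖) : ∀ᶠ z in 𝓝 p, glueOrbit Γ R V ψ z = (ψ z : EReal) := by
  obtain ⟨ε, hε, hεs⟩ := Metric.nhds_basis_closedBall.mem_iff.1 (isOpen_ball.mem_nhds hp)
  have hfin := hpd _ _ hεs (closedBall_subset_ball hr1) (isCompact_closedBall p ε)
    (isCompact_closedBall 0 r)
  have hev : ∀ γ ∈ {γ ∈ Γ | (γ '' closedBall p ε ∩ closedBall 0 r).Nonempty},
      ∀ᶠ z in 𝓝 p, r < ‖γ z‖ := fun γ hγ =>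
    ((hgrp.aut γ hγ.1).1.differentiableAt
      (isOpen_ball.mem_nhds hp)).continuousAt.norm.eventually
        (lt_mem_nhds (hr.trans_le (hpR γ hγ.1)))
  filter_upwards [(Filter.eventually_all_finite hfin).2 hev, closedBall_mem_nhds p hε]
    with z h1 h2
  have hz := hεs h2
  have hlt : ∀ γ ∈ Γ, r < ‖γ z‖ := by
    intro γ hγ
    by_contra! hle
    exact hle.not_gt (h1 γ ⟨hγ, γ z, ⟨z, h2, rfl⟩, by simpa using hle⟩)
  by_cases h : ∃ γ ∈ Γ, ‖γ z‖ < R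
  · obtain ⟨γ, hγ, hγR⟩ := h
    rw [glueOrbit_of_lt hgrp hR hγ hz hγR, hV _ (hlt γ hγ).le, hinv γ hγ z hz]
  · push Not at h
    exact glueOrbit_of_forall h

theorem isPSHOn_glueOrbit (hgrp : IsAutGroupOn (ball (0 : ℂ) 1) Γ)
    (hR : ∀ γ ∈ Γ, ∀ z : ℂ, ‖z‖ < R → ‖γ z‖ < R → EqOn γ id (ball 0 1))
    (hpd : ProperlyDiscontinuousOn (ball (0 : ℂ) 1) Γ)
    (hinv : ∀ γ ∈ Γ, ∀ z ∈ ball (0 : ℂ) 1, ψ (γ z) = ψ z) {r : ℝ} (hr : r < R) (hr1 : r < 1)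
    (hV : ∀ z : ℂ, r ≤ ‖z‖ → V z = (ψ z : EReal))
    (hψneg : ∀ z ∈ ball (0 : ℂ) 1, ψ z < 0) (hVneg : ∀ z ∈ ball (0 : ℂ) 1, V z < 0)
    (hψ : ContDiffOn ℝ 2 ψ (ball 0 1)) (hlap : ∀ z ∈ ball (0 : ℂ) 1, 0 < lineLaplacian ψ z 1)
    (husc : ∀ z ∈ ball (0 : ℂ) 1, UpperSemicontinuousAt V z)
    (hno : ∀ z ∈ ball (0 : ℂ) 1, NoHarmonicTouch V z) :
    IsPSHOn (glueOrbit Γ R V ψ) (ball 0 1) := by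
  have hnear : ∀ γ ∈ Γ, ∀ p ∈ ball (0 : ℂ) 1, ‖γ p‖ < R →
      ContinuousAt γ p ∧ ∀ᶠ z in 𝓝 p, glueOrbit Γ R V ψ z = V (γ z) := by
    intro γ hγ p hp hlt
    have hc := ((hgrp.aut γ hγ).1.differentiableAt (isOpen_ball.mem_nhds hp)).continuousAt
    refine ⟨hc, ?_⟩
    filter_upwards [hc.norm.eventually (gt_mem_nhds hlt), isOpen_ball.mem_nhds hp] with z h1 h2
    exact glueOrbit_of_lt hgrp hR hγ h2 h1
  refine isPSHOn_of_noHarmonicTouch (fun p hp => ?_)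
    (fun z hz => (glueOrbit_lt_zero hgrp hR hψneg hVneg hz).ne_top) fun p hp => ?_
  · refine UpperSemicontinuousAt.upperSemicontinuousWithinAt _ ?_
    by_cases h : ∃ γ ∈ Γ, ‖γ p‖ < R
    · obtain ⟨γ, hγ, hlt⟩ := h
      obtain ⟨hc, he⟩ := hnear γ hγ p hp hlt
      intro y hy
      rw [he.self_of_nhds] at hy
      filter_upwards [he, hc.eventually (husc _ ((hgrp.aut γ hγ).2.1 hp) y hy)] with z h1 h2
      rwa [h1]
    · push Not at h
      have he := eventually_glueOrbit_eq hgrp hR hpd hinv hr hr1 hV hp h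
      refine ContinuousAt.upperSemicontinuousAt ?_
      exact (ContinuousAt.comp continuous_coe_real_ereal.continuousAt
        (hψ.continuousOn.continuousAt (isOpen_ball.mem_nhds hp))).congr
        (he.mono fun z hz => hz.symm)
  · by_cases h : ∃ γ ∈ Γ, ‖γ p‖ < R
    · obtain ⟨γ, hγ, hlt⟩ := h
      obtain ⟨hc, he⟩ := hnear γ hγ p hp hlt
      obtain ⟨σ, hσ, h1, h2⟩ := hgrp.inv_mem γ hγ
      have hγp := (hgrp.aut γ hγ).2.1 hp
      exact (hno _ hγp).comp he ((hgrp.aut σ hσ).1.analyticAt (isOpen_ball.mem_nhds hγp)) (h1 hp)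
        ((isOpen_ball.eventually_mem hγp).mono fun y hy => h2 hy)
    · push Not at h
      have he := eventually_glueOrbit_eq hgrp hR hpd hinv hr hr1 hV hp h
      exact noHarmonicTouch_of_lower (hψ.contDiffAt (isOpen_ball.mem_nhds hp)) (hlap p hp)
        he.self_of_nhds.symm (he.mono fun z hz => hz.ge)

end GlueOrbit

theorem QuotientHasNegSPSH.quotientIsHyperbolic {Γ : Set (ℂ → ℂ)}
    (hgrp : IsAutGroupOn (ball (0 : ℂ) 1) Γ) (hfree : FreeActionOn (ball (0 : ℂ) 1) Γ)
    (hpd : ProperlyDiscontinuousOn (ball (0 : ℂ) 1) Γ)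
    (h : QuotientHasNegSPSH (ball (0 : ℂ) 1) Γ) : QuotientIsHyperbolic Γ := by
  obtain ⟨φ, hinv, hneg, hsm, hstrict⟩ := h
  obtain ⟨R, hR0, hR1, hR⟩ := exists_forall_norm_lt_imp_eqOn_id hgrp hfree hpd
  have hsm2 : ContDiffOn ℝ 2 φ (ball 0 1) := hsm.of_le (WithTop.coe_le_coe.2 le_top)
  set r := R / 2 with hr
  have hr0 : 0 < r := half_pos hR0
  have hrR : r < R := half_lt_self hR0
  have hr1 : r < 1 := hrR.trans hR1
  obtain ⟨A, hA, hAb⟩ := exists_const_mul_bounds isOpen_ball hsm2 hneg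
    (fun z hz => hstrict z hz 1 one_ne_zero) (isCompact_closedBall 0 r)
    (closedBall_subset_ball hr1) (8 / r ^ 2) 2
  set ψ : ℂ → ℝ := fun z => A * φ z with hψdef
  have hψ : ContDiffOn ℝ 2 ψ (ball 0 1) := contDiffOn_const.mul hsm2
  have hψneg : ∀ z ∈ ball (0 : ℂ) 1, ψ z < 0 := fun z hz => mul_neg_of_pos_of_neg hA (hneg z hz)
  have hψinv : ∀ γ ∈ Γ, ∀ z ∈ ball (0 : ℂ) 1, ψ (γ z) = ψ z := fun γ hγ z hz => by
    rw [hψdef]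
    simp only [hinv γ hγ z hz]
  have hψlap : ∀ z, lineLaplacian ψ z 1 = A * lineLaplacian φ z 1 := fun z =>
    lineLaplacian_const_mul φ z 1 A
  have hψpos : ∀ z ∈ ball (0 : ℂ) 1, 0 < lineLaplacian ψ z 1 := fun z hz => by
    rw [hψlap]
    exact mul_pos hA (hstrict z hz 1 one_ne_zero)
  have hVneg : ∀ z ∈ ball (0 : ℂ) 1, withPole ψ r z < 0 := fun z hz =>
    withPole_lt_zero hr0 (hψneg z hz) fun hzr => (hAb z (by simpa using hzr)).2
  have hball : ∀ z : ℂ, ‖z‖ < R → z ∈ ball (0 : ℂ) 1 := fun z hz => by simpa using hz.trans hR1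
  have hu : ∀ z : ℂ, ‖z‖ < R → glueOrbit Γ R (withPole ψ r) ψ z = withPole ψ r z := fun z hz =>
    glueOrbit_of_lt hgrp hR hgrp.id_mem (hball z hz) hz
  have hrn : ‖(r : ℂ)‖ = r := by rw [Complex.norm_real, Real.norm_of_nonneg hr0.le]
  refine ⟨0, by simp, glueOrbit Γ R (withPole ψ r) ψ,
    isPSHOn_glueOrbit hgrp hR hpd hψinv hrR hr1 (fun z hz => withPole_eq hr0 hz) hψneg hVneg hψ
      hψpos (fun z hz => ?_) (fun z hz => ?_),
    fun z hz => glueOrbit_lt_zero hgrp hR hψneg hVneg hz, ⟨r, hball _ (hrn.trans_lt hrR), ?_⟩,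
    fun γ hγ z hz => glueOrbit_comp hgrp hR hψinv hγ hz, 1 + Real.log 2 - Real.log r, ?_⟩
  · exact upperSemicontinuousAt_withPole hr0
      (hψ.continuousOn.continuousAt (isOpen_ball.mem_nhds hz)) (hψneg z hz)
  · refine noHarmonicTouch_withPole hr0 (hψ.contDiffAt (isOpen_ball.mem_nhds hz)) (hψpos z hz) ?_
    intro hzr
    rw [hψlap]
    exact (hAb z (by simpa using hzr)).1
  · rw [hu _ (hrn.trans_lt hrR)]
    exact withPole_ne_bot (Complex.ofReal_ne_zero.2 hr0.ne')
  · have h0 : ∀ᶠ z in 𝓝 (0 : ℂ), ψ z < 0 :=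
      (isOpen_ball.eventually_mem (by simp)).mono hψneg
    have hle : 𝓝[ball (0 : ℂ) 1 \ {0}] (0 : ℂ) ≤ 𝓝[≠] 0 := nhdsWithin_mono _ fun z hz => hz.2
    filter_upwards [hle (withPole_le_log hr0 h0),
      nhdsWithin_le_nhds (ball_mem_nhds (0 : ℂ) hR0)] with z h1 h2
    rw [hu z (by simpa using h2)]
    exact h1

/-- **Corollary 2.** An open Riemann surface (written, via the uniformization theorem, as
`Δ/Γ` for a free, properly discontinuous group `Γ` of automorphisms of the unit disc `Δ`)
is hyperbolic if and only if it carries a negative `C^∞` strictly subharmonic function. -/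
theorem hyperbolic_iff_neg_strictly_subharmonic (Γ : Set (ℂ → ℂ))
    (hgrp : IsAutGroupOn (ball (0 : ℂ) 1) Γ)
    (hfree : FreeActionOn (ball (0 : ℂ) 1) Γ)
    (hpd : ProperlyDiscontinuousOn (ball (0 : ℂ) 1) Γ) :
    QuotientIsHyperbolic Γ ↔ QuotientHasNegSPSH (ball (0 : ℂ) 1) Γ := by
  exact ⟨fun h => h.quotientHasNegSPSH hgrp,
    fun h => h.quotientIsHyperbolic hgrp hfree hpd⟩

end
end

section
/- Let Γ be an infinite, cyclic, free, properly discontinuous group of automorphisms of the unit ball B ⊂ ℂⁿ. Then ⋃_{a∈D} CΓ_a has at most two elements, where D is a fundamental domain and CΓ_a is the cluster set of the orbit of a. In particular, B/Γ is a Stein manifold. -/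
open Set Metric Filter MeasureTheory Topology

noncomputable section

variable {E : Type*} [NormedAddCommGroup E] [NormedSpace ℂ E]

section Iterates

variable {X : Type*} {Ω : Set X} {f g : X → X}

lemma zIter_mapsTo (hf : MapsTo f Ω Ω) (hg : MapsTo g Ω Ω) (k : ℤ) :
    MapsTo (zIter f g k) Ω Ω := by
  cases k with
  | ofNat k => exact hf.iterate k
  | negSucc k => exact hg.iterate (k + 1)

lemma zIter_apply_self (hgf : EqOn (g ∘ f) id Ω) (k : ℤ) {x : X} (hx : x ∈ Ω) :
    zIter f g k (f x) = zIter f g (k + 1) x := by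
  rcases k with k | k
  · rfl
  · have h : g (f x) = x := hgf hx
    have e : zIter f g (Int.negSucc k + 1) x = g^[k] x := by
      cases k with
      | zero => rfl
      | succ k => rfl
    rw [e]
    change g^[k + 1] (f x) = _
    rw [Function.iterate_succ_apply, h]

lemma apply_iterate_eq_add (hf : MapsTo f Ω Ω) {τ : X → ℂ} {c : ℂ}
    (h : ∀ x ∈ Ω, τ (f x) = τ x + c) (k : ℕ) {x : X} (hx : x ∈ Ω) :
    τ (f^[k] x) = τ x + k * c := by
  induction k with
  | zero => simp
  | succ k ih =>
    rw [Function.iterate_succ_apply', h _ (hf.iterate k hx), ih]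
    push_cast
    ring

lemma apply_zIter_eq_add (hf : MapsTo f Ω Ω) (hg : MapsTo g Ω Ω) (hfg : EqOn (f ∘ g) id Ω)
    {τ : X → ℂ} {c : ℂ} (h : ∀ x ∈ Ω, τ (f x) = τ x + c) (k : ℤ) {x : X} (hx : x ∈ Ω) :
    τ (zIter f g k x) = τ x + k * c := by
  rcases k with k | k
  · exact_mod_cast apply_iterate_eq_add hf h k hx
  · have h' : ∀ x ∈ Ω, τ (g x) = τ x + -c := fun x hx => by
      have := h (g x) (hg hx)
      rw [show f (g x) = x from hfg hx] at this
      rw [this]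
      ring
    have := apply_iterate_eq_add hg h' (k + 1) hx
    change τ (g^[k + 1] x) = _
    rw [this, Int.cast_negSucc]
    ring

/-- A function invariant under the generator of a cyclic group of automorphisms is invariant under
the whole group. -/
lemma apply_eq_of_generator {Γ : Set (X → X)} (hf : MapsTo f Ω Ω) (hg : MapsTo g Ω Ω)
    (hfg : EqOn (f ∘ g) id Ω) (hΓ : ∀ σ ∈ Γ, ∃ k : ℤ, EqOn σ (zIter f g k) Ω)
    {φ : X → ℂ} (h : ∀ x ∈ Ω, φ (f x) = φ x) {σ : X → X} (hσ : σ ∈ Γ) {x : X} (hx : x ∈ Ω) :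
    φ (σ x) = φ x := by
  obtain ⟨k, hk⟩ := hΓ σ hσ
  rw [hk hx, apply_zIter_eq_add hf hg hfg (τ := φ) (c := 0) (by simpa using h) k hx]
  simp

lemma zIter_differentiableOn {Ω : Set E} {f g : E → E} (hf : MapsTo f Ω Ω) (hg : MapsTo g Ω Ω)
    (hfd : DifferentiableOn ℂ f Ω) (hgd : DifferentiableOn ℂ g Ω) (k : ℤ) :
    DifferentiableOn ℂ (zIter f g k) Ω := by
  cases k with
  | ofNat k => exact hfd.iterate hf k
  | negSucc k => exact hgd.iterate hg (k + 1)

end Iterates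

section Series

/-- A series of holomorphic functions on a ball, dominated by a summable series of constants, is
holomorphic at the centre. -/
lemma differentiableAt_tsum_of_summable_norm {ι : Type*} {F : ι → E → ℂ} {u : ι → ℝ} {x : E}
    {δ : ℝ} (hδ : 0 < δ) (hu : Summable u) (hF : ∀ k, DifferentiableOn ℂ (F k) (ball x δ))
    (hb : ∀ k, ∀ y ∈ ball x δ, ‖F k y‖ ≤ u k) :
    DifferentiableAt ℂ (fun y => ∑' k, F k y) x := by
  have hsub : ∀ y ∈ ball x (δ / 2), ball y (δ / 2) ⊆ ball x δ := fun y hy =>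
    ball_subset_ball' (by rw [mem_ball] at hy; linarith)
  have hx : x ∈ ball x (δ / 2) := mem_ball_self (by positivity)
  refine (hasFDerivAt_tsum_of_isPreconnected (f' := fun k y => fderiv ℂ (F k) y)
    (u := fun k => 2 * u k / (δ / 2)) (s := ball x (δ / 2)) (x₀ := x) ?_ isOpen_ball
    (convex_ball x (δ / 2)).isPreconnected ?_ ?_ hx ?_ hx).differentiableAt
  · simpa [div_eq_mul_inv] using (hu.mul_left 2).mul_right (δ / 2)⁻¹
  · intro k y hy
    exact ((hF k).differentiableAt
      (isOpen_ball.mem_nhds (ball_subset_ball (by linarith) hy))).hasFDerivAt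
  · intro k y hy
    refine Complex.norm_fderiv_le_div_of_mapsTo_ball ((hF k).mono (hsub y hy)) ?_ (by positivity)
    intro z hz
    have h1 := hb k z (hsub y hy hz)
    have h2 := hb k y (hsub y hy (mem_ball_self (by positivity)))
    rw [mem_closedBall, dist_eq_norm]
    linarith [norm_sub_le (F k z) (F k y)]
  · exact Summable.of_norm_bounded hu fun k => hb k x (mem_ball_self hδ)

lemma summable_exp_neg_mul_sq {c : ℝ} (hc : 0 < c) :
    Summable fun k : ℤ => Real.exp (-c * (k : ℝ) ^ 2) := by
  have h : Summable fun k : ℕ => Real.exp (-c * (k : ℝ) ^ 2) := by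
    refine Summable.of_nonneg_of_le (fun _ => (Real.exp_pos _).le) (fun k => ?_)
      (summable_geometric_of_lt_one (Real.exp_pos (-c)).le (Real.exp_lt_one_iff.2 (by linarith)))
    rw [← Real.exp_nat_mul]
    refine Real.exp_le_exp.2 ?_
    have : (k : ℝ) ≤ (k : ℝ) ^ 2 := by exact_mod_cast Nat.le_self_pow two_ne_zero k
    nlinarith
  exact Summable.of_nat_of_neg (by simpa using h) (by simpa using h)

lemma norm_exp_neg_mul_sq_le {N R : ℝ} (hN : 0 < N) {w : ℂ} (hw : ‖w‖ ≤ R) (k : ℤ) :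
    ‖Complex.exp (-N * (w + k) ^ 2)‖ ≤
      Real.exp (N * R ^ 2) * Real.exp (-(N / 2) * (k : ℝ) ^ 2) := by
  rw [Complex.norm_exp, ← Real.exp_add]
  refine Real.exp_le_exp.2 ?_
  have h1 : w.re ^ 2 + w.im ^ 2 ≤ R ^ 2 := by
    have h := Complex.sq_norm w
    rw [Complex.normSq_apply] at h
    nlinarith [norm_nonneg w]
  have h2 : (-N * (w + k) ^ 2 : ℂ).re = -N * ((w.re + k) ^ 2 - w.im ^ 2) := by
    simp [pow_two]
  rw [h2]
  have h3 : 0 ≤ ((k : ℝ) + 2 * w.re) ^ 2 := sq_nonneg _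
  have h4 : (k : ℝ) ^ 2 / 2 - R ^ 2 ≤ (w.re + k) ^ 2 - w.im ^ 2 := by nlinarith
  nlinarith [mul_le_mul_of_nonneg_left h4 hN.le]

/-- For large `N` the weights `exp (-N k²)` concentrate at `k = 0`. -/
lemma exists_norm_tsum_gaussian_sub_le {ε : ℝ} (hε : 0 < ε) :
    ∃ N : ℝ, 0 < N ∧ ∀ c : ℤ → ℂ, (∀ k, ‖c k‖ ≤ 1) →
      ‖∑' k : ℤ, c k * Complex.exp (-N * (k : ℂ) ^ 2) - c 0‖ ≤ ε := by
  set S : ℝ := ∑' k : ℤ, Real.exp (-1 * (k : ℝ) ^ 2) with hS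
  have hlim : Tendsto (fun N : ℝ => Real.exp (-(N - 1)) * S) atTop (𝓝 0) := by
    have : Tendsto (fun N : ℝ => Real.exp (-(N - 1))) atTop (𝓝 0) :=
      Real.tendsto_exp_neg_atTop_nhds_zero.comp (tendsto_atTop_add_const_right _ (-1) tendsto_id)
    simpa using this.mul_const S
  obtain ⟨N, hNε, hN1⟩ := ((hlim.eventually (gt_mem_nhds hε)).and (eventually_ge_atTop 1)).exists
  refine ⟨N, by linarith, fun c hc => ?_⟩
  have hnorm : ∀ k : ℤ, ‖Complex.exp (-N * (k : ℂ) ^ 2)‖ = Real.exp (-N * (k : ℝ) ^ 2) := by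
    intro k
    rw [← Complex.norm_exp_ofReal]
    push_cast
    rfl
  have hsum : Summable fun k : ℤ => c k * Complex.exp (-N * (k : ℂ) ^ 2) := by
    refine Summable.of_norm_bounded (summable_exp_neg_mul_sq (c := N) (by linarith)) fun k => ?_
    rw [norm_mul, hnorm]
    exact mul_le_of_le_one_left (Real.exp_pos _).le (hc k)
  rw [hsum.tsum_eq_add_tsum_ite 0]
  simp only [Int.cast_zero, ne_eq, OfNat.ofNat_ne_zero, not_false_eq_true, zero_pow, mul_zero,
    Complex.exp_zero, mul_one, add_sub_cancel_left]
  refine (tsum_of_norm_bounded (a := Real.exp (-(N - 1)) * S)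
    ((summable_exp_neg_mul_sq one_pos).hasSum.mul_left _) fun k => ?_).trans hNε.le
  split_ifs with hk
  · rw [norm_zero]
    positivity
  · rw [norm_mul, hnorm, ← Real.exp_add]
    refine (mul_le_of_le_one_left (Real.exp_pos _).le (hc k)).trans (Real.exp_le_exp.2 ?_)
    have : (1 : ℝ) ≤ (k : ℝ) ^ 2 := by
      exact_mod_cast Int.add_one_le_iff.2 (by positivity : (0 : ℤ) < k ^ 2)
    nlinarith

end Series
section AbelEquation

/-- The weighted Poincaré series of `f`, with Gaussian weights centred at `t`. -/
def gaussSeries {X : Type*} (g : ℤ → X → X) (τ : X → ℂ) (N : ℝ) (t : ℂ) (f : X → ℂ) (x : X) : ℂ :=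
  ∑' k : ℤ, f (g k x) * Complex.exp (-N * (τ x - t + k) ^ 2)

variable {N : ℝ} {t : ℂ}

lemma norm_gaussSeries_term_le (hN : 0 < N) {w : ℂ} {R : ℝ} (hw : ‖w‖ ≤ R) {z : ℂ} {c : ℝ}
    (hz : ‖z‖ ≤ c) (k : ℤ) :
    ‖z * Complex.exp (-N * (w + k) ^ 2)‖ ≤
      c * (Real.exp (N * R ^ 2) * Real.exp (-(N / 2) * (k : ℝ) ^ 2)) := by
  rw [norm_mul]
  exact mul_le_mul hz (norm_exp_neg_mul_sq_le hN hw k) (norm_nonneg _) ((norm_nonneg z).trans hz)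

lemma differentiableOn_gaussSeries {Ω : Set E} {τ f : E → ℂ} (hΩ : IsOpen Ω) {g : ℤ → E → E}
    (hg : ∀ k, MapsTo (g k) Ω Ω) (hgd : ∀ k, DifferentiableOn ℂ (g k) Ω)
    (hτ : DifferentiableOn ℂ τ Ω) (hN : 0 < N) (hf : DifferentiableOn ℂ f Ω)
    (hf1 : ∀ x ∈ Ω, ‖f x‖ ≤ 1) : DifferentiableOn ℂ (gaussSeries g τ N t f) Ω := by
  intro x hx
  have hcont : ContinuousAt τ x := (hτ.differentiableAt (hΩ.mem_nhds hx)).continuousAt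
  have hev : ∀ᶠ y in 𝓝 x, y ∈ Ω ∧ ‖τ y - t‖ < ‖τ x - t‖ + 1 :=
    Filter.Eventually.and (hΩ.mem_nhds hx)
      ((hcont.sub continuousAt_const).norm.eventually (gt_mem_nhds (lt_add_one _)))
  obtain ⟨δ, hδ, hball⟩ := Metric.eventually_nhds_iff_ball.1 hev
  refine (differentiableAt_tsum_of_summable_norm (δ := δ)
    (u := fun k : ℤ => 1 * (Real.exp (N * (‖τ x - t‖ + 1) ^ 2) *
      Real.exp (-(N / 2) * (k : ℝ) ^ 2))) hδ
    (((summable_exp_neg_mul_sq (by positivity)).mul_left _).mul_left _) (fun k => ?_)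
    fun k y hy => ?_).differentiableWithinAt
  · have hsub : ball x δ ⊆ Ω := fun y hy => (hball y hy).1
    have h1 : DifferentiableOn ℂ (fun y => f (g k y)) (ball x δ) :=
      (hf.comp (hgd k) (hg k)).mono hsub
    have h2 := hτ.mono hsub
    exact h1.mul (((h2.sub_const t).add_const (k : ℂ)).pow 2 |>.const_mul (-(N : ℂ))).cexp
  · exact norm_gaussSeries_term_le hN (hball y hy).2.le (hf1 _ (hg k (hball y hy).1)) k

lemma gaussSeries_apply_generator {X : Type*} {Ω : Set X} {γ γ' : X → X} {τ f : X → ℂ}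
    (hgf : EqOn (γ' ∘ γ) id Ω) (h : ∀ x ∈ Ω, τ (γ x) = τ x + 1)
    {x : X} (hx : x ∈ Ω) :
    gaussSeries (zIter γ γ') τ N t f (γ x) = gaussSeries (zIter γ γ') τ N t f x := by
  unfold gaussSeries
  rw [← (Equiv.addRight (1 : ℤ)).tsum_eq
    (fun k : ℤ => f (zIter γ γ' k x) * Complex.exp (-N * (τ x - t + k) ^ 2))]
  refine tsum_congr fun k => ?_
  rw [zIter_apply_self hgf k hx, h x hx, Equiv.coe_addRight]
  push_cast
  ring_nf

end AbelEquation

/-- A cyclic group of automorphisms of the ball has a Stein quotient as soon as the Abel equation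
`τ ∘ γ = τ + 1` for its generator `γ` has a holomorphic solution `τ`. -/
theorem quotientIsStein_of_abel {n : ℕ}
    {Γ : Set (EuclideanSpace ℂ (Fin n) → EuclideanSpace ℂ (Fin n))}
    {γ γ' : EuclideanSpace ℂ (Fin n) → EuclideanSpace ℂ (Fin n)}
    {τ : EuclideanSpace ℂ (Fin n) → ℂ}
    (hgrp : IsAutGroupOn (ball (0 : EuclideanSpace ℂ (Fin n)) 1) Γ)
    (hγ : γ ∈ Γ) (hγ' : γ' ∈ Γ)
    (hgf : EqOn (γ' ∘ γ) id (ball (0 : EuclideanSpace ℂ (Fin n)) 1))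
    (hfg : EqOn (γ ∘ γ') id (ball (0 : EuclideanSpace ℂ (Fin n)) 1))
    (hmem : ∀ k : ℤ, zIter γ γ' k ∈ Γ)
    (hall : ∀ σ ∈ Γ, ∃ k : ℤ, EqOn σ (zIter γ γ' k) (ball (0 : EuclideanSpace ℂ (Fin n)) 1))
    (hτd : DifferentiableOn ℂ τ (ball (0 : EuclideanSpace ℂ (Fin n)) 1))
    (hτ : ∀ x ∈ ball (0 : EuclideanSpace ℂ (Fin n)) 1, τ (γ x) = τ x + 1) :
    QuotientIsStein (ball (0 : EuclideanSpace ℂ (Fin n)) 1) Γ := by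
  have hm := (hgrp.aut γ hγ).2.1
  have hm' := (hgrp.aut γ' hγ').2.1
  have hd := (hgrp.aut γ hγ).1
  have hd' := (hgrp.aut γ' hγ').1
  have hmaps := zIter_mapsTo hm hm'
  have hdiff := zIter_differentiableOn hm hm' hd hd'
  have hτk : ∀ (k : ℤ), ∀ x ∈ ball (0 : EuclideanSpace ℂ (Fin n)) 1,
      τ (zIter γ γ' k x) = τ x + k := fun k x hx => by
    simpa using apply_zIter_eq_add hm hm' hfg hτ k hx
  have hinv : ∀ φ : EuclideanSpace ℂ (Fin n) → ℂ,
      (∀ x ∈ ball (0 : EuclideanSpace ℂ (Fin n)) 1, φ (γ x) = φ x) →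
      ∀ σ ∈ Γ, ∀ x ∈ ball (0 : EuclideanSpace ℂ (Fin n)) 1, φ (σ x) = φ x := fun φ hφ σ hσ x hx =>
    apply_eq_of_generator hm hm' hfg hall hφ hσ hx
  have hGd : ∀ (N : ℝ) (t : ℂ) (f : EuclideanSpace ℂ (Fin n) → ℂ), 0 < N →
      DifferentiableOn ℂ f (ball (0 : EuclideanSpace ℂ (Fin n)) 1) →
      (∀ x ∈ ball (0 : EuclideanSpace ℂ (Fin n)) 1, ‖f x‖ ≤ 1) →
      DifferentiableOn ℂ (gaussSeries (zIter γ γ') τ N t f)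
        (ball (0 : EuclideanSpace ℂ (Fin n)) 1) := fun N t f hN hf hf1 =>
    differentiableOn_gaussSeries isOpen_ball hmaps hdiff hτd hN hf hf1
  have hGi : ∀ (N : ℝ) (t : ℂ) (f : EuclideanSpace ℂ (Fin n) → ℂ),
      ∀ σ ∈ Γ, ∀ x ∈ ball (0 : EuclideanSpace ℂ (Fin n)) 1,
      gaussSeries (zIter γ γ') τ N t f (σ x) = gaussSeries (zIter γ γ') τ N t f x :=
    fun N t f => hinv _ fun x hx => gaussSeries_apply_generator hgf hτ hx
  have hGval : ∀ (N : ℝ) (t : ℂ) (f : EuclideanSpace ℂ (Fin n) → ℂ) (x), τ x = t →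
      gaussSeries (zIter γ γ') τ N t f x =
        ∑' k : ℤ, f (zIter γ γ' k x) * Complex.exp (-N * (k : ℂ) ^ 2) := by
    intro N t f x hx
    simp [gaussSeries, hx]
  have hexp : ∀ s : ℂ, Complex.exp s = 1 →
      DifferentiableOn ℂ (fun x => Complex.exp (s * τ x)) (ball (0 : EuclideanSpace ℂ (Fin n)) 1) ∧
      ∀ σ ∈ Γ, ∀ x ∈ ball (0 : EuclideanSpace ℂ (Fin n)) 1,
        Complex.exp (s * τ (σ x)) = Complex.exp (s * τ x) := by
    intro s hs
    refine ⟨(hτd.const_mul s).cexp, hinv (fun x => Complex.exp (s * τ x)) fun x hx => ?_⟩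
    simp only [hτ x hx, mul_add, mul_one, Complex.exp_add, hs]
  constructor
  · intro z hz w hw hne
    by_cases hzw : Complex.exp (2 * Real.pi * Complex.I * τ w) =
        Complex.exp (2 * Real.pi * Complex.I * τ z)
    · obtain ⟨m, hm⟩ := Complex.exp_eq_exp_iff_exists_int.1 hzw
      have hm' : τ w = τ z + m := by
        have h2 : (2 * Real.pi * Complex.I : ℂ) ≠ 0 := Complex.two_pi_I_ne_zero
        apply mul_left_cancel₀ h2
        rw [hm]
        ring
      set w' := zIter γ γ' (-m) w with hw'
      have hw'B : w' ∈ ball 0 1 := hmaps (-m) hw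
      have hτw' : τ w' = τ z := by
        rw [hw', hτk _ _ hw, hm']
        push_cast
        ring
      have hww' : w' ≠ z := by
        intro h
        obtain ⟨σ, hσ, hσ1, -⟩ := hgrp.inv_mem _ (hmem (-m))
        refine hne σ hσ ?_
        rw [← h]
        exact hσ1 hw
      obtain ⟨i, hi⟩ : ∃ i, w' i ≠ z i := by
        by_contra! hcon
        exact hww' (by ext i; exact hcon i)
      have hpos : 0 < ‖w' i - z i‖ := norm_pos_iff.2 (sub_ne_zero.2 hi)
      obtain ⟨N, hN, hNb⟩ := exists_norm_tsum_gaussian_sub_le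
        (ε := ‖w' i - z i‖ / 3) (by positivity)
      have hf1 : ∀ x ∈ ball (0 : EuclideanSpace ℂ (Fin n)) 1, ‖x i‖ ≤ 1 := fun x hx =>
        (PiLp.norm_apply_le x i).trans (mem_ball_zero_iff.1 hx).le
      have hfd : DifferentiableOn ℂ (fun x : EuclideanSpace ℂ (Fin n) => x i)
          (ball (0 : EuclideanSpace ℂ (Fin n)) 1) :=
        (EuclideanSpace.proj (𝕜 := ℂ) i).differentiable.differentiableOn
      refine ⟨gaussSeries (zIter γ γ') τ N (τ z) (fun x => x i),
          hGd N _ _ hN hfd hf1, hGi N _ _, ?_⟩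
      rw [← hGi N (τ z) (fun x => x i) _ (hmem (-m)) w hw]
      intro heq
      have h1 := hNb (fun k => (zIter γ γ' k z) i) fun k => hf1 _ (hmaps k hz)
      have h2 := hNb (fun k => (zIter γ γ' k w') i) fun k => hf1 _ (hmaps k hw'B)
      rw [← hGval N (τ z) (fun x => x i) z rfl] at h1
      rw [← hGval N (τ z) (fun x => x i) w' hτw', ← heq] at h2
      change ‖_ - z i‖ ≤ _ at h1
      change ‖_ - w' i‖ ≤ _ at h2
      set G := gaussSeries (zIter γ γ') τ N (τ z) (fun x => x i) z
      have h3 : w' i - z i = (G - z i) - (G - w' i) := by ring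
      have h4 := norm_sub_le (G - z i) (G - w' i)
      rw [← h3] at h4
      linarith
    · obtain ⟨h1, h2⟩ := hexp (2 * Real.pi * Complex.I) Complex.exp_two_pi_mul_I
      exact ⟨_, h1, h2, Ne.symm hzw⟩
  · intro K hK hKc
    obtain ⟨N, hN, hNb⟩ := exists_norm_tsum_gaussian_sub_le (ε := 1 / 4) (by norm_num)
    obtain ⟨R₀, hR₀⟩ := hKc.exists_bound_of_continuousOn (hτd.continuousOn.mono hK)
    set C₁ := sSup ((fun x => ‖Complex.exp (2 * Real.pi * Complex.I * τ x)‖) '' K)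
    set C₂ := sSup ((fun x => ‖Complex.exp (-(2 * Real.pi * Complex.I) * τ x)‖) '' K)
    set R := R₀ + (1 + max C₁ C₂)
    set u : ℤ → ℝ := fun k => Real.exp (N * R ^ 2) * Real.exp (-(N / 2) * (k : ℝ) ^ 2)
    have hu : Summable u := (summable_exp_neg_mul_sq (by positivity)).mul_left _
    have hu0 : ∀ k, 0 ≤ u k := fun k => by positivity
    have hD : ∀ k : ℤ, ∃ D, ∀ x ∈ K, ‖(1 - ‖zIter γ γ' k x‖)⁻¹‖ ≤ D := fun k => by
      refine hKc.exists_bound_of_continuousOn (ContinuousOn.inv₀ ?_ fun x hx => ?_)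
      · exact continuousOn_const.sub ((hdiff k).continuousOn.mono hK).norm
      · have := mem_ball_zero_iff.1 (hmaps k (hK hx))
        exact (sub_pos.2 this).ne'
    choose D hD using hD
    have hlim : Tendsto (fun s : ℝ => ∑' k : ℤ, min 1 (|s| * |D k|) * u k) (𝓝 0) (𝓝 0) := by
      have h := tendsto_tsum_of_dominated_convergence (𝓕 := 𝓝 (0 : ℝ))
        (f := fun s (k : ℤ) => min 1 (|s| * |D k|) * u k) (g := fun _ => (0 : ℝ)) hu
        (fun k => ?_) (Eventually.of_forall fun s k => ?_)
      · simpa using h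
      · have hc : Continuous fun s : ℝ => min 1 (|s| * |D k|) * u k := by fun_prop
        simpa using hc.tendsto 0
      · have h0 : 0 ≤ min 1 (|s| * |D k|) := le_min zero_le_one (by positivity)
        rw [Real.norm_of_nonneg (mul_nonneg h0 (hu0 k))]
        exact mul_le_of_le_one_left (hu0 k) (min_le_left _ _)
    obtain ⟨δ, hδ, hδb⟩ := Metric.eventually_nhds_iff_ball.1
      (hlim.eventually (gt_mem_nhds (by norm_num : (0 : ℝ) < 1 / 4)))
    refine ⟨closedBall 0 (1 - δ), closedBall_subset_ball (by linarith),
      isCompact_closedBall _ _, ?_⟩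
    rintro z ⟨hz, hzH⟩
    set m : ℤ := -⌊(τ z).re⌋
    set a := zIter γ γ' m z with ha
    have haB : a ∈ ball (0 : EuclideanSpace ℂ (Fin n)) 1 := hmaps m hz
    have ha1 : ‖a‖ < 1 := mem_ball_zero_iff.1 haB
    have haH : ∀ f : EuclideanSpace ℂ (Fin n) → ℂ,
        DifferentiableOn ℂ f (ball (0 : EuclideanSpace ℂ (Fin n)) 1) →
        (∀ σ ∈ Γ, ∀ x ∈ ball (0 : EuclideanSpace ℂ (Fin n)) 1, f (σ x) = f x) →
        ‖f a‖ ≤ sSup ((fun x => ‖f x‖) '' K) := fun f hf hfi => by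
      rw [ha, hfi _ (hmem m) z hz]
      exact hzH f hf hfi
    have hτa : ‖τ a‖ ≤ 1 + max C₁ C₂ := by
      have him : |(τ a).im| ≤ max C₁ C₂ := by
        have e1 := hexp (2 * Real.pi * Complex.I) Complex.exp_two_pi_mul_I
        have e2 := hexp (-(2 * Real.pi * Complex.I))
          (by rw [Complex.exp_neg, Complex.exp_two_pi_mul_I, inv_one])
        have h1 : _ ≤ C₁ := haH _ e1.1 e1.2
        have h2 : _ ≤ C₂ := haH _ e2.1 e2.2
        rw [Complex.norm_exp] at h1 h2
        have h1' := (Real.add_one_le_exp _).trans h1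
        have h2' := (Real.add_one_le_exp _).trans h2
        simp at h1' h2'
        have hpi := Real.pi_gt_three
        have h1m := le_max_left C₁ C₂
        have h2m := le_max_right C₁ C₂
        have h0 : 0 ≤ C₁ := (Real.exp_pos _).le.trans h1
        rw [abs_le]
        constructor
        · by_contra! hcon
          nlinarith
        · by_contra! hcon
          nlinarith
      have hre : |(τ a).re| ≤ 1 := by
        have h : (τ a).re = Int.fract (τ z).re := by
          rw [ha, hτk m z hz, Int.fract]
          simp [m, sub_eq_add_neg]
        rw [h, abs_of_nonneg (Int.fract_nonneg _)]
        exact (Int.fract_lt_one _).le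
      linarith [Complex.norm_le_abs_re_add_abs_im (τ a)]
    have haL : a ∈ closedBall (0 : EuclideanSpace ℂ (Fin n)) (1 - δ) := by
      rw [mem_closedBall_zero_iff]
      by_contra! hcon
      set f : EuclideanSpace ℂ (Fin n) → ℂ := fun x => ((1 - ‖a‖ : ℝ) : ℂ) / (1 - inner ℂ a x)
      have hin : ∀ x, ‖inner ℂ a x‖ ≤ ‖a‖ * ‖x‖ := fun x => norm_inner_le_norm a x
      have hge : ∀ x, 1 - ‖a‖ * ‖x‖ ≤ ‖1 - inner ℂ a x‖ := fun x => by
        have := norm_sub_norm_le (1 : ℂ) (inner ℂ a x)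
        rw [norm_one] at this
        linarith [hin x]
      have hfn : ∀ x, ‖f x‖ = (1 - ‖a‖) / ‖1 - inner ℂ a x‖ := fun x => by
        rw [norm_div, Complex.norm_real, Real.norm_of_nonneg (by linarith)]
      have hfd : DifferentiableOn ℂ f (ball (0 : EuclideanSpace ℂ (Fin n)) 1) := by
        intro x hx
        have hx1 := mem_ball_zero_iff.1 hx
        have hne : (1 : ℂ) - inner ℂ a x ≠ 0 := by
          rw [← norm_pos_iff]
          nlinarith [hge x, norm_nonneg a, norm_nonneg x]
        have h : DifferentiableAt ℂ (fun x => (1 : ℂ) - inner ℂ a x) x :=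
          (innerSL ℂ a).differentiableAt.const_sub 1
        simp only [f, div_eq_mul_inv]
        exact ((h.fun_inv hne).const_mul _).differentiableWithinAt
      have hf1 : ∀ x ∈ ball (0 : EuclideanSpace ℂ (Fin n)) 1, ‖f x‖ ≤ 1 := fun x hx => by
        have hx1 := mem_ball_zero_iff.1 hx
        rw [hfn]
        refine div_le_one_of_le₀ ?_ (norm_nonneg _)
        nlinarith [hge x, norm_nonneg a, norm_nonneg x]
      have hfa : 1 / 2 ≤ ‖f a‖ := by
        have hpos : 0 < 1 - ‖a‖ ^ 2 := by nlinarith [norm_nonneg a]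
        have h : ‖1 - inner ℂ a a‖ = 1 - ‖a‖ ^ 2 := by
          have h' : 1 - inner ℂ a a = ((1 - ‖a‖ ^ 2 : ℝ) : ℂ) := by
            rw [inner_self_eq_norm_sq_to_K]
            simp
          rw [h', Complex.norm_real, Real.norm_of_nonneg hpos.le]
        rw [hfn, h, le_div_iff₀ hpos]
        nlinarith [norm_nonneg a]
      have hG := hδb (1 - ‖a‖) (by
        rw [mem_ball_zero_iff, Real.norm_of_nonneg (by linarith)]
        linarith)
      have hsup : sSup ((fun x => ‖gaussSeries (zIter γ γ') τ N (τ a) f x‖) '' K) ≤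
          ∑' k : ℤ, min 1 (|1 - ‖a‖| * |D k|) * u k := by
        have hnn : ∀ k, 0 ≤ min 1 (|1 - ‖a‖| * |D k|) * u k := fun k =>
          mul_nonneg (le_min zero_le_one (by positivity)) (hu0 k)
        refine Real.sSup_le ?_ (tsum_nonneg hnn)
        rintro _ ⟨x, hx, rfl⟩
        refine tsum_of_norm_bounded (Summable.hasSum ?_) fun k => ?_
        · exact Summable.of_nonneg_of_le hnn
            (fun k => mul_le_of_le_one_left (hu0 k) (min_le_left _ _)) hu
        · have hτx : ‖τ x - τ a‖ ≤ R := (norm_sub_le _ _).trans (add_le_add (hR₀ x hx) hτa)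
          refine norm_gaussSeries_term_le hN hτx (le_min (hf1 _ (hmaps k (hK hx))) ?_) k
          have hk1 := mem_ball_zero_iff.1 (hmaps k (hK hx))
          have hk2 : 1 - ‖zIter γ γ' k x‖ ≤ ‖1 - inner ℂ a (zIter γ γ' k x)‖ := by
            nlinarith [hge (zIter γ γ' k x), norm_nonneg (zIter γ γ' k x)]
          rw [hfn, abs_of_nonneg (by linarith : 0 ≤ 1 - ‖a‖), div_eq_mul_inv]
          refine mul_le_mul_of_nonneg_left ?_ (by linarith)
          refine (inv_anti₀ (by linarith) hk2).trans ?_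
          exact (le_abs_self _).trans ((hD k x hx).trans (le_abs_self _))
      have h1 := haH _ (hGd N (τ a) f hN hfd hf1) (hGi N (τ a) f)
      have h2 := hNb (fun k => f (zIter γ γ' k a)) fun k => hf1 _ (hmaps k haB)
      rw [← hGval N (τ a) f a rfl] at h2
      change ‖_ - f a‖ ≤ _ at h2
      have h3 := norm_sub_norm_le (f a) (gaussSeries (zIter γ γ') τ N (τ a) f a)
      rw [norm_sub_rev] at h3
      linarith
    obtain ⟨σ, hσ, hσ1, -⟩ := hgrp.inv_mem _ (hmem m)
    exact mem_biUnion hσ ⟨a, haL, hσ1 hz⟩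
section Lorentz

variable {H : Type*} [NormedAddCommGroup H] [InnerProductSpace ℂ H]

open ComplexConjugate

/-- The Lorentzian sesquilinear form of signature `(dim H, 1)` on `H × ℂ`. -/
def lorentzForm (u v : H × ℂ) : ℂ := inner ℂ u.1 v.1 - conj u.2 * v.2

@[simp] lemma lorentzForm_add_right (u v w : H × ℂ) :
    lorentzForm u (v + w) = lorentzForm u v + lorentzForm u w := by
  simp only [lorentzForm, Prod.fst_add, Prod.snd_add, inner_add_right]
  ring

@[simp] lemma lorentzForm_add_left (u v w : H × ℂ) :
    lorentzForm (u + v) w = lorentzForm u w + lorentzForm v w := by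
  simp only [lorentzForm, Prod.fst_add, Prod.snd_add, inner_add_left, map_add]
  ring

@[simp] lemma lorentzForm_smul_right (c : ℂ) (u v : H × ℂ) :
    lorentzForm u (c • v) = c * lorentzForm u v := by
  simp only [lorentzForm, Prod.smul_fst, Prod.smul_snd, inner_smul_right, smul_eq_mul]
  ring

@[simp] lemma lorentzForm_smul_left (c : ℂ) (u v : H × ℂ) :
    lorentzForm (c • u) v = conj c * lorentzForm u v := by
  simp only [lorentzForm, Prod.smul_fst, Prod.smul_snd, inner_smul_left, smul_eq_mul, map_mul]
  ring

@[simp] lemma lorentzForm_sub_right (u v w : H × ℂ) :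
    lorentzForm u (v - w) = lorentzForm u v - lorentzForm u w := by
  simp only [lorentzForm, Prod.fst_sub, Prod.snd_sub, inner_sub_right]
  ring

@[simp] lemma lorentzForm_sub_left (u v w : H × ℂ) :
    lorentzForm (u - v) w = lorentzForm u w - lorentzForm v w := by
  simp only [lorentzForm, Prod.fst_sub, Prod.snd_sub, inner_sub_left, map_sub]
  ring

lemma conj_lorentzForm (u v : H × ℂ) : conj (lorentzForm u v) = lorentzForm v u := by
  simp only [lorentzForm, map_sub, inner_conj_symm, map_mul, Complex.conj_conj]
  ring

lemma lorentzForm_self (v : H × ℂ) :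
    lorentzForm v v = ((‖v.1‖ ^ 2 - ‖v.2‖ ^ 2 : ℝ) : ℂ) := by
  rw [lorentzForm, inner_self_eq_norm_sq_to_K, Complex.conj_mul']
  simp

/-- The linear functional `v ↦ lorentzForm u v`. -/
def lorentzDual (u : H × ℂ) : (H × ℂ) →ₗ[ℂ] ℂ where
  toFun := lorentzForm u
  map_add' := lorentzForm_add_right u
  map_smul' c v := by simp

lemma lorentzDual_apply (u v : H × ℂ) : lorentzDual u v = lorentzForm u v := rfl

/-- The action on `H` of a linear map of `H × ℂ` by fractional linear transformations. -/
def projAction (T : (H × ℂ) →ₗ[ℂ] (H × ℂ)) (x : H) : H := (T (x, 1)).2⁻¹ • (T (x, 1)).1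

lemma snd_ne_zero_of_norm_lt {F : Type*} [NormedAddCommGroup F] {v : F × ℂ} (hv : ‖v.1‖ < ‖v.2‖) :
    v.2 ≠ 0 :=
  norm_pos_iff.1 ((norm_nonneg _).trans_lt hv)

section Isometry

variable {T : (H × ℂ) →ₗ[ℂ] (H × ℂ)} (hT : ∀ u v, lorentzForm (T u) (T v) = lorentzForm u v)

include hT

lemma norm_fst_lt_norm_snd {v : H × ℂ} (hv : ‖v.1‖ < ‖v.2‖) : ‖(T v).1‖ < ‖(T v).2‖ := by
  have h := hT v v
  rw [lorentzForm_self, lorentzForm_self] at h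
  have h' : ‖(T v).1‖ ^ 2 - ‖(T v).2‖ ^ 2 = ‖v.1‖ ^ 2 - ‖v.2‖ ^ 2 := by exact_mod_cast h
  nlinarith [norm_nonneg (T v).1, norm_nonneg (T v).2, norm_nonneg v.1, norm_nonneg v.2]

lemma snd_apply_ne_zero {x : H} (hx : x ∈ ball (0 : H) 1) : (T (x, 1)).2 ≠ 0 :=
  snd_ne_zero_of_norm_lt (norm_fst_lt_norm_snd hT (by simpa using hx))

lemma apply_eq_smul_projAction {x : H} (hx : x ∈ ball (0 : H) 1) :
    T (x, 1) = (T (x, 1)).2 • (projAction T x, (1 : ℂ)) := by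
  have h := snd_apply_ne_zero hT hx
  ext <;> simp [projAction, smul_smul, h]

lemma projAction_mapsTo : MapsTo (projAction T) (ball (0 : H) 1) (ball (0 : H) 1) := by
  intro x hx
  have h := norm_fst_lt_norm_snd hT (v := (x, 1)) (by simpa using hx)
  rw [mem_ball_zero_iff, projAction, norm_smul, norm_inv,
    inv_mul_lt_iff₀ ((norm_nonneg _).trans_lt h), mul_one]
  exact h

lemma projAction_differentiableOn [FiniteDimensional ℂ H] :
    DifferentiableOn ℂ (projAction T) (ball (0 : H) 1) := by
  intro x hx
  have h : DifferentiableAt ℂ (fun y : H => T (y, 1)) x :=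
    (LinearMap.toContinuousLinearMap T).differentiableAt.comp x
      (differentiableAt_id.prodMk (differentiableAt_const _))
  exact ((h.snd.fun_inv (snd_apply_ne_zero hT hx)).smul h.fst).differentiableWithinAt

end Isometry

lemma projAction_eq_of_apply_eq {T : (H × ℂ) →ₗ[ℂ] (H × ℂ)} {x y : H} {c : ℂ} (hc : c ≠ 0)
    (h : T (x, 1) = c • (y, (1 : ℂ))) : projAction T x = y := by
  simp [projAction, h, smul_smul, hc]

/-- The Lorentzian reflection in the hyperplane orthogonal to `d`. -/
def lorentzReflection (d : H × ℂ) : (H × ℂ) →ₗ[ℂ] (H × ℂ) :=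
  LinearMap.id - ((2 / lorentzForm d d) • lorentzDual d).smulRight d

lemma lorentzReflection_apply (d v : H × ℂ) :
    lorentzReflection d v = v - (2 / lorentzForm d d * lorentzForm d v) • d := by
  simp [lorentzReflection, lorentzDual_apply]

lemma lorentzForm_lorentzReflection {d : H × ℂ} (hd : lorentzForm d d ≠ 0) (u v : H × ℂ) :
    lorentzForm (lorentzReflection d u) (lorentzReflection d v) = lorentzForm u v := by
  simp only [lorentzReflection_apply, lorentzForm_sub_left, lorentzForm_sub_right,
    lorentzForm_smul_left, lorentzForm_smul_right, map_mul, map_div₀, map_ofNat, conj_lorentzForm]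
  field_simp
  ring

lemma lorentzReflection_lorentzReflection {d : H × ℂ} (hd : lorentzForm d d ≠ 0) (v : H × ℂ) :
    lorentzReflection d (lorentzReflection d v) = v := by
  simp only [lorentzReflection_apply, lorentzForm_sub_right, lorentzForm_smul_right]
  rw [sub_sub, ← add_smul]
  convert sub_zero v
  convert zero_smul ℂ d
  field_simp
  ring

/-- Every point of the ball is mapped to the centre by a linear Lorentzian involution. -/
lemma exists_involution_projAction_eq_zero {b : H} (hb : b ∈ ball (0 : H) 1) :
    ∃ R : (H × ℂ) →ₗ[ℂ] (H × ℂ), (∀ u v, lorentzForm (R u) (R v) = lorentzForm u v) ∧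
      (∀ v, R (R v) = v) ∧ projAction R b = 0 := by
  have hb1 : 0 < 1 - ‖b‖ ^ 2 := by
    have := mem_ball_zero_iff.1 hb
    nlinarith [norm_nonneg b]
  set s : ℝ := √(1 - ‖b‖ ^ 2)
  have hs : 0 < s := Real.sqrt_pos.2 hb1
  have hs2 : s ^ 2 = 1 - ‖b‖ ^ 2 := Real.sq_sqrt hb1.le
  have hsc : (s : ℂ) ^ 2 = 1 - (‖b‖ : ℂ) ^ 2 := by exact_mod_cast hs2
  have hs0 : (s : ℂ) ≠ 0 := by exact_mod_cast hs.ne'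
  have hs1 : (1 + s : ℂ) ≠ 0 := by
    have : (1 + s : ℝ) ≠ 0 := by positivity
    exact_mod_cast this
  set d : H × ℂ := (b, (1 : ℂ)) + (s : ℂ) • ((0 : H), (1 : ℂ)) with hd
  have h1 : lorentzForm d d = -2 * s * (1 + s) := by
    rw [lorentzForm_self, Complex.ofReal_sub, Complex.ofReal_pow, Complex.ofReal_pow]
    have : ‖d.2‖ = 1 + s := by
      have h : d.2 = ((1 + s : ℝ) : ℂ) := by simp [hd]
      rw [h, Complex.norm_real, Real.norm_of_nonneg (by positivity)]
    rw [this]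
    simp [hd]
    linear_combination hsc
  have h2 : lorentzForm d (b, 1) = - s * (1 + s) := by
    simp [lorentzForm, hd, inner_self_eq_norm_sq_to_K]
    linear_combination hsc
  have h0 : lorentzForm d d ≠ 0 := by
    rw [h1]
    exact mul_ne_zero (mul_ne_zero (by norm_num) hs0) hs1
  refine ⟨lorentzReflection d, lorentzForm_lorentzReflection h0,
    lorentzReflection_lorentzReflection h0, ?_⟩
  refine projAction_eq_of_apply_eq (c := -s) (neg_ne_zero.2 hs0) ?_
  have h3 : 2 / lorentzForm d d * lorentzForm d (b, 1) = 1 := by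
    rw [h1, h2]
    field_simp
  rw [lorentzReflection_apply, h3, one_smul, hd]
  ext <;> simp

/-- A holomorphic automorphism of the ball fixing the centre is linear and isometric. -/
lemma exists_linearIsometry_of_map_zero {g h : H → H}
    (hg : DifferentiableOn ℂ g (ball 0 1)) (hh : DifferentiableOn ℂ h (ball 0 1))
    (hgm : MapsTo g (ball 0 1) (ball 0 1)) (hhm : MapsTo h (ball 0 1) (ball 0 1))
    (hhg : EqOn (h ∘ g) id (ball 0 1)) (hg0 : g 0 = 0) (hh0 : h 0 = 0) :
    ∃ L : H →ₗᵢ[ℂ] H, ∀ x ∈ ball (0 : H) 1, g x = L x := by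
  have hnorm : ∀ x ∈ ball (0 : H) 1, ‖g x‖ = ‖x‖ := by
    intro x hx
    refine le_antisymm (Complex.norm_le_norm_of_mapsTo_ball hg
      (hgm.mono_right ball_subset_closedBall) hg0 (mem_ball_zero_iff.1 hx)) ?_
    have := Complex.norm_le_norm_of_mapsTo_ball hh
      (hhm.mono_right ball_subset_closedBall) hh0 (mem_ball_zero_iff.1 (hgm hx))
    rwa [show h (g x) = x from hhg hx] at this
  set L := fderiv ℂ g 0
  have hL : HasFDerivAt g L 0 := (hg.differentiableAt (ball_mem_nhds _ one_pos)).hasFDerivAt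
  have hline : ∀ p : H, ‖p‖ = 1 → ∀ t ∈ ball (0 : ℂ) 1, g (t • p) = L (t • p) := by
    intro p hp
    have hmem : ∀ t ∈ ball (0 : ℂ) 1, t • p ∈ ball (0 : H) 1 := fun t ht => by
      simpa [norm_smul, hp] using ht
    have hd : DifferentiableOn ℂ (fun t : ℂ => g (t • p)) (ball 0 1) :=
      hg.comp (differentiable_id.smul_const p).differentiableOn hmem
    have hhalf : (1 / 2 : ℂ) ∈ ball (0 : ℂ) 1 := by simp; norm_num
    have hmaps : MapsTo (fun t : ℂ => g (t • p)) (ball 0 1)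
        (closedBall ((fun t : ℂ => g (t • p)) 0) 1) := by
      intro t ht
      simpa [hg0] using (mem_ball_zero_iff.1 (hgm (hmem t ht))).le
    have : StrictConvexSpace ℝ H := by
      let _ := InnerProductSpace.complexToReal (G := H)
      infer_instance
    obtain ⟨C, -, hC⟩ := Complex.affine_of_mapsTo_ball_of_exists_norm_dslope_eq_div' hd hmaps
      ⟨1 / 2, hhalf, by
        rw [dslope_of_ne _ (by norm_num), slope_def_module]
        simp only [zero_smul, hg0, sub_zero, norm_smul, hnorm _ (hmem _ hhalf), hp]
        norm_num⟩
    have h1 : HasDerivAt (fun t : ℂ => g (t • p)) (L p) 0 := by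
      have h2 : HasDerivAt (fun t : ℂ => t • p) p 0 := by
        simpa using (hasDerivAt_id (0 : ℂ)).smul_const p
      have h3 : HasFDerivAt g L ((0 : ℂ) • p) := by simpa using hL
      exact h3.comp_hasDerivAt 0 h2
    have h2 : HasDerivAt (fun t : ℂ => g (t • p)) C 0 := by
      have h3 : HasDerivAt (fun t : ℂ => t • C) C 0 := by
        simpa using (hasDerivAt_id (0 : ℂ)).smul_const C
      refine h3.congr_of_eventuallyEq ?_
      filter_upwards [ball_mem_nhds (0 : ℂ) one_pos] with t ht
      simpa [hg0] using hC ht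
    have h3 : C = L p := h2.unique h1
    intro t ht
    have := hC ht
    simpa [hg0, h3] using this
  have heq : ∀ x ∈ ball (0 : H) 1, g x = L x := by
    intro x hx
    rcases eq_or_ne x 0 with rfl | hx0
    · simp [hg0]
    · have hxn : (‖x‖ : ℂ) ≠ 0 := by simpa using hx0
      have := hline ((‖x‖ : ℂ)⁻¹ • x) (by simp [norm_smul, hx0]) ‖x‖ (by simpa using hx)
      simpa [smul_smul, hxn] using this
  have hLn : ∀ x, ‖L x‖ = ‖x‖ := by
    intro x
    set c : ℂ := ((2 * (‖x‖ + 1) : ℝ) : ℂ)⁻¹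
    have hpos : (0 : ℝ) < 2 * (‖x‖ + 1) := by positivity
    have hcn : ‖c‖ = (2 * (‖x‖ + 1))⁻¹ := by
      rw [norm_inv, Complex.norm_real, Real.norm_of_nonneg hpos.le]
    have hc : 0 < ‖c‖ := by
      rw [hcn]
      positivity
    have hcx : c • x ∈ ball (0 : H) 1 := by
      rw [mem_ball_zero_iff, norm_smul, hcn, inv_mul_lt_iff₀ hpos]
      linarith [norm_nonneg x]
    have h := hnorm _ hcx
    rw [heq _ hcx, map_smul, norm_smul, norm_smul] at h
    exact mul_left_cancel₀ hc.ne' h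
  exact ⟨⟨L.toLinearMap, hLn⟩, heq⟩

/-- Every holomorphic automorphism of the ball is induced by a linear Lorentzian isometry. -/
theorem exists_lorentzIsometry_of_automorphism [FiniteDimensional ℂ H] {γ γ' : H → H}
    (hγ : DifferentiableOn ℂ γ (ball 0 1)) (hγ' : DifferentiableOn ℂ γ' (ball 0 1))
    (hm : MapsTo γ (ball 0 1) (ball 0 1)) (hm' : MapsTo γ' (ball 0 1) (ball 0 1))
    (hgf : EqOn (γ' ∘ γ) id (ball 0 1)) :
    ∃ A : (H × ℂ) →ₗ[ℂ] (H × ℂ), (∀ u v, lorentzForm (A u) (A v) = lorentzForm u v) ∧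
      ∀ x ∈ ball (0 : H) 1, projAction A x = γ x := by
  have h0 : (0 : H) ∈ ball (0 : H) 1 := mem_ball_self one_pos
  obtain ⟨R, hR, hRR, hRb⟩ := exists_involution_projAction_eq_zero (hm h0)
  have hρm := projAction_mapsTo hR
  have hρd := projAction_differentiableOn hR
  have hρρ : ∀ x ∈ ball (0 : H) 1, projAction R (projAction R x) = x := by
    intro x hx
    obtain ⟨c, hne, h⟩ : ∃ c : ℂ, c ≠ 0 ∧ R (x, 1) = c • (projAction R x, (1 : ℂ)) :=
      ⟨_, snd_apply_ne_zero hR hx, apply_eq_smul_projAction hR hx⟩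
    refine projAction_eq_of_apply_eq (inv_ne_zero hne) ?_
    have h' := congrArg R h
    rw [hRR, map_smul] at h'
    rw [h', smul_smul, inv_mul_cancel₀ hne, one_smul]
  have hρ0 : projAction R 0 = γ 0 := by simpa [hRb] using hρρ _ (hm h0)
  obtain ⟨L, hL⟩ := exists_linearIsometry_of_map_zero (hρd.comp hγ hm) (hγ'.comp hρd hρm)
    (hρm.comp hm) (hm'.comp hρm) (fun x hx => by
      change γ' (projAction R (projAction R (γ x))) = x
      rw [hρρ _ (hm hx)]
      exact hgf hx) hRb (by
      change γ' (projAction R 0) = 0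
      rw [hρ0]
      exact hgf h0)
  refine ⟨R ∘ₗ LinearMap.prodMap L.toLinearMap LinearMap.id, fun u v => ?_, fun x hx => ?_⟩
  · rw [LinearMap.comp_apply, LinearMap.comp_apply, hR]
    simp [lorentzForm]
  · have h := hL x hx
    change projAction R (γ x) = L x at h
    rw [← hρρ _ (hm hx), h]
    rfl

section Eigenvectors

lemma lorentzForm_eq_zero_iff {p q : H} (hp : ‖p‖ = 1) (hq : ‖q‖ = 1) :
    lorentzForm (p, 1) (q, 1) = 0 ↔ p = q := by
  rw [← inner_eq_one_iff_of_norm_eq_one (𝕜 := ℂ) hp hq, lorentzForm, map_one, one_mul, sub_eq_zero]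

lemma lorentzForm_ne_zero {p x : H} (hp : ‖p‖ = 1) (hx : x ∈ ball (0 : H) 1) :
    lorentzForm (p, 1) (x, 1) ≠ 0 := by
  intro h
  rw [lorentzForm, map_one, one_mul, sub_eq_zero] at h
  have h1 := norm_inner_le_norm (𝕜 := ℂ) p x
  rw [h, hp, norm_one, one_mul] at h1
  exact h1.not_gt (mem_ball_zero_iff.1 hx)

/-- A null vector orthogonal to a null vector is proportional to it. -/
lemma eq_smul_of_lorentzForm_eq_zero {p : H} {v : H × ℂ} (hp : ‖p‖ = 1)
    (hv : lorentzForm v v = 0) (hpv : lorentzForm (p, 1) v = 0) : v = v.2 • (p, (1 : ℂ)) := by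
  have h1 : inner ℂ p v.1 = v.2 := by
    simpa [lorentzForm, sub_eq_zero] using hpv
  have h2 : inner ℂ v.1 v.1 = conj v.2 * v.2 := by
    simpa [lorentzForm, sub_eq_zero] using hv
  have h3 : inner ℂ (v.1 - v.2 • p) (v.1 - v.2 • p) = 0 := by
    have h4 : inner ℂ p p = (1 : ℂ) := by simp [inner_self_eq_norm_sq_to_K, hp]
    have h5 : inner ℂ v.1 p = conj v.2 := by rw [← h1, inner_conj_symm]
    simp only [inner_sub_left, inner_sub_right, inner_smul_left, inner_smul_right, h1, h2, h4, h5]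
    ring
  ext
  · simpa using sub_eq_zero.1 (inner_self_eq_zero.1 h3)
  · simp

/-- A vector orthogonal to a null vector is not timelike. -/
lemma norm_snd_le_norm_fst {p : H} {v : H × ℂ} (hp : ‖p‖ = 1)
    (hpv : lorentzForm (p, 1) v = 0) : ‖v.2‖ ≤ ‖v.1‖ := by
  have h1 : inner ℂ p v.1 = v.2 := by
    simpa [lorentzForm, sub_eq_zero] using hpv
  rw [← h1]
  simpa [hp] using norm_inner_le_norm (𝕜 := ℂ) p v.1

lemma lorentzForm_self_of_norm_eq_one {p : H} (hp : ‖p‖ = 1) :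
    lorentzForm (p, 1) (p, 1) = 0 := (lorentzForm_eq_zero_iff hp hp).2 rfl

lemma norm_lt_of_lorentzForm_re_neg {v : H × ℂ} (hv : (lorentzForm v v).re < 0) :
    ‖v.1‖ < ‖v.2‖ := by
  rw [lorentzForm_self, Complex.ofReal_re] at hv
  nlinarith [norm_nonneg v.1, norm_nonneg v.2]

lemma lorentzForm_self_re_neg {x : H} (hx : x ∈ ball (0 : H) 1) :
    (lorentzForm (x, (1 : ℂ)) (x, 1)).re < 0 := by
  rw [lorentzForm_self, Complex.ofReal_re]
  have := mem_ball_zero_iff.1 hx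
  simp only [norm_one]
  nlinarith [norm_nonneg x]

/-- The span of a null vector `P` and of a vector `v` not orthogonal to it contains a timelike
vector `t • P + v`. -/
lemma exists_smul_add_timelike {P v : H × ℂ} (hP : lorentzForm P P = 0)
    (hv : lorentzForm P v ≠ 0) : ∃ t : ℂ, ‖(t • P + v).1‖ < ‖(t • P + v).2‖ := by
  set g := lorentzForm P v with hg
  set m : ℝ := (lorentzForm v v).re
  have hn : 0 < ‖g‖ ^ 2 := by positivity
  set s : ℝ := (m + 1) / (2 * ‖g‖ ^ 2)
  refine ⟨-(s : ℂ) * g, norm_lt_of_lorentzForm_re_neg ?_⟩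
  have h1 : lorentzForm ((-(s : ℂ) * g) • P + v) ((-(s : ℂ) * g) • P + v) =
      ((-2 * s * ‖g‖ ^ 2 : ℝ) : ℂ) + lorentzForm v v := by
    have h2 : lorentzForm v P = conj g := (conj_lorentzForm P v).symm
    have h3 : conj g * g = (‖g‖ : ℂ) ^ 2 := Complex.conj_mul' g
    simp only [lorentzForm_add_left, lorentzForm_add_right, lorentzForm_smul_left,
      lorentzForm_smul_right, hP, h2, ← hg, map_mul, map_neg, Complex.conj_ofReal]
    push_cast
    linear_combination (-2 * s : ℂ) * h3
  rw [h1, Complex.add_re, Complex.ofReal_re]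
  have h4 : -2 * s * ‖g‖ ^ 2 = -(m + 1) := by
    simp only [s]
    field_simp
  rw [h4]
  change -(m + 1) + m < 0
  linarith

variable {A : (H × ℂ) →ₗ[ℂ] (H × ℂ)}
  (hA : ∀ u v, lorentzForm (A u) (A v) = lorentzForm u v)
  (hfix : ∀ (v : H × ℂ) (κ : ℂ), A v = κ • v → ¬ ‖v.1‖ < ‖v.2‖)

include hA

lemma conj_eigenvalue_mul {u v : H × ℂ} {a b : ℂ} (hu : A u = a • u) (hv : A v = b • v)
    (huv : lorentzForm u v ≠ 0) : conj a * b = 1 := by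
  have h := hA u v
  rw [hu, hv, lorentzForm_smul_left, lorentzForm_smul_right, ← mul_assoc] at h
  exact mul_right_cancel₀ huv (h.trans (one_mul _).symm)

lemma lorentzForm_apply_of_eigenvector {u : H × ℂ} {a b : ℂ} (hu : A u = a • u)
    (hab : conj a * b = 1) (v : H × ℂ) : lorentzForm u (A v) = b * lorentzForm u v := by
  have h := hA u v
  rw [hu, lorentzForm_smul_left] at h
  rw [← h]
  linear_combination (-lorentzForm u (A v)) * hab

include hfix

/-- A Lorentzian isometry without timelike eigenvectors has at most two null eigenlines. -/
lemma eq_or_eq_of_null_eigenvectors {p q r : H} {a b c : ℂ} (hp : ‖p‖ = 1) (hq : ‖q‖ = 1)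
    (hr : ‖r‖ = 1) (hpa : A (p, 1) = a • (p, (1 : ℂ))) (hqb : A (q, 1) = b • (q, (1 : ℂ)))
    (hrc : A (r, 1) = c • (r, (1 : ℂ))) (hpq : p ≠ q) : r = p ∨ r = q := by
  by_contra! hne
  have h1 := conj_eigenvalue_mul hA hpa hqb ((lorentzForm_eq_zero_iff hp hq).not.2 hpq)
  have h2 := conj_eigenvalue_mul hA hrc hpa ((lorentzForm_eq_zero_iff hr hp).not.2 hne.1)
  have h3 := conj_eigenvalue_mul hA hrc hqb ((lorentzForm_eq_zero_iff hr hq).not.2 hne.2)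
  have hab : a = b := mul_left_cancel₀ (left_ne_zero_of_mul_eq_one h2) (h2.trans h3.symm)
  obtain ⟨t, ht⟩ := exists_smul_add_timelike (lorentzForm_self_of_norm_eq_one hp)
    ((lorentzForm_eq_zero_iff hp hq).not.2 hpq)
  refine hfix _ a ?_ ht
  rw [map_add, map_smul, hpa, hqb, ← hab, smul_add, smul_comm]

/-- A fixed-point free automorphism of the ball with a boundary fixed point is holomorphically
semiconjugate to the translation of `ℂ` by `1`. -/
theorem exists_abel_function [FiniteDimensional ℂ H] {p : H} {μ : ℂ} (hp : ‖p‖ = 1)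
    (hpμ : A (p, 1) = μ • (p, (1 : ℂ))) (hμ : μ ≠ 0) :
    ∃ τ : H → ℂ, DifferentiableOn ℂ τ (ball 0 1) ∧
      ∀ x ∈ ball (0 : H) 1, τ (projAction A x) = τ x + 1 := by
  have hdiff : ∀ (ℓ : (H × ℂ) →ₗ[ℂ] ℂ), Differentiable ℂ fun x : H => ℓ (x, 1) := fun ℓ =>
    (LinearMap.toContinuousLinearMap ℓ).differentiable.comp
      (differentiable_id.prodMk (differentiable_const _))
  have hdiv : ∀ (ℓ₁ ℓ₂ : (H × ℂ) →ₗ[ℂ] ℂ) (x : H), ℓ₂ (x, 1) ≠ 0 →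
      DifferentiableAt ℂ (fun x : H => ℓ₁ (x, 1) / ℓ₂ (x, 1)) x := by
    intro ℓ₁ ℓ₂ x hx
    simp only [div_eq_mul_inv]
    exact (hdiff ℓ₁ x).mul ((hdiff ℓ₂ x).fun_inv hx)
  have hquot : ∀ (ℓ₁ ℓ₂ : (H × ℂ) →ₗ[ℂ] ℂ), ∀ x ∈ ball (0 : H) 1,
      ℓ₁ (projAction A x, 1) / ℓ₂ (projAction A x, 1) = ℓ₁ (A (x, 1)) / ℓ₂ (A (x, 1)) := by
    intro ℓ₁ ℓ₂ x hx
    have h := apply_eq_smul_projAction hA hx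
    have hne := snd_apply_ne_zero hA hx
    rw [h, map_smul, map_smul, smul_eq_mul, smul_eq_mul, mul_div_mul_left]
    simpa using hne
  have hP0 := lorentzForm_self_of_norm_eq_one hp
  set P : H × ℂ := (p, 1)
  have hcμ : conj μ ≠ 0 := (map_ne_zero _).2 hμ
  by_cases hμ1 : conj μ * μ = 1
  · have hker : ∀ v, A v = μ • v → lorentzForm P v = 0 := by
      intro v hv
      by_contra hne
      obtain ⟨t, ht⟩ := exists_smul_add_timelike hP0 hne
      refine hfix _ μ ?_ ht
      rw [map_add, map_smul, hpμ, hv, smul_add, smul_comm]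
    obtain ⟨ℓ, hℓ⟩ : ∃ ℓ : (H × ℂ) →ₗ[ℂ] ℂ, ∀ v, ℓ (A v) = μ * (ℓ v + lorentzForm P v) := by
      have h : μ • lorentzDual P ∈ LinearMap.range (A - μ • LinearMap.id).dualMap := by
        rw [LinearMap.range_dualMap_eq_dualAnnihilator_ker, Submodule.mem_dualAnnihilator]
        intro v hv
        have : A v = μ • v := by
          simpa [sub_eq_zero] using hv
        simp [lorentzDual_apply, hker v this]
      obtain ⟨ℓ, hℓ⟩ := h
      refine ⟨ℓ, fun v => ?_⟩
      have h := LinearMap.congr_fun hℓ v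
      simp [lorentzDual_apply] at h
      linear_combination h
    refine ⟨fun x => ℓ (x, 1) / lorentzDual P (x, 1), fun x hx => ?_, fun x hx => ?_⟩
    · exact (hdiv _ _ x (lorentzForm_ne_zero hp hx)).differentiableWithinAt
    · have hne := lorentzForm_ne_zero hp hx
      simp only
      rw [hquot _ _ x hx, hℓ, lorentzDual_apply, lorentzDual_apply,
        lorentzForm_apply_of_eigenvector hA hpμ hμ1, mul_div_mul_left _ _ hμ, add_div,
        div_self hne]
  · set ν : ℂ := (conj μ)⁻¹ with hν
    have hμν : conj μ * ν = 1 := mul_inv_cancel₀ hcμ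
    have hνμ : conj ν * μ = 1 := by
      rw [hν, map_inv₀, Complex.conj_conj, inv_mul_cancel₀ hμ]
    have hPA := lorentzForm_apply_of_eigenvector hA hpμ hμν
    obtain ⟨q, hq0, hq⟩ : ∃ q : H × ℂ, q ≠ 0 ∧ A q = ν • q := by
      by_contra! hcon
      have hinj : Function.Injective (A - ν • LinearMap.id : (H × ℂ) →ₗ[ℂ] (H × ℂ)) := by
        rw [← LinearMap.ker_eq_bot, LinearMap.ker_eq_bot']
        intro v hv
        by_contra hv0
        exact hcon v hv0 (by simpa [sub_eq_zero] using hv)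
      obtain ⟨v, hv⟩ := LinearMap.injective_iff_surjective.1 hinj ((0 : H), (1 : ℂ))
      have h1 : lorentzForm P ((A - ν • LinearMap.id : (H × ℂ) →ₗ[ℂ] (H × ℂ)) v) = 0 := by
        simp [hPA]
      rw [hv] at h1
      simp [lorentzForm, P] at h1
    have hqq : lorentzForm q q = 0 := by
      by_contra hne
      have h1 := conj_eigenvalue_mul hA hq hq hne
      have h2 : μ = ν := mul_left_cancel₀ (left_ne_zero_of_mul_eq_one h1) (hνμ.trans h1.symm)
      exact hμ1 (by rwa [← h2] at hμν)
    have hg : lorentzForm P q ≠ 0 := by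
      intro h
      have h1 := eq_smul_of_lorentzForm_eq_zero hp hqq h
      have h2 : A q = μ • q := by
        rw [h1, map_smul, hpμ, smul_comm]
      have h3 : μ = ν := smul_left_injective ℂ hq0 (h2.symm.trans hq)
      exact hμ1 (by rwa [← h3] at hμν)
    set g := lorentzForm P q
    have hqA := lorentzForm_apply_of_eigenvector hA hq hνμ
    have hcg : conj g ≠ 0 := (map_ne_zero _).2 hg
    have hqP : lorentzForm q P = conj g := (conj_lorentzForm P q).symm
    have hneg : ∀ x ∈ ball (0 : H) 1,
        (conj (lorentzForm q (x, 1)) * lorentzForm P (x, 1) / g).re < 0 := by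
      intro x hx
      have hx' := lorentzForm_self_re_neg hx
      set v : H × ℂ := (x, 1)
      set a := lorentzForm P v
      set b := lorentzForm q v
      set w := v - (b / conj g) • P - (a / g) • q with hw
      have h1 : lorentzForm P w = 0 := by
        simp only [hw, lorentzForm_sub_right, lorentzForm_smul_right, hP0]
        change a - _ - a / g * g = 0
        field_simp
        ring
      have h2 : lorentzForm q w = 0 := by
        simp only [hw, lorentzForm_sub_right, lorentzForm_smul_right, hqq, hqP]
        change b - _ - _ = 0
        field_simp
        ring
      have h3 : v = w + (b / conj g) • P + (a / g) • q := by
        rw [hw]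
        abel
      have h1' : lorentzForm w P = 0 := by rw [← conj_lorentzForm, h1, map_zero]
      have h2' : lorentzForm w q = 0 := by rw [← conj_lorentzForm, h2, map_zero]
      have h4 : lorentzForm v v = lorentzForm w w + (conj b * a / g + conj (conj b * a / g)) := by
        rw [h3]
        simp only [lorentzForm_add_left, lorentzForm_add_right, lorentzForm_smul_left,
          lorentzForm_smul_right, hP0, hqq, h1, h2, h1', h2', hqP, map_div₀, map_mul,
          Complex.conj_conj]
        rw [show lorentzForm P q = g from rfl]
        field_simp
        ring
      have h5 : 0 ≤ (lorentzForm w w).re := by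
        rw [lorentzForm_self, Complex.ofReal_re]
        have := norm_snd_le_norm_fst hp h1
        nlinarith [norm_nonneg w.2]
      rw [h4, Complex.add_re, Complex.add_re, Complex.conj_re] at hx'
      linarith
    have hq_ne : ∀ x ∈ ball (0 : H) 1, lorentzForm q (x, 1) ≠ 0 := by
      intro x hx h
      simpa [h] using hneg x hx
    set W : H → ℂ := fun x => ((-g⁻¹) • lorentzDual P) (x, 1) / lorentzDual q (x, 1)
    have hWre : ∀ x ∈ ball (0 : H) 1, 0 < (W x).re := by
      intro x hx
      have h1 := hneg x hx
      have h2 := hq_ne x hx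
      have h3 : W x = ((‖lorentzForm q (x, 1)‖ ^ 2)⁻¹ : ℝ) *
          -(conj (lorentzForm q (x, 1)) * lorentzForm P (x, 1) / g) := by
        simp only [W, LinearMap.smul_apply, lorentzDual_apply, smul_eq_mul]
        have h4 := Complex.conj_mul' (lorentzForm q (x, 1))
        have h5 : conj (lorentzForm q (x, 1)) ≠ 0 := (map_ne_zero _).2 h2
        push_cast
        rw [← h4]
        field_simp
      rw [h3, Complex.re_ofReal_mul, Complex.neg_re]
      exact mul_pos (by positivity) (by linarith)
    set ρ : ℝ := (‖μ‖ ^ 2)⁻¹ with hρ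
    have hρ0 : 0 < ρ := by positivity
    have hρ1 : ρ ≠ 1 := by
      intro h
      rw [hρ, inv_eq_one] at h
      apply hμ1
      rw [Complex.conj_mul']
      exact_mod_cast h
    have hlog : (Real.log ρ : ℂ) ≠ 0 := by
      exact_mod_cast Real.log_ne_zero_of_pos_of_ne_one hρ0 hρ1
    have hW : ∀ x ∈ ball (0 : H) 1, W (projAction A x) = ρ * W x := by
      intro x hx
      simp only [W]
      rw [hquot _ _ x hx]
      simp only [LinearMap.smul_apply, lorentzDual_apply, smul_eq_mul, hPA, hqA]
      have h2 := hq_ne x hx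
      have h4 : (ρ : ℂ) = (conj μ * μ)⁻¹ := by
        rw [Complex.conj_mul']
        rw [hρ]
        push_cast
        rfl
      rw [h4, hν]
      field_simp
    refine ⟨fun x => Complex.log (W x) / Real.log ρ, fun x hx => ?_, fun x hx => ?_⟩
    · have h1 : DifferentiableAt ℂ W x := hdiv _ _ x (hq_ne x hx)
      simp only [div_eq_mul_inv]
      exact ((h1.clog (Or.inl (hWre x hx))).mul_const _).differentiableWithinAt
    · have h1 : W x ≠ 0 := fun h => by
        have := hWre x hx
        simp [h] at this
      simp only
      rw [hW x hx, Complex.log_ofReal_mul hρ0 h1, add_div, div_self hlog, add_comm]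

end Eigenvectors

end Lorentz
section Dynamics

variable {H : Type*} [NormedAddCommGroup H] {Γ : Set (H → H)} {γ γ' : H → H}

lemma generator_apply_ne (hinf : Γ.Infinite) (hpd : ProperlyDiscontinuousOn (ball (0 : H) 1) Γ)
    (hgf : EqOn (γ' ∘ γ) id (ball (0 : H) 1))
    (hall : ∀ σ ∈ Γ, ∃ k : ℤ, EqOn σ (zIter γ γ' k) (ball (0 : H) 1)) {z : H}
    (hz : z ∈ ball (0 : H) 1) : γ z ≠ z := by
  intro h
  have h' : γ' z = z := by
    have : γ' (γ z) = z := hgf hz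
    rwa [h] at this
  have hk : ∀ k : ℤ, zIter γ γ' k z = z := by
    rintro (k | k)
    · exact Function.iterate_fixed h k
    · exact Function.iterate_fixed h' (k + 1)
  refine hinf ((hpd {z} {z} (by simpa using hz) (by simpa using hz) isCompact_singleton
    isCompact_singleton).subset fun σ hσ => ⟨hσ, z, ⟨z, rfl, ?_⟩, rfl⟩)
  obtain ⟨k, hk'⟩ := hall σ hσ
  rw [hk' hz, hk]

lemma orbitOf_infinite {Ω : Set H} (hmaps : ∀ σ ∈ Γ, MapsTo σ Ω Ω) (hinf : Γ.Infinite)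
    (hpd : ProperlyDiscontinuousOn Ω Γ) {a : H} (ha : a ∈ Ω) : (orbitOf Γ a).Infinite := by
  intro hfin
  refine hinf ((hpd {a} (orbitOf Γ a) (by simpa using ha) ?_ isCompact_singleton
    hfin.isCompact).subset fun σ hσ => ⟨hσ, σ a, ⟨a, rfl, rfl⟩, ⟨σ, hσ, rfl⟩⟩)
  rintro _ ⟨σ, hσ, rfl⟩
  exact hmaps σ hσ ha

lemma norm_eq_one_of_mem_clusterPtsOfOrbit [ProperSpace H]
    (hmaps : ∀ σ ∈ Γ, MapsTo σ (ball (0 : H) 1) (ball 0 1))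
    (hpd : ProperlyDiscontinuousOn (ball (0 : H) 1) Γ) {a b : H} (ha : a ∈ ball (0 : H) 1)
    (hb : b ∈ clusterPtsOfOrbit Γ a) : ‖b‖ = 1 := by
  have hacc : AccPt b (𝓟 (orbitOf Γ a)) := hb
  have hle : b ∈ closedBall (0 : H) 1 := by
    refine closure_minimal ?_ isClosed_closedBall (mem_closure_iff_clusterPt.2 hacc.clusterPt)
    rintro _ ⟨σ, hσ, rfl⟩
    exact ball_subset_closedBall (hmaps σ hσ ha)
  refine le_antisymm (mem_closedBall_zero_iff.1 hle) ?_
  by_contra! hlt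
  obtain ⟨ε, hε, hεb⟩ := nhds_basis_closedBall.mem_iff.1
    (isOpen_ball.mem_nhds (mem_ball_zero_iff.2 hlt))
  refine Set.Infinite.of_accPt (hacc.nhds_inter (closedBall_mem_nhds b hε)) ?_
  refine ((hpd {a} (closedBall b ε) (by simpa using ha) hεb isCompact_singleton
    (isCompact_closedBall b ε)).image fun σ => σ a).subset ?_
  rintro _ ⟨hy, σ, hσ, rfl⟩
  exact ⟨σ, ⟨hσ, σ a, ⟨a, rfl, rfl⟩, hy⟩, rfl⟩

variable [InnerProductSpace ℂ H] {A : (H × ℂ) →ₗ[ℂ] (H × ℂ)}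
  (hA : ∀ u v, lorentzForm (A u) (A v) = lorentzForm u v)

include hA

lemma not_timelike_of_eigenvector (hfix : ∀ x ∈ ball (0 : H) 1, projAction A x ≠ x) {v : H × ℂ}
    {κ : ℂ} (hv : A v = κ • v) : ¬ ‖v.1‖ < ‖v.2‖ := by
  intro hlt
  have h0 := snd_ne_zero_of_norm_lt hlt
  have hx : v.2⁻¹ • v.1 ∈ ball (0 : H) 1 := by
    rw [mem_ball_zero_iff, norm_smul, norm_inv, inv_mul_lt_iff₀ (norm_pos_iff.2 h0), mul_one]
    exact hlt
  have hvx : (v.2⁻¹ • v.1, (1 : ℂ)) = v.2⁻¹ • v := by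
    ext <;> simp [h0]
  have hAx : A (v.2⁻¹ • v.1, (1 : ℂ)) = κ • (v.2⁻¹ • v.1, (1 : ℂ)) := by
    rw [hvx, map_smul, hv, smul_comm]
  have hκ : κ ≠ 0 := by
    rintro rfl
    exact snd_apply_ne_zero hA hx (by simp [hAx])
  exact hfix _ hx (projAction_eq_of_apply_eq hκ hAx)

/-- The function `⟨X, A X⟩ / ⟨X, X⟩`, where `X = (x, 1)`, is invariant under the action of `A`. -/
lemma lorentzForm_div_projAction {x : H} (hx : x ∈ ball (0 : H) 1) :
    lorentzForm (projAction A x, (1 : ℂ)) (A (projAction A x, 1)) /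
      lorentzForm (projAction A x, (1 : ℂ)) (projAction A x, 1) =
    lorentzForm (x, (1 : ℂ)) (A (x, 1)) / lorentzForm (x, (1 : ℂ)) (x, 1) := by
  obtain ⟨c, hc, h⟩ : ∃ c : ℂ, c ≠ 0 ∧ A (x, 1) = c • (projAction A x, (1 : ℂ)) :=
    ⟨_, snd_apply_ne_zero hA hx, apply_eq_smul_projAction hA hx⟩
  have hc' : (starRingEnd ℂ) c ≠ 0 := (map_ne_zero _).2 hc
  rw [← hA (x, 1) (A (x, 1)), ← hA (x, 1) (x, 1), h]
  simp only [map_smul, lorentzForm_smul_left, lorentzForm_smul_right]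
  rw [mul_div_mul_left _ _ hc, mul_div_mul_left _ _ hc']

lemma exists_eigenvalue_of_lorentzForm_eq_zero {b : H} (hb : ‖b‖ = 1)
    (h : lorentzForm (b, (1 : ℂ)) (A (b, 1)) = 0) :
    ∃ μ : ℂ, μ ≠ 0 ∧ A (b, 1) = μ • (b, (1 : ℂ)) := by
  have hnull : lorentzForm (A (b, 1)) (A (b, 1)) = 0 := by
    rw [hA, lorentzForm_self_of_norm_eq_one hb]
  have h1 := eq_smul_of_lorentzForm_eq_zero hb hnull h
  refine ⟨_, fun h0 => ?_, h1⟩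
  rw [h0, zero_smul] at h1
  have h2 := hA (b, 1) (0, 1)
  rw [h1] at h2
  simp [lorentzForm] at h2

/-- The cluster points of the orbits are fixed by (the extension to the sphere of) the
generator. -/
lemma exists_eigenvalue_of_mem_clusterPtsOfOrbit [FiniteDimensional ℂ H]
    (hproj : ∀ x ∈ ball (0 : H) 1, projAction A x = γ x)
    (hm : MapsTo γ (ball 0 1) (ball 0 1)) (hm' : MapsTo γ' (ball 0 1) (ball 0 1))
    (hfg : EqOn (γ ∘ γ') id (ball (0 : H) 1))
    (hall : ∀ σ ∈ Γ, ∃ k : ℤ, EqOn σ (zIter γ γ' k) (ball (0 : H) 1)) {a b : H}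
    (ha : a ∈ ball (0 : H) 1) (hb : b ∈ clusterPtsOfOrbit Γ a) (hb1 : ‖b‖ = 1) :
    ∃ μ : ℂ, μ ≠ 0 ∧ A (b, 1) = μ • (b, (1 : ℂ)) := by
  have hcont : Continuous fun x : H => A (x, 1) :=
    (LinearMap.toContinuousLinearMap A).continuous.comp (by fun_prop)
  have hform : ∀ f g : H → H × ℂ, Continuous f → Continuous g →
      Continuous fun x => lorentzForm (f x) (g x) := by
    intro f g hf hg
    unfold lorentzForm
    fun_prop
  set φ : H → ℂ := fun x => lorentzForm (x, (1 : ℂ)) (A (x, 1)) / lorentzForm (x, (1 : ℂ)) (x, 1)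
    with hφ
  have hinv : ∀ x ∈ ball (0 : H) 1, φ (γ x) = φ x := by
    intro x hx
    rw [← hproj x hx]
    exact lorentzForm_div_projAction hA hx
  have hmem : b ∈ {x : H | lorentzForm (x, (1 : ℂ)) (A (x, 1)) =
      φ a * lorentzForm (x, (1 : ℂ)) (x, 1)} := by
    have hacc : AccPt b (𝓟 (orbitOf Γ a)) := hb
    refine closure_minimal ?_ (isClosed_eq ?_ ?_) (mem_closure_iff_clusterPt.2 hacc.clusterPt)
    · rintro _ ⟨σ, hσ, rfl⟩
      have hσa : σ a ∈ ball (0 : H) 1 := by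
        obtain ⟨k, hk⟩ := hall σ hσ
        rw [hk ha]
        exact zIter_mapsTo hm hm' k ha
      have hne : lorentzForm (σ a, (1 : ℂ)) (σ a, 1) ≠ 0 := fun h => by
        simpa [h] using lorentzForm_self_re_neg hσa
      rw [mem_ofPred_eq, ← apply_eq_of_generator hm hm' hfg hall hinv hσ ha, hφ]
      exact (div_mul_cancel₀ _ hne).symm
    · exact hform _ _ (by fun_prop) hcont
    · exact continuous_const.mul (hform _ _ (by fun_prop) (by fun_prop))
  rw [mem_ofPred_eq, lorentzForm_self_of_norm_eq_one hb1, mul_zero] at hmem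
  exact exists_eigenvalue_of_lorentzForm_eq_zero hA hb1 hmem

end Dynamics

lemma exists_pair_of_at_most_two {X : Type*} [Nonempty X] {S : Set X}
    (h : ∀ p ∈ S, ∀ q ∈ S, ∀ r ∈ S, p ≠ q → r = p ∨ r = q) : ∃ p q : X, S ⊆ {p, q} := by
  rcases S.eq_empty_or_nonempty with rfl | ⟨p, hp⟩
  · obtain ⟨x⟩ := ‹Nonempty X›
    exact ⟨x, x, empty_subset _⟩
  · by_cases hq : ∃ q ∈ S, p ≠ q
    · obtain ⟨q, hq, hpq⟩ := hq
      exact ⟨p, q, fun r hr => h p hp q hq r hr hpq⟩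
    · push Not at hq
      exact ⟨p, p, fun r hr => Or.inl (hq r hr).symm⟩

/-- **Theorem 6.** Let `Γ` be an infinite, cyclic, free, properly discontinuous group of
automorphisms of the unit ball `B ⊂ ℂⁿ`. Then `⋃_{a ∈ D} CΓ_a` has at most two elements,
where `D` is a fundamental domain and `CΓ_a` is the cluster set of the orbit of `a`.
In particular, `B/Γ` is a Stein manifold. -/
theorem ball_cyclic_cluster_set_two_points (n : ℕ)
    (Γ : Set (EuclideanSpace ℂ (Fin n) → EuclideanSpace ℂ (Fin n)))
    (hgrp : IsAutGroupOn (ball (0 : EuclideanSpace ℂ (Fin n)) 1) Γ)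
    (hinf : Γ.Infinite)
    (hcyc : IsCyclicAutGroupOn (ball (0 : EuclideanSpace ℂ (Fin n)) 1) Γ)
    (hfree : FreeActionOn (ball (0 : EuclideanSpace ℂ (Fin n)) 1) Γ)
    (hpd : ProperlyDiscontinuousOn (ball (0 : EuclideanSpace ℂ (Fin n)) 1) Γ) :
    (∀ D : Set (EuclideanSpace ℂ (Fin n)),
      IsFundamentalDomainOn (ball (0 : EuclideanSpace ℂ (Fin n)) 1) Γ D →
      ∃ p q : EuclideanSpace ℂ (Fin n),
        (⋃ a ∈ D, clusterPtsOfOrbit Γ a) ⊆ {p, q}) ∧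
    QuotientIsStein (ball (0 : EuclideanSpace ℂ (Fin n)) 1) Γ := by
  obtain ⟨γ, hγ, γ', hγ', hgf, hfg, hmem, hall⟩ := hcyc
  have hmaps : ∀ σ ∈ Γ, MapsTo σ (ball 0 1) (ball 0 1) := fun σ hσ => (hgrp.aut σ hσ).2.1
  have hm := hmaps γ hγ
  have hm' := hmaps γ' hγ'
  obtain ⟨A, hA, hproj⟩ := exists_lorentzIsometry_of_automorphism (hgrp.aut γ hγ).1
    (hgrp.aut γ' hγ').1 hm hm' hgf
  have hfix : ∀ (v : EuclideanSpace ℂ (Fin n) × ℂ) (κ : ℂ), A v = κ • v → ¬ ‖v.1‖ < ‖v.2‖ :=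
    fun v κ => not_timelike_of_eigenvector hA fun x hx => by
      rw [hproj x hx]
      exact generator_apply_ne hinf hpd hgf hall hx
  have hcl : ∀ a ∈ ball (0 : EuclideanSpace ℂ (Fin n)) 1, ∀ b ∈ clusterPtsOfOrbit Γ a,
      ‖b‖ = 1 ∧ ∃ μ : ℂ, μ ≠ 0 ∧ A (b, 1) = μ • (b, (1 : ℂ)) := fun a ha b hb => by
    have hb1 := norm_eq_one_of_mem_clusterPtsOfOrbit hmaps hpd ha hb
    exact ⟨hb1, exists_eigenvalue_of_mem_clusterPtsOfOrbit hA hproj hm hm' hfg hall ha hb hb1⟩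
  refine ⟨fun D hD => exists_pair_of_at_most_two fun p hp q hq r hr hpq => ?_, ?_⟩
  · obtain ⟨a, ha, hp⟩ := mem_iUnion₂.1 hp
    obtain ⟨b, hb, hq⟩ := mem_iUnion₂.1 hq
    obtain ⟨c, hc, hr⟩ := mem_iUnion₂.1 hr
    obtain ⟨hp1, α, -, hα⟩ := hcl a (hD.1 ha) p hp
    obtain ⟨hq1, β, -, hβ⟩ := hcl b (hD.1 hb) q hq
    obtain ⟨hr1, κ, -, hκ⟩ := hcl c (hD.1 hc) r hr
    exact eq_or_eq_of_null_eigenvectors hA hfix hp1 hq1 hr1 hα hβ hκ hpq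
  · have h0 : (0 : EuclideanSpace ℂ (Fin n)) ∈ ball 0 1 := mem_ball_self one_pos
    obtain ⟨b, -, hb⟩ := (orbitOf_infinite hmaps hinf hpd h0).exists_accPt_of_subset_isCompact
      (isCompact_closedBall (0 : EuclideanSpace ℂ (Fin n)) 1) (by
        rintro _ ⟨σ, hσ, rfl⟩
        exact ball_subset_closedBall (hmaps σ hσ h0))
    obtain ⟨hb1, μ, hμ, hbμ⟩ := hcl 0 h0 b hb
    obtain ⟨τ, hτd, hτ⟩ := exists_abel_function hA hfix hb1 hbμ hμ
    exact quotientIsStein_of_abel hgrp hγ hγ' hgf hfg hmem hall hτd fun x hx => by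
      rw [← hproj x hx, hτ x hx]

end
end
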